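/- arXiv:0903.3295 — 2 statements merged into one kernel-verified Lean document; each statement's English description precedes it below -/
import Mathlib

section
/- Let A = ⊕_{n≥0} A_n be a well-graded self-injective positively graded finite-dimensional k-algebra with c ≥ 1. Then there is an equivalence of categories A-gr ≃ T(b(A))-gr, where T(b(A)) = b(A) ⋉ D(b(A)) is the trivial extension algebra of the Beilinson algebra b(A), graded with deg b(A) = 0 and deg D(b(A)) = 1. -/
/-!
STATEMENT 0: Let `A = ⊕_{n≥0} A_n` be a well-graded self-injective positively graded
finite-dimensional `k`-algebra with `c ≥ 1`.  Then there is an equivalence of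
categories `A-gr ≃ T(b(A))-gr`, where `T(b(A)) = b(A) ⋉ D(b(A))` is the trivial
extension of the Beilinson algebra `b(A)`, graded with `b(A)` in degree `0` and
`D(b(A))` in degree `1`.
-/

open CategoryTheory MulOpposite
set_option synthInstance.maxHeartbeats 1000000
set_option maxHeartbeats 1000000
set_option linter.unusedVariables false

/-- The category of finite-dimensional `ℤ`-graded left modules (with degree-preserving
morphisms) over an algebra `A` graded by `𝒜 : ℕ → Submodule k A`. -/
structure GrMod (k : Type) [Field k] (A : Type) [Ring A] [Algebra k A]
    (𝒜 : ℕ → Submodule k A) : Type 1 where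
  carrier : Type
  [acg : AddCommGroup carrier]
  [modA : Module A carrier]
  [modk : Module k carrier]
  [tower : IsScalarTower k A carrier]
  [fd : FiniteDimensional k carrier]
  grading : ℤ → Submodule k carrier
  internal : DirectSum.IsInternal grading
  smul_mem : ∀ (i : ℕ) (j : ℤ) (a : A) (m : carrier),
    a ∈ 𝒜 i → m ∈ grading j → a • m ∈ grading (i + j)

attribute [instance] GrMod.acg GrMod.modA GrMod.modk GrMod.tower GrMod.fd

instance GrMod.instCategory {k : Type} [Field k] {A : Type} [Ring A] [Algebra k A]
    {𝒜 : ℕ → Submodule k A} : CategoryTheory.Category (GrMod k A 𝒜) where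
  Hom M N := {f : M.carrier →ₗ[A] N.carrier // ∀ (j : ℤ), ∀ m ∈ M.grading j, f m ∈ N.grading j}
  id M := ⟨LinearMap.id, fun _ _ hm => hm⟩
  comp f g := ⟨g.1.comp f.1, fun j m hm => g.2 j _ (f.2 j m hm)⟩

section Dual
variable (k : Type) [Field k] (B : Type) [Ring B] [Algebra k B]

/-- The left `B`-action on `D(B) = Hom_k(B,k)`: `(b • f) y = f (y * b)`. -/
noncomputable instance dualLeftModule : Module B (Module.Dual k B) where
  smul b f := f.comp (LinearMap.mulRight k b)
  one_smul f := by ext y; show f (y * 1) = f y; rw [mul_one]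
  mul_smul b b' f := by ext y; show f (y * (b * b')) = f (y * b * b'); rw [mul_assoc]
  smul_zero b := rfl
  smul_add b f g := rfl
  add_smul b b' f := by ext y; show f (y * (b + b')) = f (y * b) + f (y * b'); rw [mul_add, map_add]
  zero_smul f := by ext y; show f (y * 0) = 0; rw [mul_zero, map_zero]

/-- The right `B`-action on `D(B)`: `(f • b) y = f (b * y)`. -/
noncomputable instance dualRightModule : Module Bᵐᵒᵖ (Module.Dual k B) where
  smul b f := f.comp (LinearMap.mulLeft k (unop b))
  one_smul f := by ext y; show f (1 * y) = f y; rw [one_mul]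
  mul_smul b b' f := by
    ext y; show f ((unop b' * unop b) * y) = f (unop b' * (unop b * y)); rw [mul_assoc]
  smul_zero b := rfl
  smul_add b f g := rfl
  add_smul b b' f := by
    ext y; show f ((unop b + unop b') * y) = f (unop b * y) + f (unop b' * y)
    rw [add_mul, map_add]
  zero_smul f := by ext y; show f (0 * y) = 0; rw [zero_mul, map_zero]

instance : SMulCommClass B Bᵐᵒᵖ (Module.Dual k B) where
  smul_comm b b' f := by
    ext y; show f (unop b' * (y * b)) = f ((unop b' * y) * b); rw [mul_assoc]

instance : IsScalarTower k B (Module.Dual k B) where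
  smul_assoc r b f := by
    ext y; show f (y * (r • b)) = r • f (y * b)
    rw [mul_smul_comm, map_smul]

instance : IsScalarTower k Bᵐᵒᵖ (Module.Dual k B) where
  smul_assoc r b f := by
    ext y
    show f ((unop (r • b)) * y) = r • f (unop b * y)
    rw [unop_smul, smul_mul_assoc, map_smul]

end Dual
section Grading
variable (k : Type) [Field k] (B X : Type) [Ring B] [Algebra k B]
  [AddCommGroup X] [Module B X] [Module Bᵐᵒᵖ X] [SMulCommClass B Bᵐᵒᵖ X]
  [Module k X] [IsScalarTower k B X] [IsScalarTower k Bᵐᵒᵖ X]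

/-- The degree-`0` component of `B ⋉ X`, namely `B`. -/
def tszDegZero : Submodule k (TrivSqZeroExt B X) where
  carrier := {p | TrivSqZeroExt.snd p = 0}
  zero_mem' := rfl
  add_mem' := by
    intro p q hp hq
    show TrivSqZeroExt.snd (p + q) = 0
    rw [TrivSqZeroExt.snd_add, hp, hq, add_zero]
  smul_mem' := by
    intro r p hp
    show TrivSqZeroExt.snd (r • p) = 0
    rw [TrivSqZeroExt.snd_smul, hp, smul_zero]

/-- The degree-`1` component of `B ⋉ X`, namely `X`. -/
def tszDegOne : Submodule k (TrivSqZeroExt B X) where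
  carrier := {p | TrivSqZeroExt.fst p = 0}
  zero_mem' := rfl
  add_mem' := by
    intro p q hp hq
    show TrivSqZeroExt.fst (p + q) = 0
    rw [TrivSqZeroExt.fst_add, hp, hq, add_zero]
  smul_mem' := by
    intro r p hp
    show TrivSqZeroExt.fst (r • p) = 0
    rw [TrivSqZeroExt.fst_smul, hp, smul_zero]

/-- The grading of the trivial extension `B ⋉ X`: `B` in degree `0`, `X` in degree `1`,
and `0` elsewhere. -/
def tszGrading : ℕ → Submodule k (TrivSqZeroExt B X)
  | 0 => tszDegZero k B X
  | 1 => tszDegOne k B X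
  | _ + 2 => ⊥

end Grading
/-- `A` is left well-graded: `e · A_c ≠ 0` for every nonzero idempotent `e ∈ A_0`. -/
def LeftWellGraded {k A : Type} [Field k] [Ring A] [Algebra k A]
    (𝒜 : ℕ → Submodule k A) (c : ℕ) : Prop :=
  ∀ e : A, e ∈ 𝒜 0 → IsIdempotentElem e → e ≠ 0 → ∃ x ∈ 𝒜 c, e * x ≠ 0

/-- `A` is right well-graded: `A_c · e ≠ 0` for every nonzero idempotent `e ∈ A_0`. -/
def RightWellGraded {k A : Type} [Field k] [Ring A] [Algebra k A]
    (𝒜 : ℕ → Submodule k A) (c : ℕ) : Prop :=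
  ∀ e : A, e ∈ 𝒜 0 → IsIdempotentElem e → e ≠ 0 → ∃ x ∈ 𝒜 c, x * e ≠ 0

section Bei
variable (k : Type) [Field k] (A : Type) [Ring A] [Algebra k A]
variable (𝒜 : ℕ → Submodule k A) [GradedAlgebra 𝒜] (c : ℕ)

def bei : Subalgebra k (Matrix (Fin c) (Fin c) A) where
  carrier := {M | ∀ i j : Fin c,
    ((i : ℕ) ≤ (j : ℕ) → M i j ∈ 𝒜 ((j : ℕ) - (i : ℕ))) ∧ ((j : ℕ) < (i : ℕ) → M i j = 0)}
  zero_mem' := fun i j => ⟨fun _ => by simp, fun _ => rfl⟩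
  add_mem' := by
    intro M N hM hN i j
    refine ⟨fun hij => Submodule.add_mem _ ((hM i j).1 hij) ((hN i j).1 hij), fun hij => ?_⟩
    show M i j + N i j = 0
    rw [(hM i j).2 hij, (hN i j).2 hij, add_zero]
  one_mem' := by
    intro i j
    constructor
    · intro hij
      by_cases h : i = j
      · subst h
        simpa [Matrix.one_apply] using SetLike.one_mem_graded 𝒜
      · simp [Matrix.one_apply, h]
    · intro hij
      have : i ≠ j := by intro h; subst h; exact lt_irrefl _ hij
      simp [Matrix.one_apply, this]
  mul_mem' := by
    intro M N hM hN i j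
    constructor
    · intro hij
      show (∑ l, M i l * N l j) ∈ 𝒜 ((j : ℕ) - (i : ℕ))
      refine Submodule.sum_mem _ (fun l _ => ?_)
      by_cases hil : (i : ℕ) ≤ (l : ℕ)
      · by_cases hlj : (l : ℕ) ≤ (j : ℕ)
        · have := SetLike.mul_mem_graded ((hM i l).1 hil) ((hN l j).1 hlj)
          have harith : (l : ℕ) - (i : ℕ) + ((j : ℕ) - (l : ℕ)) = (j : ℕ) - (i : ℕ) := by omega
          rwa [harith] at this
        · rw [(hN l j).2 (by omega), mul_zero]; exact Submodule.zero_mem _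
      · rw [(hM i l).2 (by omega), zero_mul]; exact Submodule.zero_mem _
    · intro hij
      show (∑ l, M i l * N l j) = 0
      refine Finset.sum_eq_zero (fun l _ => ?_)
      by_cases hil : (l : ℕ) < (i : ℕ)
      · rw [(hM i l).2 hil, zero_mul]
      · rw [(hN l j).2 (by omega), mul_zero]
  algebraMap_mem' := by
    intro r i j
    constructor
    · intro hij
      rw [Matrix.algebraMap_matrix_apply]
      by_cases h : i = j
      · subst h
        simpa using SetLike.algebraMap_mem_graded 𝒜 r
      · simp only [h, if_false]
        exact Submodule.zero_mem _
    · intro hij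
      have h : i ≠ j := by intro h; subst h; exact lt_irrefl _ hij
      rw [Matrix.algebraMap_matrix_apply, if_neg h]

def xA : Submodule k (Matrix (Fin c) (Fin c) A) where
  carrier := {M | ∀ i j : Fin c,
    ((j : ℕ) ≤ (i : ℕ) → M i j ∈ 𝒜 (c - ((i : ℕ) - (j : ℕ)))) ∧ ((i : ℕ) < (j : ℕ) → M i j = 0)}
  zero_mem' := fun i j => ⟨fun _ => by simp, fun _ => rfl⟩
  add_mem' := by
    intro M N hM hN i j
    refine ⟨fun hij => Submodule.add_mem _ ((hM i j).1 hij) ((hN i j).1 hij), fun hij => ?_⟩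
    show M i j + N i j = 0
    rw [(hM i j).2 hij, (hN i j).2 hij, add_zero]
  smul_mem' := by
    intro r M hM i j
    refine ⟨fun hij => Submodule.smul_mem _ r ((hM i j).1 hij), fun hij => ?_⟩
    show r • M i j = 0
    rw [(hM i j).2 hij, smul_zero]

end Bei

/-- The trivial extension `T(b(A)) = b(A) ⋉ D(b(A))` of the Beilinson algebra. -/
noncomputable abbrev TBei (k : Type) [Field k] (A : Type) [Ring A] [Algebra k A]
    (𝒜 : ℕ → Submodule k A) [GradedAlgebra 𝒜] (c : ℕ) : Type :=
  TrivSqZeroExt ↥(bei k A 𝒜 c) (Module.Dual k ↥(bei k A 𝒜 c))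

/-- The category of left modules over a `k`-algebra `B` that are finite-dimensional over `k`. -/
structure FdMod (k : Type) [Field k] (B : Type) [Ring B] [Algebra k B] : Type 1 where
  carrier : Type
  [acg : AddCommGroup carrier]
  [modB : Module B carrier]
  [modk : Module k carrier]
  [tower : IsScalarTower k B carrier]
  [fd : FiniteDimensional k carrier]

attribute [instance] FdMod.acg FdMod.modB FdMod.modk FdMod.tower FdMod.fd

namespace FdMod

variable {k : Type} [Field k] {B : Type} [Ring B] [Algebra k B]

instance : Category (FdMod k B) where
  Hom M N := M.carrier →ₗ[B] N.carrier
  id M := LinearMap.id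
  comp f g := g.comp f

instance : Limits.HasZeroMorphisms (FdMod k B) where
  zero M N := ⟨(0 : M.carrier →ₗ[B] N.carrier)⟩
  comp_zero f N := by
    apply LinearMap.ext
    intro x
    rfl
  zero_comp M N K f := LinearMap.ext fun x =>
    map_zero (show N.carrier →ₗ[B] K.carrier from f)

/-- The isomorphism of `FdMod k B` given by a linear equivalence. -/
def isoOfEquiv {M N : FdMod k B} (e : M.carrier ≃ₗ[B] N.carrier) : M ≅ N where
  hom := e.toLinearMap
  inv := e.symm.toLinearMap
  hom_inv_id := LinearMap.ext fun x => e.symm_apply_apply x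
  inv_hom_id := LinearMap.ext fun x => e.apply_symm_apply x

theorem isZero_iff (M : FdMod k B) : Limits.IsZero M ↔ Subsingleton M.carrier := by
  rw [Limits.IsZero.iff_id_eq_zero]
  constructor
  · intro h
    refine ⟨fun x y => ?_⟩
    have hx : ∀ z : M.carrier, z = 0 := fun z =>
      LinearMap.congr_fun (show (LinearMap.id : M.carrier →ₗ[B] M.carrier) = 0 from h) z
    rw [hx x, hx y]
  · intro h
    exact LinearMap.ext fun x => Subsingleton.elim _ _

end FdMod

/-- `Hom_B(X, N)` for a `B`-bimodule `X`, with left `B`-action induced by the right action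
of `B` on `X`. -/
def CoindHom (B X N : Type) [Ring B] [AddCommGroup X] [Module B X] [AddCommGroup N]
    [Module B N] : Type := X →ₗ[B] N

namespace CoindHom

section
variable {B X N : Type} [Ring B] [AddCommGroup X] [Module B X] [AddCommGroup N] [Module B N]

instance : AddCommGroup (CoindHom B X N) := inferInstanceAs (AddCommGroup (X →ₗ[B] N))

instance : FunLike (CoindHom B X N) X N := inferInstanceAs (FunLike (X →ₗ[B] N) X N)

instance : LinearMapClass (CoindHom B X N) B X N :=
  inferInstanceAs (LinearMapClass (X →ₗ[B] N) B X N)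

theorem ext {f g : CoindHom B X N} (h : ∀ x, f x = g x) : f = g := LinearMap.ext h

theorem add_apply (f g : CoindHom B X N) (x : X) : (f + g) x = f x + g x := rfl

variable [Module Bᵐᵒᵖ X] [SMulCommClass B Bᵐᵒᵖ X]

instance : Module B (CoindHom B X N) where
  smul b f :=
    { toFun := fun x => f (op b • x)
      map_add' := fun x y => by rw [smul_add, map_add]
      map_smul' := fun c x => by
        rw [← smul_comm c (op b) x, map_smul]; rfl }
  one_smul f := ext fun x => show f (op 1 • x) = f x by rw [op_one, one_smul]
  mul_smul b c f := ext fun x => show f (op (b * c) • x) = f (op c • op b • x) by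
    rw [op_mul, mul_smul]
  smul_zero b := rfl
  smul_add b f g := rfl
  add_smul b c f := ext fun x => show f (op (b + c) • x) = f (op b • x) + f (op c • x) by
    rw [MulOpposite.op_add, add_smul, map_add]
  zero_smul f := ext fun x => show f (op 0 • x) = 0 by rw [op_zero, zero_smul, map_zero]

theorem smul_apply (b : B) (f : CoindHom B X N) (x : X) : (b • f) x = f (op b • x) := rfl

end

section
variable {k B X N : Type} [Field k] [Ring B] [Algebra k B]
  [AddCommGroup X] [Module B X]
  [AddCommGroup N] [Module B N] [Module k N] [IsScalarTower k B N]

instance : Module k (CoindHom B X N) := inferInstanceAs (Module k (X →ₗ[B] N))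

theorem smul_apply' (r : k) (f : CoindHom B X N) (x : X) : (r • f) x = r • f x := rfl

variable [Module k X] [IsScalarTower k B X]

instance [Module Bᵐᵒᵖ X] [SMulCommClass B Bᵐᵒᵖ X] [IsScalarTower k Bᵐᵒᵖ X] :
    IsScalarTower k B (CoindHom B X N) where
  smul_assoc r b f := ext fun x => by
    rw [smul_apply, smul_apply', smul_apply, op_smul, smul_assoc]
    exact map_smul ((show X →ₗ[B] N from f).restrictScalars k) r _

instance [FiniteDimensional k X] [FiniteDimensional k N] :
    FiniteDimensional k (CoindHom B X N) :=
  FiniteDimensional.of_injective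
    (LinearMap.restrictScalarsₗ k B X N k : (X →ₗ[B] N) →ₗ[k] (X →ₗ[k] N))
    (LinearMap.restrictScalars_injective k)

end

end CoindHom

section
variable (k B : Type) [Field k] [Ring B] [Algebra k B]
  (X : Type) [AddCommGroup X] [Module B X] [Module Bᵐᵒᵖ X] [SMulCommClass B Bᵐᵒᵖ X]
  [Module k X] [IsScalarTower k B X] [IsScalarTower k Bᵐᵒᵖ X] [FiniteDimensional k X]

/-- The functor `Hom_B(X, -)` attached to a bimodule `X`. -/
def coindFunctor : FdMod k B ⥤ FdMod k B where
  obj N := { carrier := CoindHom B X N.carrier }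
  map {M N} f :=
    { toFun := fun φ => LinearMap.comp (show M.carrier →ₗ[B] N.carrier from f)
        (show X →ₗ[B] M.carrier from φ)
      map_add' := fun φ ψ => LinearMap.comp_add _ _ _
      map_smul' := fun b φ => rfl }

end

/-- Finitely supported sequences of objects with maps `N_n ⟶ H(N_{n+1})` composing to zero. -/
structure GSeq {C : Type 1} [Category.{0} C] [Limits.HasZeroMorphisms C] (H : C ⥤ C) :
    Type 1 where
  obj : ℤ → C
  d : ∀ n, obj n ⟶ H.obj (obj (n + 1))
  d_comp : ∀ n, d n ≫ H.map (d (n + 1)) = 0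
  finite : {n | ¬ Limits.IsZero (obj n)}.Finite

namespace GSeq

variable {C : Type 1} [Category.{0} C] [Limits.HasZeroMorphisms C] {H : C ⥤ C}

/-- A morphism of sequences: a family of maps compatible with the structure maps. -/
@[ext]
structure Hom (M N : GSeq H) : Type where
  app : ∀ n, M.obj n ⟶ N.obj n
  comm : ∀ n, app n ≫ N.d n = M.d n ≫ H.map (app (n + 1))

instance : Category (GSeq H) where
  Hom := Hom
  id M := { app := fun n => 𝟙 _, comm := fun n => by simp }
  comp f g :=
    { app := fun n => f.app n ≫ g.app n
      comm := fun n => by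
        rw [Category.assoc, g.comm, ← Category.assoc, f.comm, Category.assoc, ← H.map_comp] }
  id_comp f := Hom.ext (funext fun n => Category.id_comp _)
  comp_id f := Hom.ext (funext fun n => Category.comp_id _)
  assoc f g h := Hom.ext (funext fun n => Category.assoc _ _ _)

theorem hom_ext {M N : GSeq H} {f g : M ⟶ N} (h : ∀ n, Hom.app f n = Hom.app g n) : f = g :=
  Hom.ext (funext h)

/-- A family of isomorphisms compatible with the structure maps. -/
def isoMk {M N : GSeq H} (e : ∀ n, M.obj n ≅ N.obj n)
    (h : ∀ n, (e n).hom ≫ N.d n = M.d n ≫ H.map (e (n + 1)).hom) : M ≅ N where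
  hom := ⟨fun n => (e n).hom, h⟩
  inv := ⟨fun n => (e n).inv, fun n => by
    rw [Iso.inv_comp_eq, ← Category.assoc, h, Category.assoc, ← H.map_comp, Iso.hom_inv_id,
      H.map_id, Category.comp_id]⟩
  hom_inv_id := hom_ext fun n => (e n).hom_inv_id
  inv_hom_id := hom_ext fun n => (e n).inv_hom_id

variable {H' : C ⥤ C} (E : ℤ → (C ≌ C))
  (θ : ∀ n, H ⋙ (E n).functor ≅ (E (n + 1)).functor ⋙ H')

theorem isZero_map_iff (e : C ≌ C) (X : C) :
    Limits.IsZero (e.functor.obj X) ↔ Limits.IsZero X := by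
  rw [Limits.IsZero.iff_id_eq_zero, Limits.IsZero.iff_id_eq_zero, ← e.functor.map_id,
    e.functor.map_eq_zero_iff]

/-- The structure map of the transported sequence. -/
def twistD (M : GSeq H) (n : ℤ) :
    (E n).functor.obj (M.obj n) ⟶ H'.obj ((E (n + 1)).functor.obj (M.obj (n + 1))) :=
  (E n).functor.map (M.d n) ≫ (θ n).hom.app (M.obj (n + 1))

theorem twistD_comp (M : GSeq H) (n : ℤ) :
    twistD E θ M n ≫ H'.map (twistD E θ M (n + 1)) =
      (E n).functor.map (M.d n ≫ H.map (M.d (n + 1))) ≫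
        (θ n).hom.app (H.obj (M.obj (n + 1 + 1))) ≫
          H'.map ((θ (n + 1)).hom.app (M.obj (n + 1 + 1))) := by
  have := (θ n).hom.naturality (M.d (n + 1))
  dsimp at this
  simp only [twistD, Category.assoc, Functor.map_comp]
  rw [← reassoc_of% this]

/-- Transport of sequences along a family of autoequivalences intertwining `H` and `H'`. -/
def twist : GSeq H ⥤ GSeq H' where
  obj M :=
    { obj := fun n => (E n).functor.obj (M.obj n)
      d := twistD E θ M
      d_comp := fun n => by
        rw [twistD_comp, M.d_comp, Functor.map_zero, Limits.zero_comp]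
      finite := by simpa only [isZero_map_iff] using M.finite }
  map {M N} f :=
    { app := fun n => (E n).functor.map (Hom.app f n)
      comm := fun n => by
        have h := (θ n).hom.naturality (Hom.app f (n + 1))
        dsimp at h
        simp only [twistD, Category.assoc]
        rw [← h, ← Functor.map_comp_assoc, ← Functor.map_comp_assoc, Hom.comm] }
  map_id M := hom_ext fun n => (E n).functor.map_id _
  map_comp f g := hom_ext fun n => (E n).functor.map_comp _ _

instance : (twist E θ).Faithful where
  map_injective {M N} f g h := hom_ext fun n =>
    (E n).functor.map_injective (congrFun (congrArg Hom.app h) n)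

instance : (twist E θ).Full where
  map_surjective {M N} f := by
    have key : ∀ g : ∀ n, (E n).functor.obj (M.obj n) ⟶ (E n).functor.obj (N.obj n),
        (∀ n, g n ≫ twistD E θ N n = twistD E θ M n ≫ H'.map (g (n + 1))) →
        ∀ n, (E n).functor.preimage (g n) ≫ N.d n =
          M.d n ≫ H.map ((E (n + 1)).functor.preimage (g (n + 1))) := by
      intro g hg n
      apply (E n).functor.map_injective
      have h := (θ n).hom.naturality ((E (n + 1)).functor.preimage (g (n + 1)))
      have hf := hg n
      dsimp at h
      simp only [twistD, Category.assoc] at hf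
      rw [Functor.map_preimage] at h
      rw [← cancel_mono ((θ n).hom.app (N.obj (n + 1)))]
      simp only [Functor.map_comp, Functor.map_preimage, Category.assoc]
      rw [hf, ← h]
    exact ⟨⟨fun n => (E n).functor.preimage (Hom.app f n), key (Hom.app f) (Hom.comm f)⟩,
      hom_ext fun n => (E n).functor.map_preimage _⟩

instance : (twist E θ).EssSurj where
  mem_essImage N := by
    let ε : ∀ n, (E n).functor.obj ((E n).inverse.obj (N.obj n)) ≅ N.obj n :=
      fun n => (E n).counitIso.app (N.obj n)
    let δ : ∀ n, (E n).inverse.obj (N.obj n) ⟶ H.obj ((E (n + 1)).inverse.obj (N.obj (n + 1))) :=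
      fun n => (E n).functor.preimage ((ε n).hom ≫ N.d n ≫ H'.map (ε (n + 1)).inv ≫
        (θ n).inv.app ((E (n + 1)).inverse.obj (N.obj (n + 1))))
    have hδ : ∀ n, (E n).functor.map (δ n) ≫ (θ n).hom.app _ =
        (ε n).hom ≫ N.d n ≫ H'.map (ε (n + 1)).inv := fun n => by
      simp only [δ, Functor.map_preimage, Category.assoc, Iso.inv_hom_id_app]
      erw [Category.comp_id]
    have hd : ∀ n, δ n ≫ H.map (δ (n + 1)) = 0 := fun n => by
      apply (E n).functor.map_injective
      have h := (θ n).hom.naturality (δ (n + 1))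
      dsimp at h
      rw [Functor.map_zero, Functor.map_comp,
        ← cancel_mono ((θ n).hom.app _), Limits.zero_comp, Category.assoc]
      refine (congrArg ((E n).functor.map (δ n) ≫ ·) h).trans ?_
      rw [← Category.assoc, hδ,
        ← cancel_mono (H'.map ((θ (n + 1)).hom.app _)), Limits.zero_comp]
      simp only [Category.assoc]
      rw [← H'.map_comp, ← H'.map_comp, hδ, Iso.inv_hom_id_assoc, H'.map_comp,
        reassoc_of% (N.d_comp n)]
      simp
    have hfin : {n | ¬ Limits.IsZero ((E n).inverse.obj (N.obj n))}.Finite :=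
      N.finite.subset fun n hn h => hn ((isZero_map_iff (E n).symm (N.obj n)).2 h)
    have hcomm : ∀ n, (ε n).hom ≫ N.d n =
        ((E n).functor.map (δ n) ≫ (θ n).hom.app _) ≫ H'.map (ε (n + 1)).hom := fun n => by
      rw [hδ]
      simp only [Category.assoc]
      rw [← H'.map_comp, Iso.inv_hom_id, H'.map_id, Category.comp_id]
    exact ⟨⟨_, δ, hd, hfin⟩, ⟨isoMk ε hcomm⟩⟩

/-- Transport along a family of autoequivalences is an equivalence. -/
noncomputable def twistEquiv : GSeq H ≌ GSeq H' :=
  haveI : (twist E θ).IsEquivalence := {}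
  (twist E θ).asEquivalence

/-- If an autoequivalence `e` commutes with `H'` and `H ≅ e ⋙ H'`, then the categories of
sequences for `H` and `H'` are equivalent. -/
theorem nonempty_equiv_of_commute (e : C ≌ C) (hH : Nonempty (H ≅ e.functor ⋙ H'))
    (hcomm : Nonempty (H' ⋙ e.functor ≅ e.functor ⋙ H')) : Nonempty (GSeq H ≌ GSeq H') := by
  obtain ⟨hH⟩ := hH
  obtain ⟨φ⟩ := hcomm
  let φ' : H' ⋙ e.inverse ≅ e.inverse ⋙ H' :=
    (Functor.leftUnitor _).symm ≪≫ Functor.isoWhiskerRight e.counitIso.symm (H' ⋙ e.inverse) ≪≫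
      Functor.isoWhiskerLeft e.inverse
        (Functor.isoWhiskerRight φ.symm e.inverse ≪≫
          Functor.isoWhiskerLeft H' e.unitIso.symm ≪≫ Functor.rightUnitor _)
  let P : ℕ → (C ≌ C) := fun n => Nat.rec CategoryTheory.Equivalence.refl (fun _ f => e.trans f) n
  let Q : ℕ → (C ≌ C) :=
    fun n => Nat.rec CategoryTheory.Equivalence.refl (fun _ f => e.symm.trans f) n
  have step : ∀ (a b : C ≌ C), Nonempty (H' ⋙ a.functor ≅ a.functor ⋙ H') →
      Nonempty (H' ⋙ b.functor ≅ b.functor ⋙ H') →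
      Nonempty (H' ⋙ (a.trans b).functor ≅ (a.trans b).functor ⋙ H') := fun a b ⟨α⟩ ⟨β⟩ =>
    ⟨Functor.isoWhiskerRight α b.functor ≪≫ Functor.isoWhiskerLeft a.functor β⟩
  have hrefl : Nonempty (H' ⋙ (CategoryTheory.Equivalence.refl : C ≌ C).functor ≅
      (CategoryTheory.Equivalence.refl : C ≌ C).functor ⋙ H') :=
    ⟨Functor.rightUnitor _ ≪≫ (Functor.leftUnitor _).symm⟩
  have hP : ∀ n, Nonempty (H' ⋙ (P n).functor ≅ (P n).functor ⋙ H') := fun n => by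
    induction n with
    | zero => exact hrefl
    | succ n ih => exact step _ _ ⟨φ⟩ ih
  have hQ : ∀ n, Nonempty (H' ⋙ (Q n).functor ≅ (Q n).functor ⋙ H') := fun n => by
    induction n with
    | zero => exact hrefl
    | succ n ih => exact step _ _ ⟨φ'⟩ ih
  let E : ℤ → (C ≌ C) := fun n => Int.rec P (fun m => Q (m + 1)) n
  have hE : ∀ n, Nonempty (H' ⋙ (E n).functor ≅ (E n).functor ⋙ H') := fun n => by
    cases n with
    | ofNat n => exact hP n
    | negSucc n => exact hQ (n + 1)
  have hsucc : ∀ n, Nonempty (e.functor ⋙ (E n).functor ≅ (E (n + 1)).functor) := fun n => by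
    cases n with
    | ofNat n => exact ⟨Iso.refl _⟩
    | negSucc n =>
      have hQn : Nonempty (e.functor ⋙ (Q (n + 1)).functor ≅ (Q n).functor) :=
        ⟨Functor.isoWhiskerRight e.unitIso.symm (Q n).functor ≪≫ Functor.leftUnitor _⟩
      cases n with
      | zero => exact hQn
      | succ n => exact hQn
  have hθ : ∀ n, Nonempty (H ⋙ (E n).functor ≅ (E (n + 1)).functor ⋙ H') := fun n => by
    obtain ⟨α⟩ := hE n
    obtain ⟨β⟩ := hsucc n
    exact ⟨Functor.isoWhiskerRight hH (E n).functor ≪≫ Functor.isoWhiskerLeft e.functor α ≪≫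
      Functor.isoWhiskerRight β H'⟩
  exact ⟨twistEquiv E fun n => (hθ n).some⟩

end GSeq

/-- A spanning family of submodules admitting a compatible family of projections is an
internal direct sum decomposition. -/
theorem isInternal_of_projections {k L : Type} [Field k] [AddCommGroup L] [Module k L]
    (G : ℤ → Submodule k L) (q : ℤ → L →ₗ[k] L) (hself : ∀ n, ∀ v ∈ G n, q n v = v)
    (hne : ∀ n m, n ≠ m → ∀ v ∈ G n, q m v = 0) (htop : ⨆ n, G n = ⊤) :
    DirectSum.IsInternal G := by
  rw [DirectSum.isInternal_submodule_iff_iSupIndep_and_iSup_eq_top]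
  refine ⟨fun n => ?_, htop⟩
  rw [Submodule.disjoint_def]
  intro x hx hx'
  have hker : (⨆ m, ⨆ (_ : m ≠ n), G m) ≤ LinearMap.ker (q n) :=
    iSup₂_le fun m hm v hv => hne m n hm v hv
  rw [← hself n x hx]
  exact hker hx'

namespace GrMod

section
variable {k : Type} [Field k] {A : Type} [Ring A] [Algebra k A] {𝒜 : ℕ → Submodule k A}
  (M : GrMod k A 𝒜)

theorem homogeneous_induction {P : M.carrier → Prop} (zero : P 0)
    (add : ∀ v w, P v → P w → P (v + w)) (hom : ∀ m, ∀ v ∈ M.grading m, P v)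
    (v : M.carrier) : P v := by
  have hv : v ∈ ⨆ m, M.grading m := by
    rw [M.internal.submodule_iSup_eq_top]; trivial
  exact Submodule.iSup_induction (motive := P) _ hv hom zero add

/-- The linear map on a graded module with prescribed restrictions to the components. -/
noncomputable def lift {L : Type} [AddCommGroup L] [Module k L]
    (g : ∀ m, M.grading m →ₗ[k] L) : M.carrier →ₗ[k] L :=
  (DirectSum.toModule k ℤ L g).comp
    (LinearEquiv.ofBijective (DirectSum.coeLinearMap M.grading) M.internal).symm.toLinearMap

theorem lift_apply {L : Type} [AddCommGroup L] [Module k L]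
    (g : ∀ m, M.grading m →ₗ[k] L) {m : ℤ} {v : M.carrier} (hv : v ∈ M.grading m) :
    M.lift g v = g m ⟨v, hv⟩ := by
  have h : (LinearEquiv.ofBijective (DirectSum.coeLinearMap M.grading) M.internal).symm v =
      DirectSum.lof k ℤ (fun m => M.grading m) m ⟨v, hv⟩ := by
    rw [LinearEquiv.symm_apply_eq]
    exact (DirectSum.coeLinearMap_lof M.grading m ⟨v, hv⟩).symm
  change DirectSum.toModule k ℤ L g
    ((LinearEquiv.ofBijective (DirectSum.coeLinearMap M.grading) M.internal).symm v) = _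
  rw [h, DirectSum.toModule_lof]

theorem hom_ext {M N : GrMod k A 𝒜} {f g : M ⟶ N} (h : ∀ v, f.1 v = g.1 v) : f = g :=
  Subtype.ext (LinearMap.ext h)

end

section TrivExt

variable {k : Type} [Field k] {B X : Type} [Ring B] [Algebra k B]
  [AddCommGroup X] [Module B X] [Module Bᵐᵒᵖ X] [SMulCommClass B Bᵐᵒᵖ X]
  [Module k X] [IsScalarTower k B X] [IsScalarTower k Bᵐᵒᵖ X]
  (M : GrMod k (TrivSqZeroExt B X) (tszGrading k B X))

theorem inl_smul_mem (b : B) {n : ℤ} {v : M.carrier} (hv : v ∈ M.grading n) :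
    (TrivSqZeroExt.inl b : TrivSqZeroExt B X) • v ∈ M.grading n := by
  have := M.smul_mem 0 n (TrivSqZeroExt.inl b) v (TrivSqZeroExt.snd_inl X b) hv
  simpa using this

theorem inr_smul_mem (x : X) {n : ℤ} {v : M.carrier} (hv : v ∈ M.grading n) :
    (TrivSqZeroExt.inr x : TrivSqZeroExt B X) • v ∈ M.grading (n + 1) := by
  have := M.smul_mem 1 n (TrivSqZeroExt.inr x) v (TrivSqZeroExt.fst_inr B x) hv
  rw [add_comm]
  simpa using this

instance pieceModule (n : ℤ) : Module B ↥(M.grading n) where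
  smul b v := ⟨(TrivSqZeroExt.inl b : TrivSqZeroExt B X) • v.1, M.inl_smul_mem b v.2⟩
  one_smul v := Subtype.ext (one_smul _ v.1)
  mul_smul b c v := Subtype.ext <| by
    change (TrivSqZeroExt.inl (b * c) : TrivSqZeroExt B X) • v.1 = _
    rw [TrivSqZeroExt.inl_mul, mul_smul]; rfl
  smul_zero b := Subtype.ext (smul_zero _)
  smul_add b v w := Subtype.ext (smul_add _ _ _)
  add_smul b c v := Subtype.ext <| by
    change (TrivSqZeroExt.inl (b + c) : TrivSqZeroExt B X) • v.1 = _
    rw [TrivSqZeroExt.inl_add, add_smul]; rfl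
  zero_smul v := Subtype.ext (zero_smul _ v.1)

theorem coe_piece_smul {n : ℤ} (b : B) (v : M.grading n) :
    ((b • v : M.grading n) : M.carrier) = (TrivSqZeroExt.inl b : TrivSqZeroExt B X) • v.1 := rfl

instance (n : ℤ) : IsScalarTower k B ↥(M.grading n) where
  smul_assoc r b v := Subtype.ext <| by
    rw [coe_piece_smul, TrivSqZeroExt.inl_smul, smul_assoc]; rfl

/-- The degree `n` component of a graded `B ⋉ X`-module, as a `B`-module. -/
def piece (n : ℤ) : FdMod k B where
  carrier := ↥(M.grading n)

theorem tsz_smul (r : TrivSqZeroExt B X) (v : M.carrier) :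
    r • v = (TrivSqZeroExt.inl r.fst : TrivSqZeroExt B X) • v +
      (TrivSqZeroExt.inr r.snd : TrivSqZeroExt B X) • v := by
  rw [← add_smul, TrivSqZeroExt.inl_fst_add_inr_snd_eq]

/-- Multiplication by `X`, as a map `M_n ⟶ Hom_B(X, M_{n+1})`. -/
def pieceMul (n : ℤ) : M.grading n →ₗ[B] CoindHom B X (M.grading (n + 1)) where
  toFun v :=
    ({ toFun := fun x => ⟨(TrivSqZeroExt.inr x : TrivSqZeroExt B X) • v.1, M.inr_smul_mem x v.2⟩
       map_add' := fun x y => Subtype.ext <| by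
         change (TrivSqZeroExt.inr (x + y) : TrivSqZeroExt B X) • v.1 = _
         rw [TrivSqZeroExt.inr_add, add_smul]; rfl
       map_smul' := fun b x => Subtype.ext <| by
         change (TrivSqZeroExt.inr (b • x) : TrivSqZeroExt B X) • v.1 =
           (TrivSqZeroExt.inl b : TrivSqZeroExt B X) •
             (TrivSqZeroExt.inr x : TrivSqZeroExt B X) • v.1
         rw [← mul_smul, TrivSqZeroExt.inl_mul_inr] } : X →ₗ[B] M.grading (n + 1))
  map_add' v w := CoindHom.ext fun x => Subtype.ext (smul_add _ _ _)
  map_smul' b v := CoindHom.ext fun x => Subtype.ext <| by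
    change (TrivSqZeroExt.inr x : TrivSqZeroExt B X) •
      (TrivSqZeroExt.inl b : TrivSqZeroExt B X) • v.1
      = (TrivSqZeroExt.inr (op b • x) : TrivSqZeroExt B X) • v.1
    rw [← mul_smul, TrivSqZeroExt.inr_mul_inl]

theorem finite_nontrivial_pieces : {n | ¬ Limits.IsZero (M.piece n)}.Finite := by
  have h := Submodule.finite_ne_bot_of_iSupIndep M.internal.submodule_iSupIndep
  refine h.subset fun n hn hbot => hn ?_
  rw [FdMod.isZero_iff]
  exact (Submodule.subsingleton_iff_eq_bot).2 hbot

variable [FiniteDimensional k X]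

/-- The sequence of components of a graded `B ⋉ X`-module. -/
def toGSeqObj : GSeq (coindFunctor k B X) where
  obj := M.piece
  d n := M.pieceMul n
  d_comp n := LinearMap.ext fun v => CoindHom.ext fun x => CoindHom.ext fun y => Subtype.ext <| by
    change (TrivSqZeroExt.inr y : TrivSqZeroExt B X) • (TrivSqZeroExt.inr x : TrivSqZeroExt B X) •
      (v : ↥(M.grading n)).1 = 0
    rw [← mul_smul, TrivSqZeroExt.inr_mul_inr, zero_smul]
  finite := M.finite_nontrivial_pieces

variable {M}

/-- The component of degree `n` of a morphism of graded modules. -/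
def pieceMap {N : GrMod k (TrivSqZeroExt B X) (tszGrading k B X)} (f : M ⟶ N) (n : ℤ) :
    M.grading n →ₗ[B] N.grading n where
  toFun v := ⟨f.1 v.1, f.2 n v.1 v.2⟩
  map_add' v w := Subtype.ext (map_add f.1 _ _)
  map_smul' b v := Subtype.ext (map_smul f.1 _ _)

variable (k B X) in
/-- The functor taking a graded `B ⋉ X`-module to the sequence of its components. -/
def toGSeq : GrMod k (TrivSqZeroExt B X) (tszGrading k B X) ⥤ GSeq (coindFunctor k B X) where
  obj M := M.toGSeqObj
  map f :=
    { app := fun n => pieceMap f n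
      comm := fun n => LinearMap.ext fun v => CoindHom.ext fun x => Subtype.ext
        (map_smul f.1 _ _).symm }

instance : (toGSeq k B X).Faithful where
  map_injective {M N} f g h := hom_ext fun v => by
    induction v using M.homogeneous_induction with
    | zero => rw [map_zero, map_zero]
    | add v w hv hw => rw [map_add, map_add, hv, hw]
    | hom n v hv =>
      have h1 : pieceMap f n = pieceMap g n := congrFun (congrArg GSeq.Hom.app h) n
      exact congrArg Subtype.val (LinearMap.congr_fun h1 ⟨v, hv⟩)

instance : (toGSeq k B X).Full where
  map_surjective {M N} f := by
    let F : ∀ n, M.grading n →ₗ[B] N.grading n := fun n => GSeq.Hom.app f n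
    have hF : ∀ n (v : M.grading n) (x : X), (TrivSqZeroExt.inr x : TrivSqZeroExt B X) •
        (F n v).1 = (F (n + 1) ⟨(TrivSqZeroExt.inr x : TrivSqZeroExt B X) • v.1,
          M.inr_smul_mem x v.2⟩).1 := fun n v x =>
      congrArg (fun g : M.grading n →ₗ[B] CoindHom B X (N.grading (n + 1)) =>
        ((g v) x : N.grading (n + 1)).1) (GSeq.Hom.comm f n)
    let φ : M.carrier →ₗ[k] N.carrier := M.lift fun n =>
      (N.grading n).subtype.comp ((F n).restrictScalars k)
    have hφ : ∀ n (v : M.grading n), φ v.1 = (F n v).1 := fun n v => M.lift_apply _ v.2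
    have hinl : ∀ (b : B) v, φ ((TrivSqZeroExt.inl b : TrivSqZeroExt B X) • v) =
        (TrivSqZeroExt.inl b : TrivSqZeroExt B X) • φ v := fun b v => by
      induction v using M.homogeneous_induction with
      | zero => rw [smul_zero, map_zero, smul_zero]
      | add v w hv hw => rw [smul_add, map_add, map_add, smul_add, hv, hw]
      | hom n v hv =>
        rw [hφ n ⟨v, hv⟩, hφ n ⟨_, M.inl_smul_mem b hv⟩]
        exact congrArg Subtype.val (map_smul (F n) b ⟨v, hv⟩)
    have hinr : ∀ (x : X) v, φ ((TrivSqZeroExt.inr x : TrivSqZeroExt B X) • v) =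
        (TrivSqZeroExt.inr x : TrivSqZeroExt B X) • φ v := fun x v => by
      induction v using M.homogeneous_induction with
      | zero => rw [smul_zero, map_zero, smul_zero]
      | add v w hv hw => rw [smul_add, map_add, map_add, smul_add, hv, hw]
      | hom n v hv =>
        rw [hφ n ⟨v, hv⟩, hφ (n + 1) ⟨_, M.inr_smul_mem x hv⟩, hF]
    refine ⟨⟨{ toFun := φ, map_add' := map_add φ, map_smul' := fun r v => ?_ },
      fun n v hv => ?_⟩, GSeq.hom_ext fun n => LinearMap.ext fun v => Subtype.ext (hφ n v)⟩
    · rw [RingHom.id_apply, tsz_smul, map_add, hinl, hinr, ← tsz_smul]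
    · change φ v ∈ _
      rw [hφ n ⟨v, hv⟩]
      exact (F n ⟨v, hv⟩).2

section OfGSeq

variable (N : GSeq (coindFunctor k B X))

/-- The structure map of a sequence, as a linear map. -/
def seqMul (n : ℤ) : (N.obj n).carrier →ₗ[B] CoindHom B X (N.obj (n + 1)).carrier := N.d n

theorem seqMul_seqMul (n : ℤ) (v : (N.obj n).carrier) (x y : X) :
    seqMul N (n + 1) (seqMul N n v x) y = 0 :=
  congrArg (fun g : (N.obj n).carrier →ₗ[B] CoindHom B X (CoindHom B X
    (N.obj (n + 1 + 1)).carrier) => g v x y) (N.d_comp n)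

/-- The total space of a sequence. -/
abbrev SeqTotal : Type := DirectSum ℤ fun n => (N.obj n).carrier

/-- The action of an element of `X` on the total space of a sequence. -/
def seqShift (x : X) : SeqTotal N →+ SeqTotal N :=
  DirectSum.toAddMonoid fun n => (DirectSum.of (fun n => (N.obj n).carrier) (n + 1)).comp
    { toFun := fun v => seqMul N n v x
      map_zero' := by rw [map_zero]; rfl
      map_add' := fun v w => by rw [map_add]; rfl }

theorem seqShift_of (x : X) (n : ℤ) (v : (N.obj n).carrier) :
    seqShift N x (DirectSum.of (fun n => (N.obj n).carrier) n v) =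
      DirectSum.of (fun n => (N.obj n).carrier) (n + 1) (seqMul N n v x) :=
  DirectSum.toAddMonoid_of _ _ _

theorem seqTotal_ext {f g : SeqTotal N →+ SeqTotal N}
    (h : ∀ n v, f (DirectSum.of (fun n => (N.obj n).carrier) n v) =
      g (DirectSum.of (fun n => (N.obj n).carrier) n v)) (m : SeqTotal N) : f m = g m := by
  have : f = g := DirectSum.addHom_ext h
  rw [this]

theorem smul_of_seq (b : B) (n : ℤ) (v : (N.obj n).carrier) :
    b • DirectSum.of (fun n => (N.obj n).carrier) n v =
      DirectSum.of (fun n => (N.obj n).carrier) n (b • v) :=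
  (map_smul (DirectSum.lof B ℤ (fun n => (N.obj n).carrier) n) b v).symm

theorem smul_of_seq' (r : k) (n : ℤ) (v : (N.obj n).carrier) :
    r • DirectSum.of (fun n => (N.obj n).carrier) n v =
      DirectSum.of (fun n => (N.obj n).carrier) n (r • v) :=
  (map_smul (DirectSum.lof k ℤ (fun n => (N.obj n).carrier) n) r v).symm

theorem seqShift_add (x y : X) (m : SeqTotal N) :
    seqShift N (x + y) m = seqShift N x m + seqShift N y m :=
  seqTotal_ext N (g := seqShift N x + seqShift N y) (fun n v => by
    rw [AddMonoidHom.add_apply, seqShift_of, seqShift_of, seqShift_of, map_add, map_add]) m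

theorem seqShift_smul (b : B) (x : X) (m : SeqTotal N) :
    seqShift N (b • x) m = b • seqShift N x m :=
  seqTotal_ext N (g := (DistribSMul.toAddMonoidHom _ b).comp (seqShift N x)) (fun n v => by
    change _ = b • seqShift N x _
    rw [seqShift_of, seqShift_of, map_smul, smul_of_seq]) m

theorem seqShift_smul' (r : k) (x : X) (m : SeqTotal N) :
    seqShift N (r • x) m = r • seqShift N x m :=
  seqTotal_ext N (g := (DistribSMul.toAddMonoidHom _ r).comp (seqShift N x)) (fun n v => by
    change _ = r • seqShift N x _
    rw [seqShift_of, seqShift_of, smul_of_seq', algebra_compatible_smul B r x, map_smul,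
      algebraMap_smul]) m

theorem seqShift_op_smul (b : B) (x : X) (m : SeqTotal N) :
    seqShift N (op b • x) m = seqShift N x (b • m) :=
  seqTotal_ext N (g := (seqShift N x).comp (DistribSMul.toAddMonoidHom _ b)) (fun n v => by
    rw [AddMonoidHom.comp_apply, DistribSMul.toAddMonoidHom_apply, smul_of_seq, seqShift_of,
      seqShift_of, map_smul (seqMul N n),
      CoindHom.smul_apply]) m

theorem seqShift_seqShift (x y : X) (m : SeqTotal N) :
    seqShift N x (seqShift N y m) = 0 :=
  seqTotal_ext N (f := (seqShift N x).comp (seqShift N y)) (g := 0) (fun n v => by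
    rw [AddMonoidHom.comp_apply, AddMonoidHom.zero_apply, seqShift_of, seqShift_of,
      seqMul_seqMul, map_zero]) m

/-- The action of the trivial extension on the total space of a sequence. -/
instance seqTotalModule : Module (TrivSqZeroExt B X) (SeqTotal N) where
  smul r m := r.fst • m + seqShift N r.snd m
  one_smul m := by
    change (1 : TrivSqZeroExt B X).fst • m + seqShift N (1 : TrivSqZeroExt B X).snd m = m
    have h := seqShift_add N 0 0 m
    rw [add_zero, left_eq_add] at h
    rw [TrivSqZeroExt.fst_one, TrivSqZeroExt.snd_one, one_smul, h, add_zero]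
  mul_smul r s m := by
    change (r * s).fst • m + seqShift N (r * s).snd m =
      r.fst • (s.fst • m + seqShift N s.snd m) + seqShift N r.snd (s.fst • m + seqShift N s.snd m)
    rw [TrivSqZeroExt.fst_mul, TrivSqZeroExt.snd_mul, map_add, seqShift_add, seqShift_smul,
      seqShift_op_smul, seqShift_seqShift, smul_add, mul_smul, add_zero, add_assoc]
  smul_zero r := by
    change r.fst • (0 : SeqTotal N) + seqShift N r.snd 0 = 0
    rw [smul_zero, map_zero, add_zero]
  smul_add r m m' := by
    change r.fst • (m + m') + seqShift N r.snd (m + m') =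
      r.fst • m + seqShift N r.snd m + (r.fst • m' + seqShift N r.snd m')
    rw [smul_add, map_add]
    abel
  add_smul r s m := by
    change (r + s).fst • m + seqShift N (r + s).snd m =
      r.fst • m + seqShift N r.snd m + (s.fst • m + seqShift N s.snd m)
    rw [TrivSqZeroExt.fst_add, TrivSqZeroExt.snd_add, add_smul, seqShift_add]
    abel
  zero_smul m := by
    change (0 : TrivSqZeroExt B X).fst • m + seqShift N (0 : TrivSqZeroExt B X).snd m = 0
    have h := seqShift_add N 0 0 m
    rw [add_zero, left_eq_add] at h
    rw [TrivSqZeroExt.fst_zero, TrivSqZeroExt.snd_zero, zero_smul, h, add_zero]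

theorem seqTotal_smul_def (r : TrivSqZeroExt B X) (m : SeqTotal N) :
    r • m = r.fst • m + seqShift N r.snd m := rfl

theorem seqTotal_inl_smul (b : B) (m : SeqTotal N) :
    (TrivSqZeroExt.inl b : TrivSqZeroExt B X) • m = b • m := by
  have h := seqShift_add N 0 0 m
  rw [add_zero, left_eq_add] at h
  rw [seqTotal_smul_def, TrivSqZeroExt.fst_inl, TrivSqZeroExt.snd_inl, h, add_zero]

theorem seqTotal_inr_smul (x : X) (m : SeqTotal N) :
    (TrivSqZeroExt.inr x : TrivSqZeroExt B X) • m = seqShift N x m := by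
  rw [seqTotal_smul_def, TrivSqZeroExt.fst_inr, TrivSqZeroExt.snd_inr, zero_smul, zero_add]

instance : IsScalarTower k B (SeqTotal N) where
  smul_assoc r b m := by
    refine DFinsupp.ext fun n => ?_
    exact smul_assoc r b (m n)

instance : IsScalarTower k (TrivSqZeroExt B X) (SeqTotal N) where
  smul_assoc r s m := by
    rw [seqTotal_smul_def, seqTotal_smul_def, TrivSqZeroExt.fst_smul, TrivSqZeroExt.snd_smul,
      seqShift_smul', smul_assoc, smul_add]

instance : FiniteDimensional k (SeqTotal N) := by
  let S := N.finite.toFinset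
  have hS : ∀ n, n ∉ S → Subsingleton (N.obj n).carrier := fun n hn => by
    rw [← FdMod.isZero_iff]
    by_contra h
    exact hn (N.finite.mem_toFinset.2 h)
  let F : SeqTotal N →ₗ[k] (∀ n : S, (N.obj n).carrier) :=
    LinearMap.pi fun n => DirectSum.component k ℤ _ n.1
  refine FiniteDimensional.of_injective F fun m m' h => DFinsupp.ext fun n => ?_
  by_cases hn : n ∈ S
  · exact congrFun h ⟨n, hn⟩
  · have := hS n hn
    exact Subsingleton.elim _ _

/-- The degree `n` component of the total space of a sequence. -/
noncomputable def seqGrading (n : ℤ) : Submodule k (SeqTotal N) :=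
  LinearMap.range (DirectSum.lof k ℤ (fun n => (N.obj n).carrier) n)

theorem seqGrading_internal : DirectSum.IsInternal (seqGrading N) := by
  refine isInternal_of_projections _ (fun n => (DirectSum.lof k ℤ _ n).comp
    (DirectSum.component k ℤ (fun n => (N.obj n).carrier) n)) ?_ ?_ ?_
  · rintro n _ ⟨v, rfl⟩
    rw [LinearMap.comp_apply, DirectSum.component.lof_self]
  · rintro n m hnm _ ⟨v, rfl⟩
    rw [LinearMap.comp_apply, DirectSum.component.of, dif_neg hnm, map_zero]
  · rw [eq_top_iff]
    rintro m -
    induction m using DirectSum.induction_on with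
    | zero => exact zero_mem _
    | of n v => exact Submodule.mem_iSup_of_mem n ⟨v, rfl⟩
    | add m m' hm hm' => exact add_mem hm hm'

/-- The graded module over the trivial extension attached to a sequence. -/
noncomputable def ofGSeq : GrMod k (TrivSqZeroExt B X) (tszGrading k B X) where
  carrier := SeqTotal N
  grading := seqGrading N
  internal := seqGrading_internal N
  smul_mem := by
    rintro (_ | _ | i) n r _ hr ⟨v, rfl⟩
    · have hr' : r.snd = 0 := hr
      have h : r = TrivSqZeroExt.inl r.fst := by
        rw [← TrivSqZeroExt.inl_fst_add_inr_snd_eq r, hr']; simp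
      rw [h, seqTotal_inl_smul, Nat.cast_zero, zero_add]
      exact ⟨r.fst • v, (smul_of_seq N r.fst n v).symm⟩
    · have hr' : r.fst = 0 := hr
      have h : r = TrivSqZeroExt.inr r.snd := by
        rw [← TrivSqZeroExt.inl_fst_add_inr_snd_eq r, hr']; simp
      rw [h, seqTotal_inr_smul, Nat.zero_add, Nat.cast_one, add_comm]
      exact ⟨seqMul N n v r.snd, (seqShift_of N r.snd n v).symm⟩
    · have hr' : r = 0 := hr
      rw [hr', zero_smul]
      exact zero_mem _

/-- The inclusion of a term of a sequence in the attached graded module. -/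
noncomputable def ofGSeqPieceMap (n : ℤ) :
    (N.obj n).carrier →ₗ[B] ((ofGSeq N).piece n).carrier where
  toFun v := (⟨DirectSum.of (fun n => (N.obj n).carrier) n v, v, rfl⟩ : seqGrading N n)
  map_add' v w := Subtype.ext (map_add _ v w)
  map_smul' b v := Subtype.ext <| by
    change DirectSum.of (fun n => (N.obj n).carrier) n (b • v) =
      (TrivSqZeroExt.inl b : TrivSqZeroExt B X) •
        DirectSum.of (fun n => (N.obj n).carrier) n v
    rw [seqTotal_inl_smul, smul_of_seq]

/-- The component of degree `n` of the graded module attached to a sequence. -/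
noncomputable def ofGSeqPiece (n : ℤ) :
    (N.obj n).carrier ≃ₗ[B] ((ofGSeq N).piece n).carrier :=
  LinearEquiv.ofBijective (ofGSeqPieceMap N n)
    ⟨fun v w h => DirectSum.of_injective n (congrArg Subtype.val h),
      fun ⟨_, v, hv⟩ => ⟨v, Subtype.ext hv⟩⟩

theorem ofGSeqPieceMap_comm (n : ℤ) (v : (N.obj n).carrier) (x : X) :
    ((ofGSeq N).pieceMul n (ofGSeqPieceMap N n v) x : (ofGSeq N).grading (n + 1)) =
      ofGSeqPieceMap N (n + 1) (seqMul N n v x) := Subtype.ext <| by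
  change (TrivSqZeroExt.inr x : TrivSqZeroExt B X) •
    DirectSum.of (fun n => (N.obj n).carrier) n v = _
  rw [seqTotal_inr_smul, seqShift_of]
  rfl

instance : (toGSeq k B X).EssSurj where
  mem_essImage N := ⟨ofGSeq N, ⟨(GSeq.isoMk (N := (ofGSeq N).toGSeqObj)
    (fun n => FdMod.isoOfEquiv (N := (ofGSeq N).piece n) (ofGSeqPiece N n))
    fun n => LinearMap.ext fun v => CoindHom.ext (ofGSeqPieceMap_comm N n v)).symm⟩⟩

end OfGSeq

variable (k B X) in
/-- Graded modules over a trivial extension are sequences of modules. -/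
noncomputable def equivGSeq :
    GrMod k (TrivSqZeroExt B X) (tszGrading k B X) ≌ GSeq (coindFunctor k B X) :=
  haveI : (toGSeq k B X).IsEquivalence := {}
  (toGSeq k B X).asEquivalence

end TrivExt

end GrMod

section Balanced

variable {B Y Z T : Type} [Ring B]
  [AddCommGroup Y] [Module B Y] [Module Bᵐᵒᵖ Y]
  [AddCommGroup Z] [Module B Z] [Module Bᵐᵒᵖ Z]
  [AddCommGroup T] [Module B T] [Module Bᵐᵒᵖ T]

variable (B Y Z T) in
/-- A balanced bimodule map `Y × Z → T`. -/
structure BalancedMap where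
  toHom : Y →+ Z →+ T
  smul_left : ∀ (b : B) y z, toHom (b • y) z = b • toHom y z
  balanced : ∀ (b : B) y z, toHom (op b • y) z = toHom y (b • z)
  smul_right : ∀ (b : B) y z, toHom y (op b • z) = op b • toHom y z

/-- A balanced map `Y × Z → T` is universal if it exhibits `T` as `Y ⊗_B Z`. -/
def BalancedMap.IsUniversal (t : BalancedMap B Y Z T) : Prop :=
  ∀ (N : Type) [AddCommGroup N] (β : Y →+ Z →+ N),
    (∀ (b : B) y z, β (op b • y) z = β y (b • z)) → ∃! g : T →+ N, ∀ y z, g (t.toHom y z) = β y z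

theorem BalancedMap.isUniversal_of_left (t : BalancedMap B Y Z T) {ι : Type} [Fintype ι]
    (y : ι → Y) (s : ι → T →+ Z) (c : ι → Y → B)
    (h1 : ∀ τ, ∑ i, t.toHom (y i) (s i τ) = τ) (h2 : ∀ i u z, s i (t.toHom u z) = c i u • z)
    (h3 : ∀ u, ∑ i, op (c i u) • y i = u) : t.IsUniversal := by
  intro N _ β hβ
  refine ⟨∑ i, (β (y i)).comp (s i), fun u z => ?_, fun g hg => ?_⟩
  · simp only [AddMonoidHom.finsetSum_apply, AddMonoidHom.comp_apply, h2]
    simp only [← hβ]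
    rw [← AddMonoidHom.finsetSum_apply, ← map_sum, h3]
  · refine AddMonoidHom.ext fun τ => ?_
    conv_lhs => rw [← h1 τ]
    simp only [map_sum, hg, AddMonoidHom.finsetSum_apply, AddMonoidHom.comp_apply]

theorem BalancedMap.isUniversal_of_right (t : BalancedMap B Y Z T) {ι : Type} [Fintype ι]
    (z : ι → Z) (s : ι → T →+ Y) (c : ι → Z → B)
    (h1 : ∀ τ, ∑ i, t.toHom (s i τ) (z i) = τ) (h2 : ∀ i y u, s i (t.toHom y u) = op (c i u) • y)
    (h3 : ∀ u, ∑ i, c i u • z i = u) : t.IsUniversal := by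
  intro N _ β hβ
  refine ⟨∑ i, (β.flip (z i)).comp (s i), fun y u => ?_, fun g hg => ?_⟩
  · simp only [AddMonoidHom.finsetSum_apply, AddMonoidHom.comp_apply, AddMonoidHom.flip_apply,
      h2, hβ]
    rw [← map_sum, h3]
  · refine AddMonoidHom.ext fun τ => ?_
    conv_lhs => rw [← h1 τ]
    simp only [map_sum, hg, AddMonoidHom.finsetSum_apply, AddMonoidHom.comp_apply,
      AddMonoidHom.flip_apply]

variable [SMulCommClass B Bᵐᵒᵖ Y] [SMulCommClass B Bᵐᵒᵖ Z] [SMulCommClass B Bᵐᵒᵖ T]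

/-- The map `Hom_B(T, N) → Hom_B(Z, Hom_B(Y, N))` induced by a balanced map `Y × Z → T`. -/
def BalancedMap.curry (t : BalancedMap B Y Z T) (N : Type) [AddCommGroup N] [Module B N] :
    CoindHom B T N →ₗ[B] CoindHom B Z (CoindHom B Y N) where
  toFun g :=
    ({ toFun := fun z => ({ toFun := fun y => g (t.toHom y z)
                            map_add' := fun y y' => by
                              rw [map_add, AddMonoidHom.add_apply, map_add]
                            map_smul' := fun b y => by
                              rw [t.smul_left, map_smul]; rfl } : Y →ₗ[B] N)
       map_add' := fun z z' => CoindHom.ext fun y =>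
         show g (t.toHom y (z + z')) = g (t.toHom y z) + g (t.toHom y z') by rw [map_add, map_add]
       map_smul' := fun b z => CoindHom.ext fun y =>
         show g (t.toHom y (b • z)) = g (t.toHom (op b • y) z) by rw [t.balanced] } :
      Z →ₗ[B] CoindHom B Y N)
  map_add' g g' := rfl
  map_smul' b g := CoindHom.ext fun z => CoindHom.ext fun y =>
    show g (op b • t.toHom y z) = g (t.toHom y (op b • z)) by rw [t.smul_right]

theorem BalancedMap.IsUniversal.curry_bijective {t : BalancedMap B Y Z T} (ht : t.IsUniversal)
    (N : Type) [AddCommGroup N] [Module B N] : Function.Bijective (t.curry N) := by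
  constructor
  · intro g h hgh
    let β : Y →+ Z →+ N := (AddMonoidHom.compHom (AddMonoidHomClass.toAddMonoidHom g)).comp t.toHom
    obtain ⟨f, -, hf⟩ := ht N β fun b y z => congrArg g (t.balanced b y z)
    have hg := hf (AddMonoidHomClass.toAddMonoidHom g) fun y z => rfl
    have hh := hf (AddMonoidHomClass.toAddMonoidHom h) fun y z =>
      (congrArg (fun f => f z y) hgh).symm
    exact CoindHom.ext fun τ => DFunLike.congr_fun (hg.trans hh.symm) τ
  · intro h
    let β : Y →+ Z →+ N := AddMonoidHom.mk' (fun y => AddMonoidHom.mk' (fun z => h z y)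
      fun z z' => by rw [map_add, CoindHom.add_apply])
      fun y y' => AddMonoidHom.ext fun z => map_add (h z) y y'
    obtain ⟨g, hg, -⟩ := ht N β fun b y z => show h z (op b • y) = h (b • z) y by
      rw [map_smul h, CoindHom.smul_apply]
    have hlin : ∀ (b : B) τ, g (b • τ) = b • g τ := fun b τ => by
      let γ : Y →+ Z →+ N := (AddMonoidHom.compHom (DistribSMul.toAddMonoidHom N b)).comp β
      obtain ⟨f, -, hf⟩ := ht N γ fun c y z => show b • h z (op c • y) = b • h (c • z) y by
        rw [map_smul h, CoindHom.smul_apply]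
      have h1 := hf ((DistribSMul.toAddMonoidHom N b).comp g) fun y z => congrArg (b • ·) (hg y z)
      have h2 := hf (g.comp (DistribSMul.toAddMonoidHom T b)) fun y z => by
        rw [AddMonoidHom.comp_apply, DistribSMul.toAddMonoidHom_apply, ← t.smul_left, hg]
        exact map_smul (h z) b y
      exact DFunLike.congr_fun (h2.trans h1.symm) τ
    exact ⟨({ toFun := g, map_add' := map_add g, map_smul' := hlin } : T →ₗ[B] N),
      CoindHom.ext fun z => CoindHom.ext fun y => hg y z⟩

variable {k : Type} [Field k] [Algebra k B]
  [Module k Y] [IsScalarTower k B Y] [IsScalarTower k Bᵐᵒᵖ Y] [FiniteDimensional k Y]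
  [Module k Z] [IsScalarTower k B Z] [IsScalarTower k Bᵐᵒᵖ Z] [FiniteDimensional k Z]
  [Module k T] [IsScalarTower k B T] [IsScalarTower k Bᵐᵒᵖ T] [FiniteDimensional k T]

variable (k) in
/-- The tensor-hom adjunction for a universal balanced map. -/
noncomputable def BalancedMap.IsUniversal.coindIso {t : BalancedMap B Y Z T}
    (ht : t.IsUniversal) :
    coindFunctor k B T ≅ coindFunctor k B Y ⋙ coindFunctor k B Z :=
  NatIso.ofComponents
    (fun N => FdMod.isoOfEquiv (N := (coindFunctor k B Y ⋙ coindFunctor k B Z).obj N)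
      (LinearEquiv.ofBijective (t.curry N.carrier) (ht.curry_bijective N.carrier)))
    fun f => rfl

end Balanced

/-- Evaluation at `1`, as an equivalence `Hom_B(B, N) ≃ N`. -/
def coindSelfEquiv (B N : Type) [Ring B] [AddCommGroup N] [Module B N] :
    CoindHom B B N ≃ₗ[B] N where
  toFun φ := φ 1
  map_add' φ ψ := rfl
  map_smul' b φ := by
    rw [CoindHom.smul_apply, op_smul_eq_mul, one_mul, RingHom.id_apply, ← map_smul, smul_eq_mul,
      mul_one]
  invFun v := LinearMap.toSpanSingleton B N v
  left_inv φ := CoindHom.ext fun b => by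
    change b • φ 1 = φ b
    rw [← map_smul, smul_eq_mul, mul_one]
  right_inv v := one_smul B v

/-- `Hom_B(B, -)` is the identity functor. -/
def coindSelfIso (k B : Type) [Field k] [Ring B] [Algebra k B] [FiniteDimensional k B] :
    coindFunctor k B B ≅ 𝟭 (FdMod k B) :=
  NatIso.ofComponents (fun N => FdMod.isoOfEquiv (N := N) (coindSelfEquiv B N.carrier))
    fun f => rfl

/-- The `k`-dual of a bimodule. -/
def DualBi (k X : Type) [Field k] [AddCommGroup X] [Module k X] : Type := Module.Dual k X

namespace DualBi

section
variable {k X : Type} [Field k] [AddCommGroup X] [Module k X]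

noncomputable instance : AddCommGroup (DualBi k X) :=
  inferInstanceAs (AddCommGroup (Module.Dual k X))

noncomputable instance : Module k (DualBi k X) := inferInstanceAs (Module k (Module.Dual k X))

instance [FiniteDimensional k X] : FiniteDimensional k (DualBi k X) :=
  inferInstanceAs (FiniteDimensional k (Module.Dual k X))

instance : FunLike (DualBi k X) X k := inferInstanceAs (FunLike (Module.Dual k X) X k)

instance : LinearMapClass (DualBi k X) k X k :=
  inferInstanceAs (LinearMapClass (Module.Dual k X) k X k)

theorem ext {w w' : DualBi k X} (h : ∀ x, w x = w' x) : w = w' := LinearMap.ext h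

theorem sum_apply {ι : Type} (s : Finset ι) (w : ι → DualBi k X) (x : X) :
    (∑ i ∈ s, w i) x = ∑ i ∈ s, w i x :=
  LinearMap.sum_apply s (fun i => (w i : Module.Dual k X)) x

/-- Every functional on the dual of a finite-dimensional space is an evaluation. -/
theorem exists_eval [FiniteDimensional k X] (ψ : DualBi k X →ₗ[k] k) :
    ∃ x, ∀ w : DualBi k X, w x = ψ w :=
  ⟨(Module.evalEquiv k X).symm ψ, fun w => Module.apply_evalEquiv_symm_apply k X w ψ⟩

theorem eval_injective [FiniteDimensional k X] {x y : X} (h : ∀ w : DualBi k X, w x = w y) :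
    x = y :=
  (Module.evalEquiv k X).injective (LinearMap.ext h)

end

section
variable {k B X : Type} [Field k] [Ring B] [Algebra k B] [AddCommGroup X] [Module k X]
  [Module B X] [IsScalarTower k B X]

noncomputable instance : Module Bᵐᵒᵖ (DualBi k X) where
  smul b w :=
    ({ toFun := fun x => w (unop b • x)
       map_add' := fun x y => by rw [smul_add, map_add]
       map_smul' := fun r x => by
         rw [← algebraMap_smul B r x, ← mul_smul, ← Algebra.commutes, mul_smul, algebraMap_smul,
           map_smul]; rfl } :
      Module.Dual k X)
  one_smul w := ext fun x => show w ((1 : B) • x) = w x by rw [one_smul]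
  mul_smul b c w := ext fun x => show w ((unop c * unop b) • x) = w (unop c • unop b • x) by
    rw [mul_smul]
  smul_zero b := rfl
  smul_add b w w' := rfl
  add_smul b c w := ext fun x => show w ((unop b + unop c) • x) = w (unop b • x) + w (unop c • x) by
    rw [add_smul, map_add]
  zero_smul w := ext fun x => show w ((0 : B) • x) = 0 by rw [zero_smul, map_zero]

theorem op_smul_apply (b : B) (w : DualBi k X) (x : X) : (op b • w) x = w (b • x) := rfl

instance : IsScalarTower k Bᵐᵒᵖ (DualBi k X) where
  smul_assoc r b w := ext fun x => show w ((r • unop b) • x) = r • w (unop b • x) by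
    rw [smul_assoc, map_smul]

end

section
variable {k B X : Type} [Field k] [Ring B] [Algebra k B] [AddCommGroup X] [Module k X]
  [Module Bᵐᵒᵖ X] [IsScalarTower k Bᵐᵒᵖ X]

noncomputable instance : Module B (DualBi k X) where
  smul b w :=
    ({ toFun := fun x => w (op b • x)
       map_add' := fun x y => by rw [smul_add, map_add]
       map_smul' := fun r x => by
         rw [← algebraMap_smul Bᵐᵒᵖ r x, ← mul_smul, ← Algebra.commutes, mul_smul,
           algebraMap_smul, map_smul]; rfl } :
      Module.Dual k X)
  one_smul w := ext fun x => show w (op (1 : B) • x) = w x by rw [op_one, one_smul]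
  mul_smul b c w := ext fun x => show w (op (b * c) • x) = w (op c • op b • x) by
    rw [op_mul, mul_smul]
  smul_zero b := rfl
  smul_add b w w' := rfl
  add_smul b c w := ext fun x => show w (op (b + c) • x) = w (op b • x) + w (op c • x) by
    rw [MulOpposite.op_add, add_smul, map_add]
  zero_smul w := ext fun x => show w (op (0 : B) • x) = 0 by rw [op_zero, zero_smul, map_zero]

theorem smul_apply (b : B) (w : DualBi k X) (x : X) : (b • w) x = w (op b • x) := rfl

instance : IsScalarTower k B (DualBi k X) where
  smul_assoc r b w := ext fun x => show w (op (r • b) • x) = r • w (op b • x) by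
    rw [op_smul, smul_assoc, map_smul]

instance [Module B X] [IsScalarTower k B X] [SMulCommClass B Bᵐᵒᵖ X] :
    SMulCommClass B Bᵐᵒᵖ (DualBi k X) where
  smul_comm b c w := ext fun x => show w (unop c • op b • x) = w (op b • unop c • x) by
    rw [smul_comm]

end

end DualBi

namespace CoindHom

variable {k B W : Type} [Field k] [Ring B] [Algebra k B] [AddCommGroup W] [Module B W]

instance rightModule : Module Bᵐᵒᵖ (CoindHom B W B) :=
  inferInstanceAs (Module Bᵐᵒᵖ (W →ₗ[B] B))

theorem op_smul_apply (b : B) (f : CoindHom B W B) (w : W) : (op b • f) w = f w * b := rfl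

instance [Module Bᵐᵒᵖ W] [SMulCommClass B Bᵐᵒᵖ W] : SMulCommClass B Bᵐᵒᵖ (CoindHom B W B) where
  smul_comm b c f := rfl

instance : IsScalarTower k Bᵐᵒᵖ (CoindHom B W B) where
  smul_assoc r b f := ext fun w => mul_smul_comm r (f w) (unop b)

end CoindHom

/-- A bimodule `X` whose dual `W = D(X)` is an invertible bimodule, stated elementwise. -/
structure InvertibleDual (k B X : Type) [Field k] [Ring B] [Algebra k B]
    [AddCommGroup X] [Module B X] [Module Bᵐᵒᵖ X] [SMulCommClass B Bᵐᵒᵖ X]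
    [Module k X] [IsScalarTower k B X] [IsScalarTower k Bᵐᵒᵖ X] : Prop where
  generator : ∃ (n : ℕ) (f : Fin n → CoindHom B (DualBi k X) B) (w : Fin n → DualBi k X),
    ∑ i, f i (w i) = 1
  dualBasis : ∃ (n : ℕ) (f : Fin n → CoindHom B (DualBi k X) B) (w : Fin n → DualBi k X),
    ∀ u, ∑ i, f i u • w i = u
  exists_right : ∀ (f : CoindHom B (DualBi k X) B) (w : DualBi k X),
    ∃ b : B, ∀ u : DualBi k X, f u • w = op b • u
  faithful : ∀ b : B, (∀ u : DualBi k X, op b • u = 0) → b = 0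

namespace InvertibleDual

variable {k B X : Type} [Field k] [Ring B] [Algebra k B]
  [AddCommGroup X] [Module B X] [Module Bᵐᵒᵖ X] [SMulCommClass B Bᵐᵒᵖ X]
  [Module k X] [IsScalarTower k B X] [IsScalarTower k Bᵐᵒᵖ X]

theorem right_ext (h : InvertibleDual k B X) {b c : B}
    (hbc : ∀ u : DualBi k X, op b • u = op c • u) : b = c := by
  rw [← sub_eq_zero]
  exact h.faithful _ fun u => by rw [MulOpposite.op_sub, sub_smul, hbc, sub_self]

variable (h : InvertibleDual k B X)

/-- The element of `B` through which `u ↦ f u • w` is right multiplication. -/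
noncomputable def bracket (f : CoindHom B (DualBi k X) B) (w : DualBi k X) : B :=
  (h.exists_right f w).choose

theorem smul_eq (f : CoindHom B (DualBi k X) B) (w u : DualBi k X) :
    f u • w = op (h.bracket f w) • u := (h.exists_right f w).choose_spec u

theorem bracket_eq {f : CoindHom B (DualBi k X) B} {w : DualBi k X} {b : B}
    (hb : ∀ u : DualBi k X, f u • w = op b • u) : h.bracket f w = b :=
  h.right_ext fun u => by rw [← smul_eq, hb]

theorem bracket_add_left (f g : CoindHom B (DualBi k X) B) (w : DualBi k X) :
    h.bracket (f + g) w = h.bracket f w + h.bracket g w := h.bracket_eq fun u => by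
  rw [CoindHom.add_apply, add_smul, h.smul_eq, h.smul_eq, MulOpposite.op_add, add_smul]

theorem bracket_add_right (f : CoindHom B (DualBi k X) B) (w w' : DualBi k X) :
    h.bracket f (w + w') = h.bracket f w + h.bracket f w' := h.bracket_eq fun u => by
  rw [smul_add, h.smul_eq, h.smul_eq, MulOpposite.op_add, add_smul]

theorem bracket_smul_right (f : CoindHom B (DualBi k X) B) (r : k) (w : DualBi k X) :
    h.bracket f (r • w) = r • h.bracket f w := h.bracket_eq fun u => by
  rw [op_smul, smul_assoc, ← h.smul_eq, ← algebraMap_smul B r w, ← mul_smul, ← Algebra.commutes,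
    mul_smul, algebraMap_smul]

theorem bracket_smul (b : B) (f : CoindHom B (DualBi k X) B) (w : DualBi k X) :
    h.bracket (b • f) w = b * h.bracket f w := h.bracket_eq fun u => by
  rw [CoindHom.smul_apply, h.smul_eq, op_mul, mul_smul]

theorem bracket_op_smul (b : B) (f : CoindHom B (DualBi k X) B) (w : DualBi k X) :
    h.bracket (op b • f) w = h.bracket f (b • w) := h.bracket_eq fun u => by
  rw [CoindHom.op_smul_apply, mul_smul, h.smul_eq]

theorem bracket_smul_op (b : B) (f : CoindHom B (DualBi k X) B) (w : DualBi k X) :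
    h.bracket f (op b • w) = h.bracket f w * b := h.bracket_eq fun u => by
  rw [smul_comm, h.smul_eq, op_mul, mul_smul]

theorem bracket_smul_hom (f g : CoindHom B (DualBi k X) B) (w : DualBi k X) :
    h.bracket f w • g = op (g w) • f := CoindHom.ext fun u => by
  rw [CoindHom.smul_apply, ← h.smul_eq, map_smul g, CoindHom.op_smul_apply, smul_eq_mul]


variable (k B X) in
/-- The evaluation pairing `W × Hom_B(W, B) → B`. -/
noncomputable def evalMap : BalancedMap B (DualBi k X) (CoindHom B (DualBi k X) B) B where
  toHom := AddMonoidHom.mk' (fun w => AddMonoidHom.mk' (fun f => f w) fun f g => rfl)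
    fun w w' => AddMonoidHom.ext fun f => map_add f w w'
  smul_left b w f := map_smul f b w
  balanced b w f := rfl
  smul_right b w f := rfl

theorem evalMap_isUniversal (h : InvertibleDual k B X) : (evalMap k B X).IsUniversal := by
  obtain ⟨n, f, w, hfw⟩ := h.generator
  refine BalancedMap.isUniversal_of_left _ w
    (fun i => AddMonoidHom.mk' (fun b => op b • f i) fun b c => by
      rw [MulOpposite.op_add, add_smul])
    (fun i u => h.bracket (f i) u) (fun b => ?_) (fun i u g => ?_) fun u => ?_
  · change ∑ i, f i (w i) * b = b
    rw [← Finset.sum_mul, hfw, one_mul]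
  · exact (h.bracket_smul_hom (f i) g u).symm
  · simp only [← h.smul_eq]
    rw [← Finset.sum_smul, hfw, one_smul]

/-- The pairing `Hom_B(W, B) × W → B`. -/
noncomputable def bracketMap : BalancedMap B (CoindHom B (DualBi k X) B) (DualBi k X) B where
  toHom := AddMonoidHom.mk' (fun f => AddMonoidHom.mk' (h.bracket f) (h.bracket_add_right f))
    fun f g => AddMonoidHom.ext (h.bracket_add_left f g)
  smul_left b f w := h.bracket_smul b f w
  balanced b f w := h.bracket_op_smul b f w
  smul_right b f w := h.bracket_smul_op b f w

theorem sum_bracket {ι : Type} [Fintype ι] {f : ι → CoindHom B (DualBi k X) B}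
    {w : ι → DualBi k X} (hfw : ∀ u, ∑ i, f i u • w i = u) : ∑ i, h.bracket (f i) (w i) = 1 :=
  h.right_ext fun u => by
    simp only [Finset.op_sum, Finset.sum_smul, ← h.smul_eq, hfw, op_one, one_smul]

theorem bracketMap_isUniversal : h.bracketMap.IsUniversal := by
  obtain ⟨n, f, w, hfw⟩ := h.dualBasis
  have hsum := h.sum_bracket hfw
  refine BalancedMap.isUniversal_of_left _ f
    (fun i => AddMonoidHom.mk' (fun b => op b • w i) fun b c => by
      rw [MulOpposite.op_add, add_smul])
    (fun i g => g (w i)) (fun b => ?_) (fun i g u => ?_) fun g => ?_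
  · change ∑ i, h.bracket (f i) (op b • w i) = b
    simp only [h.bracket_smul_op]
    rw [← Finset.sum_mul, hsum, one_mul]
  · exact (h.smul_eq g u (w i)).symm
  · simp only [← h.bracket_smul_hom]
    rw [← Finset.sum_smul, hsum, one_smul]

variable (k B X) in
/-- The pairing `W × X → D(B)`. -/
noncomputable def leftPairing : BalancedMap B (DualBi k X) X (Module.Dual k B) where
  toHom := AddMonoidHom.mk' (fun w => AddMonoidHom.mk' (fun x =>
      { toFun := fun b => w (op b • x)
        map_add' := fun b c => by rw [MulOpposite.op_add, add_smul, map_add]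
        map_smul' := fun r b => by rw [op_smul, smul_assoc, map_smul]; rfl })
      fun x y => LinearMap.ext fun b => show w (op b • (x + y)) = w (op b • x) + w (op b • y) by
        rw [smul_add, map_add])
    fun w w' => rfl
  smul_left b w x := LinearMap.ext fun c => show w (op b • op c • x) = w (op (c * b) • x) by
    rw [op_mul, mul_smul]
  balanced b w x := LinearMap.ext fun c => show w (b • op c • x) = w (op c • b • x) by
    rw [smul_comm]
  smul_right b w x := LinearMap.ext fun c => show w (op c • op b • x) = w (op (b * c) • x) by
    rw [op_mul, mul_smul]

variable (k B X) in
/-- The pairing `X × W → D(B)`. -/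
noncomputable def rightPairing : BalancedMap B X (DualBi k X) (Module.Dual k B) where
  toHom := AddMonoidHom.mk' (fun x => AddMonoidHom.mk' (fun w =>
      { toFun := fun b => w (b • x)
        map_add' := fun b c => by rw [add_smul, map_add]
        map_smul' := fun r b => by rw [smul_assoc, map_smul]; rfl })
      fun w w' => rfl)
    fun x y => AddMonoidHom.ext fun w => LinearMap.ext fun b =>
      show w (b • (x + y)) = w (b • x) + w (b • y) by rw [smul_add, map_add]
  smul_left b x w := LinearMap.ext fun c => show w (c • b • x) = w ((c * b) • x) by
    rw [mul_smul]
  balanced b x w := LinearMap.ext fun c => show w (c • op b • x) = w (op b • c • x) by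
    rw [smul_comm]
  smul_right b x w := LinearMap.ext fun c => show w (b • c • x) = w ((b * c) • x) by
    rw [mul_smul]

variable [FiniteDimensional k X]

/-- The element of `X` representing a functional on `D(X)` that depends additively on a
parameter. -/
theorem exists_representing {P : Type} [AddCommGroup P] (ψ : P →+ DualBi k X →ₗ[k] k) :
    ∃ s : P →+ X, ∀ φ (u : DualBi k X), u (s φ) = ψ φ u := by
  choose s hs using fun φ => DualBi.exists_eval (ψ φ)
  have hadd : ∀ φ φ', s (φ + φ') = s φ + s φ' := fun φ φ' =>
    DualBi.eval_injective (k := k) fun w => by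
    rw [map_add w, hs, hs, hs, map_add]; rfl
  exact ⟨AddMonoidHom.mk' s hadd, hs⟩

theorem leftPairing_isUniversal (h : InvertibleDual k B X) : (leftPairing k B X).IsUniversal := by
  obtain ⟨n, f, w, hfw⟩ := h.generator
  have hs : ∀ i, ∃ s : Module.Dual k B →+ X, ∀ φ (u : DualBi k X), u (s φ) = φ (f i u) := fun i =>
    exists_representing (AddMonoidHom.mk' (fun φ : Module.Dual k B => φ.comp
      ((show DualBi k X →ₗ[B] B from f i).restrictScalars k)) fun φ φ' => rfl)
  choose s hs using hs
  refine BalancedMap.isUniversal_of_left _ w s (fun i u => h.bracket (f i) u)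
    (fun φ => LinearMap.ext fun b => ?_) (fun i u x => DualBi.eval_injective (k := k) fun v => ?_)
    fun u => ?_
  · rw [LinearMap.sum_apply]
    change ∑ i, (b • w i) (s i φ) = φ b
    simp only [hs, map_smul (f _), smul_eq_mul]
    rw [← map_sum, ← Finset.mul_sum, hfw, mul_one]
  · rw [hs]
    change (f i v • u) x = (op (h.bracket (f i) u) • v) x
    rw [h.smul_eq]
  · simp only [← h.smul_eq]
    rw [← Finset.sum_smul, hfw, one_smul]

theorem rightPairing_isUniversal (h : InvertibleDual k B X) : (rightPairing k B X).IsUniversal := by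
  obtain ⟨n, f, w, hfw⟩ := h.dualBasis
  have hs : ∀ i, ∃ s : Module.Dual k B →+ X, ∀ φ (u : DualBi k X),
      u (s φ) = φ (h.bracket (f i) u) := fun i =>
    exists_representing (AddMonoidHom.mk' (fun φ : Module.Dual k B => φ.comp
      ({ toFun := h.bracket (f i)
         map_add' := h.bracket_add_right (f i)
         map_smul' := h.bracket_smul_right (f i) } :
          DualBi k X →ₗ[k] B)) fun φ φ' => rfl)
  choose s hs using hs
  refine BalancedMap.isUniversal_of_right _ w s (fun i u => f i u)
    (fun φ => LinearMap.ext fun b => ?_)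
    (fun i x u => DualBi.eval_injective (k := k) fun v => ?_) hfw
  · rw [LinearMap.sum_apply]
    change ∑ i, (op b • w i) (s i φ) = φ b
    simp only [hs, h.bracket_smul_op]
    rw [← map_sum, ← Finset.sum_mul, h.sum_bracket hfw, one_mul]
  · rw [hs]
    change (op (h.bracket (f i) v) • u) x = (f i u • v) x
    rw [h.smul_eq]

variable [FiniteDimensional k B]

/-- The autoequivalence `Hom_B(V, -)` with `V = Hom_B(W, B)`, with inverse `Hom_B(W, -)`. -/
noncomputable def autoequivalence : FdMod k B ≌ FdMod k B :=
  CategoryTheory.Equivalence.mk (coindFunctor k B (CoindHom B (DualBi k X) B))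
    (coindFunctor k B (DualBi k X))
    ((coindSelfIso k B).symm ≪≫ h.bracketMap_isUniversal.coindIso k)
    ((h.evalMap_isUniversal.coindIso k).symm ≪≫ coindSelfIso k B)

/-- If `D(X)` is invertible then graded modules over `B ⋉ X` and `B ⋉ D(B)` agree. -/
theorem nonempty_equiv (h : InvertibleDual k B X) :
    Nonempty (GSeq (coindFunctor k B X) ≌ GSeq (coindFunctor k B (Module.Dual k B))) := by
  let e := h.autoequivalence
  have a1 : coindFunctor k B (Module.Dual k B) ≅ e.inverse ⋙ coindFunctor k B X :=
    h.leftPairing_isUniversal.coindIso k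
  have a2 : coindFunctor k B (Module.Dual k B) ≅ coindFunctor k B X ⋙ e.inverse :=
    h.rightPairing_isUniversal.coindIso k
  have b1 : coindFunctor k B X ≅ e.functor ⋙ coindFunctor k B (Module.Dual k B) :=
    (Functor.leftUnitor _).symm ≪≫ Functor.isoWhiskerRight e.unitIso _ ≪≫
      Functor.isoWhiskerLeft e.functor a1.symm
  have b2 : coindFunctor k B (Module.Dual k B) ⋙ e.functor ≅ coindFunctor k B X :=
    Functor.isoWhiskerRight a2 e.functor ≪≫
      Functor.isoWhiskerLeft (coindFunctor k B X) e.counitIso ≪≫ Functor.rightUnitor _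
  exact GSeq.nonempty_equiv_of_commute e ⟨b1⟩ ⟨b2 ≪≫ b1⟩

end InvertibleDual

section BeiTop

variable (k : Type) [Field k] (A : Type) [Ring A] [Algebra k A]
variable (𝒜 : ℕ → Submodule k A) [GradedAlgebra 𝒜] (c : ℕ)

/-- The bimodule over the Beilinson algebra whose trivial extension recovers the graded
modules over `A`: the matrices with `(i, j)` entry in `A_{c + j - i}`. -/
def beiTop : Submodule k (Matrix (Fin c) (Fin c) A) where
  carrier := {M | ∀ i j : Fin c, M i j ∈ 𝒜 (c + (j : ℕ) - (i : ℕ))}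
  zero_mem' := fun i j => zero_mem _
  add_mem' := fun hM hN i j => add_mem (hM i j) (hN i j)
  smul_mem' := fun r M hM i j => Submodule.smul_mem _ r (hM i j)

variable {k A 𝒜 c}

theorem mul_mem_beiTop {b x : Matrix (Fin c) (Fin c) A} (hb : b ∈ bei k A 𝒜 c)
    (hx : x ∈ beiTop k A 𝒜 c) : b * x ∈ beiTop k A 𝒜 c := fun i j => by
  rw [Matrix.mul_apply]
  refine Submodule.sum_mem _ fun l _ => ?_
  rcases le_or_gt (i : ℕ) (l : ℕ) with h | h
  · have := SetLike.mul_mem_graded ((hb i l).1 h) (hx l j)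
    rwa [show (l : ℕ) - i + (c + j - l) = c + j - i by omega] at this
  · rw [(hb i l).2 h, zero_mul]
    exact zero_mem _

theorem mul_mem_beiTop' {b x : Matrix (Fin c) (Fin c) A} (hb : b ∈ bei k A 𝒜 c)
    (hx : x ∈ beiTop k A 𝒜 c) : x * b ∈ beiTop k A 𝒜 c := fun i j => by
  rw [Matrix.mul_apply]
  refine Submodule.sum_mem _ fun l _ => ?_
  rcases le_or_gt (l : ℕ) (j : ℕ) with h | h
  · have := SetLike.mul_mem_graded (hx i l) ((hb l j).1 h)
    rwa [show c + (l : ℕ) - i + (j - l) = c + j - i by omega] at this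
  · rw [(hb l j).2 h, mul_zero]
    exact zero_mem _

instance beiTopLeftModule : Module ↥(bei k A 𝒜 c) ↥(beiTop k A 𝒜 c) where
  smul b x := ⟨b.1 * x.1, mul_mem_beiTop b.2 x.2⟩
  one_smul x := Subtype.ext (one_mul x.1)
  mul_smul b b' x := Subtype.ext (mul_assoc b.1 b'.1 x.1)
  smul_zero b := Subtype.ext (mul_zero b.1)
  smul_add b x y := Subtype.ext (mul_add b.1 x.1 y.1)
  add_smul b b' x := Subtype.ext (add_mul b.1 b'.1 x.1)
  zero_smul x := Subtype.ext (zero_mul x.1)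

instance beiTopRightModule : Module (↥(bei k A 𝒜 c))ᵐᵒᵖ ↥(beiTop k A 𝒜 c) where
  smul b x := ⟨x.1 * (unop b).1, mul_mem_beiTop' (unop b).2 x.2⟩
  one_smul x := Subtype.ext (mul_one x.1)
  mul_smul b b' x := Subtype.ext (mul_assoc x.1 (unop b').1 (unop b).1).symm
  smul_zero b := Subtype.ext (zero_mul _)
  smul_add b x y := Subtype.ext (add_mul x.1 y.1 _)
  add_smul b b' x := Subtype.ext (mul_add x.1 _ _)
  zero_smul x := Subtype.ext (mul_zero x.1)

theorem coe_bei_smul (b : ↥(bei k A 𝒜 c)) (x : ↥(beiTop k A 𝒜 c)) :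
    ((b • x : ↥(beiTop k A 𝒜 c)) : Matrix (Fin c) (Fin c) A) = b.1 * x.1 := rfl

theorem coe_bei_op_smul (b : ↥(bei k A 𝒜 c)) (x : ↥(beiTop k A 𝒜 c)) :
    ((op b • x : ↥(beiTop k A 𝒜 c)) : Matrix (Fin c) (Fin c) A) = x.1 * b.1 := rfl

instance : SMulCommClass ↥(bei k A 𝒜 c) (↥(bei k A 𝒜 c))ᵐᵒᵖ ↥(beiTop k A 𝒜 c) where
  smul_comm b b' x := Subtype.ext (mul_assoc b.1 x.1 (unop b').1).symm

instance : IsScalarTower k ↥(bei k A 𝒜 c) ↥(beiTop k A 𝒜 c) where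
  smul_assoc r b x := Subtype.ext (smul_mul_assoc r b.1 x.1)

instance : IsScalarTower k (↥(bei k A 𝒜 c))ᵐᵒᵖ ↥(beiTop k A 𝒜 c) where
  smul_assoc r b x := Subtype.ext (mul_smul_comm r x.1 (unop b).1)

variable (k A 𝒜 c) in
/-- The trivial extension of the Beilinson algebra by `beiTop`. -/
abbrev BeiExt : Type := TrivSqZeroExt ↥(bei k A 𝒜 c) ↥(beiTop k A 𝒜 c)

namespace BeiExt

/-- The sum of the two components, as a matrix over `A`. -/
def toMat (r : BeiExt k A 𝒜 c) : Matrix (Fin c) (Fin c) A := r.fst.1 + r.snd.1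

theorem toMat_apply (r : BeiExt k A 𝒜 c) (i j : Fin c) :
    r.toMat i j = r.fst.1 i j + r.snd.1 i j := rfl

theorem toMat_add (r s : BeiExt k A 𝒜 c) : (r + s).toMat = r.toMat + s.toMat :=
  add_add_add_comm _ _ _ _

theorem toMat_zero : (0 : BeiExt k A 𝒜 c).toMat = 0 := add_zero _

theorem toMat_one : (1 : BeiExt k A 𝒜 c).toMat = 1 := add_zero _

theorem toMat_smul (t : k) (r : BeiExt k A 𝒜 c) : (t • r).toMat = t • r.toMat :=
  (smul_add t r.fst.1 r.snd.1).symm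

theorem toMat_mul (htop : ∀ n : ℕ, c < n → 𝒜 n = ⊥) (r s : BeiExt k A 𝒜 c) :
    (r * s).toMat = r.toMat * s.toMat := by
  have h : r.snd.1 * s.snd.1 = 0 := by
    ext i j
    rw [Matrix.mul_apply, Matrix.zero_apply]
    refine Finset.sum_eq_zero fun l _ => ?_
    have := SetLike.mul_mem_graded (r.snd.2 i l) (s.snd.2 l j)
    rw [htop _ (by omega)] at this
    exact this
  have h1 : (r * s).fst.1 = r.fst.1 * s.fst.1 := rfl
  have h2 : (r * s).snd.1 = r.fst.1 * s.snd.1 + r.snd.1 * s.fst.1 := rfl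
  rw [toMat, toMat, toMat, h1, h2, add_mul, mul_add, mul_add, h]
  abel

theorem toMat_injective : Function.Injective (toMat : BeiExt k A 𝒜 c → _) := by
  have key : ∀ r : BeiExt k A 𝒜 c, r.toMat = 0 → r = 0 := fun r hr => by
    have hfs : ∀ i j, r.fst.1 i j = 0 ∧ r.snd.1 i j = 0 := fun i j => by
      have h : r.fst.1 i j + r.snd.1 i j = 0 := congrFun (congrFun hr i) j
      rcases le_or_gt (i : ℕ) (j : ℕ) with hij | hij
      · have h1 := (r.fst.2 i j).1 hij
        have h2 := r.snd.2 i j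
        have hne : (j : ℕ) - i ≠ c + j - i := by omega
        have h3 : r.fst.1 i j = - r.snd.1 i j := eq_neg_of_add_eq_zero_left h
        have h4 : r.fst.1 i j = 0 := by
          rw [← DirectSum.decompose_of_mem_same 𝒜 h1, h3]
          exact DirectSum.decompose_of_mem_ne 𝒜 (neg_mem h2) hne.symm
        exact ⟨h4, by rwa [h4, zero_add] at h⟩
      · have h4 := (r.fst.2 i j).2 hij
        exact ⟨h4, by rwa [h4, zero_add] at h⟩
    refine TrivSqZeroExt.ext (Subtype.ext ?_) (Subtype.ext ?_)
    · ext i j; exact (hfs i j).1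
    · ext i j; exact (hfs i j).2
  intro r s h
  rw [← sub_eq_zero]
  apply key
  have : (r - s).toMat + s.toMat = r.toMat := by rw [← toMat_add, sub_add_cancel]
  rw [h] at this
  exact add_eq_right.1 this

/-- The diagonal idempotents. -/
def idem (i : Fin c) : ↥(bei k A 𝒜 c) :=
  ⟨Matrix.single i i 1, fun p q => by
    by_cases h : i = p ∧ i = q
    · obtain ⟨rfl, rfl⟩ := h
      exact ⟨fun _ => by simpa using SetLike.one_mem_graded 𝒜, fun h => absurd h (lt_irrefl _)⟩
    · rw [Matrix.single_apply, if_neg h]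
      exact ⟨fun _ => zero_mem _, fun _ => rfl⟩⟩

theorem idem_mul_self (i : Fin c) : (idem i : ↥(bei k A 𝒜 c)) * idem i = idem i :=
  Subtype.ext (by simp [idem])

theorem idem_mul_of_ne {i j : Fin c} (h : i ≠ j) : (idem i : ↥(bei k A 𝒜 c)) * idem j = 0 :=
  Subtype.ext (Matrix.single_mul_single_of_ne (1 : A) i i j h 1)

theorem sum_idem : ∑ i, (idem i : ↥(bei k A 𝒜 c)) = 1 :=
  Subtype.ext (by
    rw [AddSubmonoidClass.coe_finsetSum]
    exact Matrix.sum_single_one)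

theorem toMat_inl_idem (i : Fin c) :
    toMat (TrivSqZeroExt.inl (idem i) : BeiExt k A 𝒜 c) = Matrix.single i i 1 := add_zero _

variable (k A 𝒜 c) in
/-- The embedding of `A` in the trivial extension, taking a homogeneous element `a` to the matrix
with entries `a` at all positions `(i, j)` with `j - i` congruent to the degree of `a`. -/
def embed (a : A) : BeiExt k A 𝒜 c :=
  TrivSqZeroExt.inl ⟨Matrix.of fun i j => if (i : ℕ) ≤ j then
      (DirectSum.decompose 𝒜 a ((j : ℕ) - i) : A) else 0,
    fun i j => ⟨fun h => by rw [Matrix.of_apply, if_pos h]; exact SetLike.coe_mem _,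
      fun h => by rw [Matrix.of_apply, if_neg (not_le.2 h)]⟩⟩ +
  TrivSqZeroExt.inr ⟨Matrix.of fun i j => (DirectSum.decompose 𝒜 a (c + (j : ℕ) - i) : A),
    fun i j => SetLike.coe_mem _⟩

theorem embed_fst_apply (a : A) (i j : Fin c) : (embed k A 𝒜 c a).fst.1 i j =
    if (i : ℕ) ≤ j then (DirectSum.decompose 𝒜 a ((j : ℕ) - i) : A) else 0 := by
  simp [embed]

theorem embed_snd_apply (a : A) (i j : Fin c) : (embed k A 𝒜 c a).snd.1 i j =
    (DirectSum.decompose 𝒜 a (c + (j : ℕ) - i) : A) := by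
  simp [embed]

theorem embed_add (a b : A) : embed k A 𝒜 c (a + b) = embed k A 𝒜 c a + embed k A 𝒜 c b := by
  refine TrivSqZeroExt.ext (Subtype.ext ?_) (Subtype.ext ?_)
  · ext i j
    rw [TrivSqZeroExt.fst_add]
    change _ = (embed k A 𝒜 c a).fst.1 i j + (embed k A 𝒜 c b).fst.1 i j
    simp only [embed_fst_apply, DirectSum.decompose_add, DirectSum.add_apply]
    split_ifs <;> simp
  · ext i j
    rw [TrivSqZeroExt.snd_add]
    change _ = (embed k A 𝒜 c a).snd.1 i j + (embed k A 𝒜 c b).snd.1 i j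
    simp only [embed_snd_apply, DirectSum.decompose_add, DirectSum.add_apply]
    simp

theorem embed_smul (r : k) (a : A) : embed k A 𝒜 c (r • a) = r • embed k A 𝒜 c a := by
  refine TrivSqZeroExt.ext (Subtype.ext ?_) (Subtype.ext ?_)
  · ext i j
    rw [TrivSqZeroExt.fst_smul]
    change _ = r • (embed k A 𝒜 c a).fst.1 i j
    simp only [embed_fst_apply, DirectSum.decompose_smul, DirectSum.smul_apply]
    split_ifs <;> simp
  · ext i j
    rw [TrivSqZeroExt.snd_smul]
    change _ = r • (embed k A 𝒜 c a).snd.1 i j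
    simp only [embed_snd_apply, DirectSum.decompose_smul, DirectSum.smul_apply]
    simp

theorem toMat_embed {a : A} {d : ℕ} (ha : a ∈ 𝒜 d) (i j : Fin c) :
    (embed k A 𝒜 c a).toMat i j = if (i : ℕ) + d = j ∨ (i : ℕ) + d = c + j then a else 0 := by
  have hj := j.2
  have hi := i.2
  rw [toMat_apply, embed_fst_apply, embed_snd_apply]
  have hdec : ∀ e : ℕ, (DirectSum.decompose 𝒜 a e : A) = if e = d then a else 0 := fun e => by
    split_ifs with h
    · rw [h]; exact DirectSum.decompose_of_mem_same 𝒜 ha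
    · exact DirectSum.decompose_of_mem_ne 𝒜 ha (Ne.symm h)
  rw [hdec, hdec]
  split_ifs <;> first | omega | simp

theorem embed_one : embed k A 𝒜 c 1 = 1 := toMat_injective <| by
  ext i j
  rw [toMat_embed (SetLike.one_mem_graded 𝒜), toMat_one, Matrix.one_apply]
  have := i.2
  congr 1
  rw [Fin.ext_iff, eq_iff_iff]
  omega

theorem induction_homogeneous (𝒜 : ℕ → Submodule k A) [GradedAlgebra 𝒜] {P : A → Prop}
    (add : ∀ a b, P a → P b → P (a + b)) (hom : ∀ d, ∀ a ∈ 𝒜 d, P a) (a : A) : P a :=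
  DirectSum.Decomposition.inductionOn 𝒜 (hom 0 0 (zero_mem _)) (fun a => hom _ a.1 a.2)
    add a

theorem embed_mul (htop : ∀ n : ℕ, c < n → 𝒜 n = ⊥) (a b : A) :
    embed k A 𝒜 c (a * b) = embed k A 𝒜 c a * embed k A 𝒜 c b := by
  have hzero : embed k A 𝒜 c 0 = 0 := by
    have := embed_smul (𝒜 := 𝒜) (c := c) (0 : k) 0
    rwa [zero_smul, zero_smul] at this
  induction a using induction_homogeneous 𝒜 with
  | add a a' h h' => rw [add_mul, embed_add, embed_add, h, h', add_mul]
  | hom d a ha =>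
    induction b using induction_homogeneous 𝒜 with
    | add b b' h h' => rw [mul_add, embed_add, embed_add, h, h', mul_add]
    | hom e b hb =>
      by_cases hd : c < d
      · rw [htop d hd] at ha
        rw [(Submodule.mem_bot k).1 ha, zero_mul, hzero, zero_mul]
      by_cases he : c < e
      · rw [htop e he] at hb
        rw [(Submodule.mem_bot k).1 hb, mul_zero, hzero, mul_zero]
      have hab := SetLike.mul_mem_graded ha hb
      apply toMat_injective
      rw [toMat_mul htop]
      ext i j
      rw [toMat_embed hab, Matrix.mul_apply]
      simp only [toMat_embed ha, toMat_embed hb, ite_mul, mul_ite, zero_mul, mul_zero]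
      have hi := i.2
      have hj := j.2
      by_cases hde : c < d + e
      · rw [htop _ hde] at hab
        have h0 : a * b = 0 := (Submodule.mem_bot k).1 hab
        simp [h0]
      by_cases h : (i : ℕ) + d < c
      · rw [Finset.sum_eq_single ⟨i + d, h⟩]
        · dsimp only
          split_ifs <;> first | rfl | omega
        · intro l _ hl
          rw [Ne, Fin.ext_iff] at hl
          dsimp only at hl
          split_ifs <;> first | rfl | omega
        · simp
      · rw [Finset.sum_eq_single ⟨i + d - c, by omega⟩]
        · dsimp only
          split_ifs <;> first | rfl | omega
        · intro l _ hl
          rw [Ne, Fin.ext_iff] at hl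
          dsimp only at hl
          split_ifs <;> first | rfl | omega
        · simp

/-- The embedding of `A` in the trivial extension, as a ring homomorphism. -/
def embedHom (htop : ∀ n : ℕ, c < n → 𝒜 n = ⊥) : A →+* BeiExt k A 𝒜 c :=
  RingHom.mk' ⟨⟨embed k A 𝒜 c, embed_one⟩, embed_mul htop⟩ embed_add

theorem sum_embed_mul_idem (htop : ∀ n : ℕ, c < n → 𝒜 n = ⊥) (r : BeiExt k A 𝒜 c) :
    ∑ i, ∑ j, embed k A 𝒜 c (r.toMat i j) * TrivSqZeroExt.inl (idem j) = r := by
  let T : BeiExt k A 𝒜 c →+ Matrix (Fin c) (Fin c) A := AddMonoidHom.mk' toMat toMat_add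
  apply toMat_injective
  change T _ = _
  rw [map_sum]
  simp only [map_sum]
  ext p q
  have hterm : ∀ i j, T (embed k A 𝒜 c (r.toMat i j) * TrivSqZeroExt.inl (idem j)) p q =
      if j = q ∧ i = p then r.toMat i j else 0 := fun i j => by
    change toMat _ p q = _
    rw [toMat_mul htop, toMat_inl_idem]
    by_cases hjq : j = q
    · subst hjq
      rw [Matrix.mul_single_apply_same, mul_one, toMat_apply r]
      have hx := r.fst.2 i j
      have hy := r.snd.2 i j
      generalize r.fst.1 i j = x at *
      generalize r.snd.1 i j = y at *
      rw [embed_add, toMat_add, Matrix.add_apply, toMat_embed hy]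
      have hi := i.2
      have hj := j.2
      have hp := p.2
      rcases le_or_gt (i : ℕ) j with h | h
      · rw [toMat_embed (hx.1 h)]
        simp only [Fin.ext_iff, true_and]
        split_ifs <;> first | omega | simp
      · rw [hx.2 h, toMat_embed (zero_mem (𝒜 0))]
        simp only [Fin.ext_iff, true_and]
        split_ifs <;> first | omega | simp
    · rw [Matrix.mul_single_apply_of_ne _ _ _ _ _ (Ne.symm hjq), if_neg (fun h => hjq h.1)]
  rw [Matrix.sum_apply]
  simp only [Matrix.sum_apply, hterm]
  rw [Finset.sum_eq_single p, Finset.sum_eq_single q]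
  · simp
  · intro j _ hj; simp [hj]
  · simp
  · intro i _ hi; simp [hi]
  · simp

end BeiExt

end BeiTop

theorem exists_eq_mul_sub_fin {c : ℕ} (hc : 1 ≤ c) (m : ℤ) :
    ∃ (n : ℤ) (i : Fin c), m = c * n - (i : ℕ) := by
  have hc' : (0 : ℤ) < c := by exact_mod_cast hc
  have h0 := Int.emod_nonneg (-m) hc'.ne'
  have h1 := Int.emod_lt_of_pos (-m) hc'
  refine ⟨-((-m) / c), ⟨((-m) % c).toNat, by omega⟩, ?_⟩
  have h2 := Int.mul_ediv_add_emod (-m) c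
  dsimp only
  rw [Int.toNat_of_nonneg h0]
  linarith

theorem eq_and_eq_of_mul_sub_fin {c : ℕ} {n n' : ℤ} {i i' : Fin c}
    (h : (c : ℤ) * n - (i : ℕ) = c * n' - (i' : ℕ)) : n = n' ∧ i = i' := by
  have hi := i.2
  have hi' := i'.2
  have hn : n = n' := by
    rcases lt_trichotomy n n' with hlt | heq | hlt
    · have : (c : ℤ) * (n + 1) ≤ c * n' := by
        apply mul_le_mul_of_nonneg_left <;> omega
      rw [mul_add] at this
      omega
    · exact heq
    · have : (c : ℤ) * (n' + 1) ≤ c * n := by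
        apply mul_le_mul_of_nonneg_left <;> omega
      rw [mul_add] at this
      omega
  subst hn
  exact ⟨rfl, Fin.ext (by omega)⟩

namespace BeiExt

variable {k : Type} [Field k] {A : Type} [Ring A] [Algebra k A]
variable {𝒜 : ℕ → Submodule k A} [GradedAlgebra 𝒜] {c : ℕ}

theorem idem_mul_embed_mul_idem (htop : ∀ n : ℕ, c < n → 𝒜 n = ⊥) {a : A} {d : ℕ}
    (ha : a ∈ 𝒜 d) {i i' : Fin c} (h : (i' : ℕ) + d = i ∨ (i' : ℕ) + d = c + i) :
    TrivSqZeroExt.inl (idem i') * (embed k A 𝒜 c a * TrivSqZeroExt.inl (idem i)) =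
      embed k A 𝒜 c a * TrivSqZeroExt.inl (idem i) := by
  apply toMat_injective
  rw [toMat_mul htop, toMat_mul htop, toMat_inl_idem, toMat_inl_idem]
  ext p q
  by_cases hq : q = i
  · subst hq
    by_cases hp : p = i'
    · subst hp
      rw [Matrix.single_mul_apply_same, one_mul]
    · rw [Matrix.single_mul_apply_of_ne _ _ _ _ _ hp, Matrix.mul_single_apply_same, mul_one,
        toMat_embed ha, if_neg]
      rw [Fin.ext_iff] at hp
      have := p.2
      have := i'.2
      have := q.2
      omega
  · rw [← Matrix.mul_assoc, Matrix.mul_single_apply_of_ne _ _ _ _ _ hq,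
      Matrix.mul_single_apply_of_ne _ _ _ _ _ hq]

theorem snd_embed_mul_idem {a : A} {d : ℕ} (ha : a ∈ 𝒜 d) {i : Fin c} (h : d ≤ i) :
    (embed k A 𝒜 c a * TrivSqZeroExt.inl (idem i)).snd = 0 := by
  rw [TrivSqZeroExt.snd_mul, TrivSqZeroExt.snd_inl, smul_zero, zero_add, TrivSqZeroExt.fst_inl]
  apply Subtype.ext
  rw [coe_bei_op_smul]
  ext p q
  change ((embed k A 𝒜 c a).snd.1 * Matrix.single i i 1 : Matrix (Fin c) (Fin c) A) p q = 0
  by_cases hq : q = i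
  · subst hq
    rw [Matrix.mul_single_apply_same, mul_one, embed_snd_apply]
    exact DirectSum.decompose_of_mem_ne 𝒜 ha (by omega)
  · rw [Matrix.mul_single_apply_of_ne _ _ _ _ _ hq]

theorem fst_embed_mul_idem {a : A} {d : ℕ} (ha : a ∈ 𝒜 d) {i : Fin c} (h : (i : ℕ) < d) :
    (embed k A 𝒜 c a * TrivSqZeroExt.inl (idem i)).fst = 0 := by
  rw [TrivSqZeroExt.fst_mul, TrivSqZeroExt.fst_inl]
  apply Subtype.ext
  ext p q
  change ((embed k A 𝒜 c a).fst.1 * Matrix.single i i 1 : Matrix (Fin c) (Fin c) A) p q = 0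
  by_cases hq : q = i
  · subst hq
    rw [Matrix.mul_single_apply_same, mul_one, embed_fst_apply]
    split_ifs
    · exact DirectSum.decompose_of_mem_ne 𝒜 ha (by omega)
    · rfl
  · rw [Matrix.mul_single_apply_of_ne _ _ _ _ _ hq]

end BeiExt

namespace GrMod

/-- An isomorphism of graded modules from a linear equivalence matching the gradings. -/
def isoMk {k : Type} [Field k] {A : Type} [Ring A] [Algebra k A] {𝒜 : ℕ → Submodule k A}
    {M N : GrMod k A 𝒜} (e : M.carrier ≃ₗ[A] N.carrier)
    (h : ∀ n, ∀ v ∈ M.grading n, e v ∈ N.grading n)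
    (h' : ∀ n, ∀ v ∈ N.grading n, e.symm v ∈ M.grading n) : M ≅ N where
  hom := ⟨e.toLinearMap, h⟩
  inv := ⟨e.symm.toLinearMap, h'⟩
  hom_inv_id := hom_ext e.symm_apply_apply
  inv_hom_id := hom_ext e.apply_symm_apply

section ToBeiExt

variable {k : Type} [Field k] {A : Type} [Ring A] [Algebra k A]
variable {𝒜 : ℕ → Submodule k A} {c : ℕ} (M : GrMod k A 𝒜)

open Classical in
/-- The projection of a graded module onto its components of degree congruent to `-j`. -/
noncomputable def residueProj (j : Fin c) : M.carrier →ₗ[k] M.carrier :=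
  M.lift fun m => if ∃ n : ℤ, m = c * n - (j : ℕ) then (M.grading m).subtype else 0

theorem residueProj_apply {n : ℤ} {i : Fin c} {v : M.carrier}
    (hv : v ∈ M.grading (c * n - (i : ℕ))) (j : Fin c) :
    M.residueProj j v = if i = j then v else 0 := by
  rw [residueProj, M.lift_apply _ hv]
  by_cases hij : i = j
  · subst hij
    rw [if_pos rfl, if_pos ⟨n, rfl⟩]
    rfl
  · rw [if_neg hij, if_neg]
    · rfl
    · rintro ⟨n', h⟩
      exact hij (eq_and_eq_of_mul_sub_fin h).2

theorem residue_induction (hc : 1 ≤ c) {P : M.carrier → Prop}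
    (add : ∀ v w, P v → P w → P (v + w))
    (hom : ∀ (n : ℤ) (i : Fin c), ∀ v ∈ M.grading (c * n - (i : ℕ)), P v)
    (v : M.carrier) : P v :=
  M.homogeneous_induction (hom 0 ⟨0, hc⟩ 0 (zero_mem _)) add (fun m v hv => by
    obtain ⟨n, i, rfl⟩ := exists_eq_mul_sub_fin hc m
    exact hom n i v hv) v

theorem sum_residueProj (hc : 1 ≤ c) (v : M.carrier) : ∑ j : Fin c, M.residueProj j v = v := by
  induction v using M.residue_induction hc with
  | add v w hv hw => simp only [map_add, Finset.sum_add_distrib, hv, hw]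
  | hom n i v hv => simp [M.residueProj_apply hv]

variable (c) in
/-- The grading of a graded module by blocks of `c` consecutive degrees. -/
def blockGrading (n : ℤ) : Submodule k M.carrier := ⨆ i : Fin c, M.grading (c * n - (i : ℕ))

theorem mem_blockGrading {n : ℤ} {i : Fin c} {v : M.carrier}
    (hv : v ∈ M.grading (c * n - (i : ℕ))) : v ∈ M.blockGrading c n :=
  Submodule.mem_iSup_of_mem i hv

theorem blockGrading_induction {n : ℤ} {P : ∀ v, v ∈ M.blockGrading c n → Prop}
    (zero : P 0 (zero_mem _))
    (add : ∀ v w hv hw, P v hv → P w hw → P (v + w) (add_mem hv hw))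
    (hom : ∀ (i : Fin c) (v) (hv : v ∈ M.grading (c * n - (i : ℕ))), P v (M.mem_blockGrading hv))
    {v : M.carrier} (hv : v ∈ M.blockGrading c n) : P v hv :=
  Submodule.iSup_induction' (motive := P) _ hom zero add hv

open Classical in
theorem blockGrading_internal (hc : 1 ≤ c) : DirectSum.IsInternal (M.blockGrading c) := by
  let q : ℤ → M.carrier →ₗ[k] M.carrier := fun n => M.lift fun m =>
    if ∃ i : Fin c, m = c * n - (i : ℕ) then (M.grading m).subtype else 0
  refine isInternal_of_projections _ q ?_ ?_ ?_
  · intro n v hv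
    induction hv using M.blockGrading_induction with
    | zero => exact map_zero _
    | add v w _ _ hv hw => rw [map_add, hv, hw]
    | hom i v hv =>
      dsimp only [q]
      rw [M.lift_apply _ hv, if_pos ⟨i, rfl⟩]
      rfl
  · intro n m hnm v hv
    induction hv using M.blockGrading_induction with
    | zero => exact map_zero _
    | add v w _ _ hv hw => rw [map_add, hv, hw, add_zero]
    | hom i v hv =>
      dsimp only [q]
      rw [M.lift_apply _ hv, if_neg]
      · rfl
      · rintro ⟨j, h⟩
        exact hnm (eq_and_eq_of_mul_sub_fin h).1
  · rw [eq_top_iff]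
    rintro v -
    induction v using M.residue_induction hc with
    | add v w hv hw => exact add_mem hv hw
    | hom n i v hv => exact Submodule.mem_iSup_of_mem n (M.mem_blockGrading hv)

theorem residueProj_mem {n : ℤ} {v : M.carrier} (hv : v ∈ M.blockGrading c n) (j : Fin c) :
    M.residueProj j v ∈ M.grading (c * n - (j : ℕ)) := by
  induction hv using M.blockGrading_induction with
  | zero => rw [map_zero]; exact zero_mem _
  | add v w _ _ hv hw => rw [map_add]; exact add_mem hv hw
  | hom i v hv =>
    rw [M.residueProj_apply hv]
    split_ifs with h
    · subst h; exact hv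
    · exact zero_mem _

variable [GradedAlgebra 𝒜]

theorem fst_smul_mem (r : BeiExt k A 𝒜 c) (i j : Fin c) {n : ℤ} {v : M.carrier}
    (hv : v ∈ M.grading (c * n - (j : ℕ))) :
    r.fst.1 i j • v ∈ M.grading (c * n - (i : ℕ)) := by
  rcases le_or_gt (i : ℕ) j with h | h
  · have := M.smul_mem _ _ _ v ((r.fst.2 i j).1 h) hv
    rwa [show ((((j : ℕ) - (i : ℕ) : ℕ) : ℤ) + (c * n - (j : ℕ))) = c * n - (i : ℕ) by
      rw [Nat.cast_sub h]; ring] at this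
  · rw [(r.fst.2 i j).2 h, zero_smul]
    exact zero_mem _

theorem snd_smul_mem (r : BeiExt k A 𝒜 c) (i j : Fin c) {n : ℤ} {v : M.carrier}
    (hv : v ∈ M.grading (c * n - (j : ℕ))) :
    r.snd.1 i j • v ∈ M.grading (c * (n + 1) - (i : ℕ)) := by
  have := M.smul_mem _ _ _ v (r.snd.2 i j) hv
  rwa [show (((c + (j : ℕ) - (i : ℕ) : ℕ) : ℤ) + (c * n - (j : ℕ))) = c * (n + 1) - (i : ℕ) by
    rw [Nat.cast_sub (by omega)]; push_cast; ring] at this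

theorem residueProj_toMat_smul (hc : 1 ≤ c) (r : BeiExt k A 𝒜 c) (i j l : Fin c)
    (v : M.carrier) : M.residueProj l (r.toMat i j • M.residueProj j v) =
      if i = l then r.toMat i j • M.residueProj j v else 0 := by
  induction v using M.residue_induction hc with
  | add v w hv hw =>
    rw [map_add, smul_add, map_add, hv, hw]
    split_ifs <;> simp
  | hom n p v hv =>
    rw [M.residueProj_apply hv]
    by_cases hpj : p = j
    · subst hpj
      rw [if_pos rfl, BeiExt.toMat_apply, add_smul, map_add,
        M.residueProj_apply (M.fst_smul_mem r i p hv),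
        M.residueProj_apply (M.snd_smul_mem r i p hv)]
      split_ifs <;> simp
    · simp [hpj]

/-- The action of the trivial extension on a graded module. -/
noncomputable def beiAct (r : BeiExt k A 𝒜 c) (v : M.carrier) : M.carrier :=
  ∑ i, ∑ j, r.toMat i j • M.residueProj j v

theorem beiAct_apply (r : BeiExt k A 𝒜 c) {n : ℤ} {p : Fin c} {v : M.carrier}
    (hv : v ∈ M.grading (c * n - (p : ℕ))) : M.beiAct r v = ∑ i, r.toMat i p • v := by
  refine Finset.sum_congr rfl fun i _ => ?_
  simp [M.residueProj_apply hv]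

theorem beiAct_add (r : BeiExt k A 𝒜 c) (v w : M.carrier) :
    M.beiAct r (v + w) = M.beiAct r v + M.beiAct r w := by
  simp [beiAct, Finset.sum_add_distrib]

/-- A graded module, as a module over the trivial extension. -/
@[reducible]
noncomputable def beiModule (hc : 1 ≤ c) (htop : ∀ n : ℕ, c < n → 𝒜 n = ⊥) :
    Module (BeiExt k A 𝒜 c) M.carrier where
  smul := M.beiAct
  one_smul v := by
    change M.beiAct 1 v = v
    rw [beiAct, BeiExt.toMat_one]
    simp only [Matrix.one_apply, ite_smul, one_smul, zero_smul, Finset.sum_ite_eq, Finset.mem_univ,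
      if_true]
    exact M.sum_residueProj hc v
  mul_smul r s v := by
    change M.beiAct (r * s) v = M.beiAct r (M.beiAct s v)
    rw [beiAct, beiAct, BeiExt.toMat_mul htop]
    refine Finset.sum_congr rfl fun i _ => ?_
    have h : ∀ l, M.residueProj l (M.beiAct s v) = ∑ j, s.toMat l j • M.residueProj j v :=
      fun l => by
        rw [beiAct, map_sum]
        simp only [map_sum, M.residueProj_toMat_smul hc]
        rw [Finset.sum_eq_single l]
        · simp
        · intro i _ hi; simp [hi]
        · simp
    simp only [h, Matrix.mul_apply, Finset.sum_smul, Finset.smul_sum, mul_smul]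
    exact Finset.sum_comm
  smul_zero r := by
    change M.beiAct r 0 = 0
    simp [beiAct]
  smul_add := M.beiAct_add
  add_smul r s v := by
    change M.beiAct (r + s) v = M.beiAct r v + M.beiAct s v
    simp [beiAct, Finset.sum_add_distrib, BeiExt.toMat_add, add_smul]
  zero_smul v := by
    change M.beiAct 0 v = 0
    simp [beiAct, BeiExt.toMat_zero]

/-- A graded module, as a graded module over the trivial extension. -/
noncomputable def toBeiExtObj (hc : 1 ≤ c) (htop : ∀ n : ℕ, c < n → 𝒜 n = ⊥) :
    GrMod k (BeiExt k A 𝒜 c) (tszGrading k ↥(bei k A 𝒜 c) ↥(beiTop k A 𝒜 c)) where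
  carrier := M.carrier
  modA := M.beiModule hc htop
  tower :=
    letI := M.beiModule hc htop
    ⟨fun t r v => by
      change M.beiAct (t • r) v = t • M.beiAct r v
      simp [beiAct, BeiExt.toMat_smul, Finset.smul_sum]⟩
  grading := M.blockGrading c
  internal := M.blockGrading_internal hc
  smul_mem := by
    rintro d n r v hr hv
    change M.beiAct r v ∈ _
    induction hv using M.blockGrading_induction with
    | zero => simp [beiAct]
    | add v w _ _ hv hw => rw [beiAct_add]; exact add_mem hv hw
    | hom j v hv =>
      rw [M.beiAct_apply r hv]
      refine Submodule.sum_mem _ fun i _ => ?_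
      rw [BeiExt.toMat_apply]
      match d, hr with
      | 0, hr =>
        have hr' : r.snd = 0 := hr
        have h0 : r.snd.1 i j = 0 := by rw [hr']; rfl
        rw [h0, add_zero, Nat.cast_zero, zero_add]
        exact M.mem_blockGrading (M.fst_smul_mem r i j hv)
      | 1, hr =>
        have hr' : r.fst = 0 := hr
        have h0 : r.fst.1 i j = 0 := by rw [hr']; rfl
        rw [h0, zero_add, Nat.cast_one, add_comm 1 n]
        exact M.mem_blockGrading (M.snd_smul_mem r i j hv)
      | d + 2, hr =>
        have hr' : r = 0 := hr
        have h0 : r.fst.1 i j + r.snd.1 i j = 0 := by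
          rw [← BeiExt.toMat_apply, hr', BeiExt.toMat_zero]; rfl
        rw [h0, zero_smul]
        exact zero_mem _

theorem beiAct_embed (hc : 1 ≤ c) (htop : ∀ n : ℕ, c < n → 𝒜 n = ⊥) (a : A) (v : M.carrier) :
    M.beiAct (BeiExt.embed k A 𝒜 c a) v = a • v := by
  induction v using M.residue_induction hc with
  | add v w hv hw =>
    rw [smul_add, ← hv, ← hw, beiAct_add]
  | hom n p v hv =>
    induction a using BeiExt.induction_homogeneous 𝒜 with
    | add a b ha hb =>
      rw [add_smul, ← ha, ← hb, BeiExt.embed_add]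
      simp [beiAct, Finset.sum_add_distrib, BeiExt.toMat_add, add_smul]
    | hom d a ha =>
      rw [M.beiAct_apply _ hv]
      simp only [BeiExt.toMat_embed ha]
      have hp := p.2
      by_cases hd : c < d
      · rw [htop d hd] at ha
        simp [(Submodule.mem_bot k).1 ha]
      by_cases h : d ≤ p
      · rw [Finset.sum_eq_single ⟨p - d, by omega⟩]
        · dsimp only
          rw [if_pos (by omega)]
        · intro l _ hl
          rw [Ne, Fin.ext_iff] at hl
          dsimp only at hl
          rw [if_neg (by omega), zero_smul]
        · simp
      · rw [Finset.sum_eq_single ⟨c + p - d, by omega⟩]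
        · dsimp only
          rw [if_pos (by omega)]
        · intro l _ hl
          rw [Ne, Fin.ext_iff] at hl
          dsimp only at hl
          rw [if_neg (by omega), zero_smul]
        · simp

theorem beiAct_idem (j : Fin c) (v : M.carrier) :
    M.beiAct (TrivSqZeroExt.inl (BeiExt.idem j) : BeiExt k A 𝒜 c) v = M.residueProj j v := by
  rw [beiAct, BeiExt.toMat_inl_idem, Finset.sum_eq_single j, Finset.sum_eq_single j]
  · simp
  · intro l _ hl; simp [hl.symm]
  · simp
  · intro l _ hl; simp [hl.symm]
  · simp

variable (k A 𝒜) in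
/-- The functor from graded `A`-modules to graded modules over the trivial extension. -/
noncomputable def toBeiExt (hc : 1 ≤ c) (htop : ∀ n : ℕ, c < n → 𝒜 n = ⊥) :
    GrMod k A 𝒜 ⥤ GrMod k (BeiExt k A 𝒜 c)
      (tszGrading k ↥(bei k A 𝒜 c) ↥(beiTop k A 𝒜 c)) where
  obj M := M.toBeiExtObj hc htop
  map {M N} f := ⟨
    { toFun := f.1
      map_add' := map_add f.1
      map_smul' := fun r v => by
        change f.1 (M.beiAct r v) = N.beiAct r (f.1 v)
        induction v using M.residue_induction hc with
        | add v w hv hw =>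
          rw [M.beiAct_add, map_add, map_add, hv, hw, N.beiAct_add]
        | hom n i v hv =>
          rw [M.beiAct_apply r hv, N.beiAct_apply r (f.2 _ v hv), map_sum]
          exact Finset.sum_congr rfl fun i _ => map_smul f.1 _ _ },
    fun n v hv => by
      change f.1 v ∈ N.blockGrading c n
      induction hv using M.blockGrading_induction with
      | zero => rw [map_zero]; exact zero_mem _
      | add v w _ _ hv hw => rw [map_add]; exact add_mem hv hw
      | hom i v hv => exact N.mem_blockGrading (f.2 _ v hv)⟩

theorem toBeiExt_faithful (hc : 1 ≤ c) (htop : ∀ n : ℕ, c < n → 𝒜 n = ⊥) :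
    (toBeiExt k A 𝒜 hc htop).Faithful where
  map_injective {M N} f g h := hom_ext fun v =>
    congrArg (fun p : M.toBeiExtObj hc htop ⟶ N.toBeiExtObj hc htop => p.1 v) h

theorem toBeiExt_full (hc : 1 ≤ c) (htop : ∀ n : ℕ, c < n → 𝒜 n = ⊥) :
    (toBeiExt k A 𝒜 hc htop).Full where
  map_surjective {M N} f := by
    let φ : M.carrier → N.carrier := f.1
    have hadd : ∀ v w, φ (v + w) = φ v + φ w := map_add f.1
    have hact : ∀ r v, φ (M.beiAct r v) = N.beiAct r (φ v) := map_smul f.1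
    have hblock : ∀ n, ∀ v ∈ M.blockGrading c n, φ v ∈ N.blockGrading c n := f.2
    refine ⟨⟨{ toFun := φ, map_add' := hadd, map_smul' := fun a v => ?_ }, fun m v hv => ?_⟩, rfl⟩
    · rw [← M.beiAct_embed hc htop, hact, N.beiAct_embed hc htop, RingHom.id_apply]
    · obtain ⟨n, i, rfl⟩ := exists_eq_mul_sub_fin hc m
      change φ v ∈ _
      have h : M.residueProj i v = v := by rw [M.residueProj_apply hv, if_pos rfl]
      rw [← h, ← M.beiAct_idem, hact, N.beiAct_idem]
      exact N.residueProj_mem (hblock n v (M.mem_blockGrading hv)) i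

end ToBeiExt
end GrMod

namespace GrMod

section OfBeiExt

variable {k : Type} [Field k] {A : Type} [Ring A] [Algebra k A]
variable {𝒜 : ℕ → Submodule k A} [GradedAlgebra 𝒜] {c : ℕ}
  (N : GrMod k (BeiExt k A 𝒜 c) (tszGrading k ↥(bei k A 𝒜 c) ↥(beiTop k A 𝒜 c)))

/-- The action of the diagonal idempotents. -/
noncomputable def idemProj (i : Fin c) : N.carrier →ₗ[k] N.carrier :=
  Algebra.lsmul k k N.carrier (TrivSqZeroExt.inl (BeiExt.idem i) : BeiExt k A 𝒜 c)

theorem idemProj_apply (i : Fin c) (v : N.carrier) :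
    N.idemProj i v = (TrivSqZeroExt.inl (BeiExt.idem i) : BeiExt k A 𝒜 c) • v := rfl

theorem idemProj_idemProj (i j : Fin c) (v : N.carrier) :
    N.idemProj i (N.idemProj j v) = if j = i then N.idemProj j v else 0 := by
  rw [idemProj_apply, idemProj_apply, ← mul_smul, ← TrivSqZeroExt.inl_mul]
  split_ifs with h
  · subst h
    rw [BeiExt.idem_mul_self]
  · rw [BeiExt.idem_mul_of_ne (Ne.symm h), TrivSqZeroExt.inl_zero, zero_smul]

theorem idemProj_of_idemProj_eq {i : Fin c} {v : N.carrier} (hv : N.idemProj i v = v)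
    (j : Fin c) : N.idemProj j v = if i = j then v else 0 := by
  conv_lhs => rw [← hv]
  rw [idemProj_idemProj, hv]

theorem sum_embed_smul_idemProj (htop : ∀ n : ℕ, c < n → 𝒜 n = ⊥) (r : BeiExt k A 𝒜 c)
    (v : N.carrier) :
    ∑ i, ∑ j, BeiExt.embed k A 𝒜 c (r.toMat i j) • N.idemProj j v = r • v := by
  conv_rhs => rw [← BeiExt.sum_embed_mul_idem htop r]
  simp only [Finset.sum_smul, mul_smul, idemProj_apply]

theorem sum_idemProj (v : N.carrier) : ∑ i, N.idemProj i v = v := by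
  simp only [idemProj_apply]
  rw [← Finset.sum_smul]
  have h : ∑ i, (TrivSqZeroExt.inl (BeiExt.idem i) : BeiExt k A 𝒜 c) = 1 := by
    have := map_sum (TrivSqZeroExt.inlHom ↥(bei k A 𝒜 c) ↥(beiTop k A 𝒜 c))
      BeiExt.idem Finset.univ
    rw [BeiExt.sum_idem, map_one] at this
    exact this.symm
  rw [h, one_smul]

theorem idemProj_mem (i : Fin c) {n : ℤ} {v : N.carrier} (hv : v ∈ N.grading n) :
    N.idemProj i v ∈ N.grading n := N.inl_smul_mem _ hv

/-- The grading of a module over the trivial extension refined by the diagonal idempotents. -/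
def fineGrading (m : ℤ) : Submodule k N.carrier where
  carrier := {v | ∀ (n : ℤ) (i : Fin c), m = c * n - (i : ℕ) →
    v ∈ N.grading n ∧ N.idemProj i v = v}
  zero_mem' := fun n i h => ⟨zero_mem _, map_zero _⟩
  add_mem' := fun hv hw n i h =>
    ⟨add_mem (hv n i h).1 (hw n i h).1, by rw [map_add, (hv n i h).2, (hw n i h).2]⟩
  smul_mem' := fun t v hv n i h =>
    ⟨Submodule.smul_mem _ t (hv n i h).1, by rw [map_smul, (hv n i h).2]⟩

theorem mem_fineGrading {n : ℤ} {i : Fin c} {v : N.carrier} :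
    v ∈ N.fineGrading (c * n - (i : ℕ)) ↔ v ∈ N.grading n ∧ N.idemProj i v = v := by
  refine ⟨fun h => h n i rfl, fun h n' i' heq => ?_⟩
  obtain ⟨rfl, rfl⟩ := eq_and_eq_of_mul_sub_fin heq
  exact h

theorem fineGrading_internal (hc : 1 ≤ c) : DirectSum.IsInternal N.fineGrading := by
  classical
  choose blk idx hbi using exists_eq_mul_sub_fin hc
  let pr : ℤ → N.carrier →ₗ[k] N.carrier := fun n => N.lift fun m =>
    if m = n then (N.grading m).subtype else 0
  have hpr : ∀ m n, ∀ v ∈ N.grading m, pr n v = if m = n then v else 0 := fun m n v hv => by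
    dsimp only [pr]
    rw [N.lift_apply _ hv]
    split_ifs <;> rfl
  refine isInternal_of_projections _ (fun m => (N.idemProj (idx m)).comp (pr (blk m))) ?_ ?_ ?_
  · intro m v hv
    obtain ⟨h1, h2⟩ := hv _ _ (hbi m)
    rw [LinearMap.comp_apply, hpr _ _ v h1, if_pos rfl, h2]
  · intro m m' hmm v hv
    obtain ⟨h1, h2⟩ := hv _ _ (hbi m)
    rw [LinearMap.comp_apply, hpr _ _ v h1]
    split_ifs with h
    · rw [← h2, idemProj_idemProj, if_neg]
      intro h'
      exact hmm (by rw [hbi m, hbi m', h, h'])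
    · exact map_zero _
  · rw [eq_top_iff]
    rintro v -
    induction v using N.homogeneous_induction with
    | zero => exact zero_mem _
    | add v w hv hw => exact add_mem hv hw
    | hom n v hv =>
      rw [← N.sum_idemProj v]
      refine Submodule.sum_mem _ fun i _ => Submodule.mem_iSup_of_mem (c * n - (i : ℕ)) ?_
      exact N.mem_fineGrading.2 ⟨N.idemProj_mem i hv, by rw [idemProj_idemProj, if_pos rfl]⟩

theorem embed_smul_mem (htop : ∀ n : ℕ, c < n → 𝒜 n = ⊥) {a : A} {d : ℕ} (ha : a ∈ 𝒜 d)
    {n : ℤ} {i : Fin c} {v : N.carrier} (hv : v ∈ N.fineGrading (c * n - (i : ℕ))) :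
    BeiExt.embed k A 𝒜 c a • v ∈ N.fineGrading (d + (c * n - (i : ℕ))) := by
  obtain ⟨hv1, hv2⟩ := N.mem_fineGrading.1 hv
  by_cases hd : c < d
  · rw [htop d hd] at ha
    have h0 := BeiExt.embed_smul (𝒜 := 𝒜) (c := c) (0 : k) 0
    rw [zero_smul, zero_smul] at h0
    rw [(Submodule.mem_bot k).1 ha, h0, zero_smul]
    exact zero_mem _
  have hi := i.2
  have hav : BeiExt.embed k A 𝒜 c a • v =
      (BeiExt.embed k A 𝒜 c a * TrivSqZeroExt.inl (BeiExt.idem i)) • v := by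
    rw [mul_smul, ← idemProj_apply, hv2]
  rw [hav]
  rcases le_or_gt d i with h | h
  · have harith : (d : ℤ) + (c * n - (i : ℕ)) =
        c * n - (((⟨i - d, by omega⟩ : Fin c) : ℕ) : ℤ) := by
      dsimp only
      rw [Nat.cast_sub h]
      ring
    rw [harith, mem_fineGrading]
    refine ⟨?_, ?_⟩
    · have := N.smul_mem 0 n _ v (BeiExt.snd_embed_mul_idem ha h) hv1
      rwa [Nat.cast_zero, zero_add] at this
    · rw [idemProj_apply, ← mul_smul, BeiExt.idem_mul_embed_mul_idem htop ha]
      left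
      dsimp only
      omega
  · have harith : (d : ℤ) + (c * n - (i : ℕ)) =
        c * (n + 1) - (((⟨c + i - d, by omega⟩ : Fin c) : ℕ) : ℤ) := by
      dsimp only
      rw [Nat.cast_sub (by omega)]
      push_cast
      ring
    rw [harith, mem_fineGrading]
    refine ⟨?_, ?_⟩
    · have := N.smul_mem 1 n _ v (BeiExt.fst_embed_mul_idem ha h) hv1
      rwa [Nat.cast_one, add_comm] at this
    · rw [idemProj_apply, ← mul_smul, BeiExt.idem_mul_embed_mul_idem htop ha]
      right
      dsimp only
      omega

/-- A graded module over the trivial extension, as a graded `A`-module. -/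
noncomputable def ofBeiExt (hc : 1 ≤ c) (htop : ∀ n : ℕ, c < n → 𝒜 n = ⊥) : GrMod k A 𝒜 where
  carrier := N.carrier
  modA := Module.compHom N.carrier (BeiExt.embedHom htop)
  tower :=
    letI := Module.compHom N.carrier (BeiExt.embedHom htop)
    ⟨fun t a v => by
      change BeiExt.embed k A 𝒜 c (t • a) • v = t • BeiExt.embed k A 𝒜 c a • v
      rw [BeiExt.embed_smul, smul_assoc]⟩
  grading := N.fineGrading
  internal := N.fineGrading_internal hc
  smul_mem d m a v ha hv := by
    obtain ⟨n, i, rfl⟩ := exists_eq_mul_sub_fin hc m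
    exact N.embed_smul_mem htop ha hv

theorem residueProj_ofBeiExt (hc : 1 ≤ c) (htop : ∀ n : ℕ, c < n → 𝒜 n = ⊥) (j : Fin c)
    (v : N.carrier) : (N.ofBeiExt hc htop).residueProj j v = N.idemProj j v := by
  induction v using (N.ofBeiExt hc htop).residue_induction hc with
  | add v w hv hw => exact ((map_add _ v w).trans (congrArg₂ _ hv hw)).trans (map_add _ v w).symm
  | hom n i v hv =>
    obtain ⟨hv1, hv2⟩ := N.mem_fineGrading.1 hv
    rw [residueProj_apply _ hv]
    exact (N.idemProj_of_idemProj_eq hv2 j).symm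

/-- The two constructions are inverse to each other. -/
noncomputable def toBeiExtOfBeiExt (hc : 1 ≤ c) (htop : ∀ n : ℕ, c < n → 𝒜 n = ⊥) :
    (N.ofBeiExt hc htop).toBeiExtObj hc htop ≅ N :=
  isoMk
    { toFun := fun v => v
      invFun := fun v => v
      left_inv := fun _ => rfl
      right_inv := fun _ => rfl
      map_add' := fun _ _ => rfl
      map_smul' := fun r v => by
        have h : (N.ofBeiExt hc htop).beiAct r v = ∑ i, ∑ j, BeiExt.embed k A 𝒜 c (r.toMat i j) •
            (N.idemProj j v : N.carrier) :=
          Finset.sum_congr rfl fun i _ => Finset.sum_congr rfl fun j _ =>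
            congrArg (fun x : N.carrier => BeiExt.embed k A 𝒜 c (r.toMat i j) • x)
              (N.residueProj_ofBeiExt hc htop j v)
        exact h.trans (N.sum_embed_smul_idemProj htop r v) }
    (fun n v hv => by
      change v ∈ N.grading n
      induction hv using (N.ofBeiExt hc htop).blockGrading_induction with
      | zero => exact zero_mem _
      | add v w _ _ hv hw => exact add_mem hv hw
      | hom i v hv => exact (N.mem_fineGrading.1 hv).1)
    (fun n v hv => by
      change v ∈ (N.ofBeiExt hc htop).blockGrading c n
      rw [← N.sum_idemProj v]
      exact Submodule.sum_mem _ fun i _ => mem_blockGrading (i := i) _ <|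
        N.mem_fineGrading.2 ⟨N.idemProj_mem i hv, by rw [idemProj_idemProj, if_pos rfl]⟩)

end OfBeiExt

/-- Graded `A`-modules are graded modules over a trivial extension of the Beilinson algebra. -/
noncomputable def equivBeiExt (k : Type) [Field k] (A : Type) [Ring A] [Algebra k A]
    (𝒜 : ℕ → Submodule k A) [GradedAlgebra 𝒜] {c : ℕ} (hc : 1 ≤ c)
    (htop : ∀ n : ℕ, c < n → 𝒜 n = ⊥) : GrMod k A 𝒜 ≌
      GrMod k (BeiExt k A 𝒜 c) (tszGrading k ↥(bei k A 𝒜 c) ↥(beiTop k A 𝒜 c)) :=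
  haveI : (toBeiExt k A 𝒜 hc htop).IsEquivalence :=
    { faithful := toBeiExt_faithful hc htop
      full := toBeiExt_full hc htop
      essSurj := ⟨fun N => ⟨N.ofBeiExt hc htop, ⟨N.toBeiExtOfBeiExt hc htop⟩⟩⟩ }
  (toBeiExt k A 𝒜 hc htop).asEquivalence

end GrMod

section GradedAlgebra

variable {k : Type} [Field k] {A : Type} [Ring A] [Algebra k A]

theorem dual_smul_apply (a : A) (φ : Module.Dual k A) (y : A) : (a • φ) y = φ (y * a) := rfl

theorem dual_op_smul_apply (a : A) (φ : Module.Dual k A) (y : A) : (op a • φ) y = φ (a * y) := rfl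

theorem exists_pow_succ_mul_eq_pow [FiniteDimensional k A] (r : A) :
    ∃ (n : ℕ) (y : A), y ∈ Algebra.adjoin k {r} ∧ r ^ (n + 1) * y = r ^ n := by
  have : IsMulCommutative (Algebra.adjoin k {r}) := Algebra.isMulCommutative_adjoin k (by simp)
  have : IsArtinianRing (Algebra.adjoin k {r}) := IsArtinianRing.of_finite k _
  let s : Algebra.adjoin k {r} := ⟨r, Algebra.subset_adjoin rfl⟩
  obtain ⟨n, y, h⟩ := IsArtinian.exists_pow_succ_smul_dvd s (1 : Algebra.adjoin k {r})
  refine ⟨n, y.1, y.2, ?_⟩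
  have := congrArg Subtype.val h
  simpa [s, Nat.succ_eq_add_one] using this

variable (𝒜 : ℕ → Submodule k A) [GradedAlgebra 𝒜]

local notation "π" => GradedAlgebra.proj 𝒜

theorem gproj_mem (n : ℕ) (a : A) : π n a ∈ 𝒜 n := SetLike.coe_mem _

variable {𝒜}

theorem gproj_of_mem {n : ℕ} {a : A} (ha : a ∈ 𝒜 n) : π n a = a :=
  DirectSum.decompose_of_mem_same 𝒜 ha

theorem gproj_of_mem_ne {n m : ℕ} {a : A} (ha : a ∈ 𝒜 n) (h : n ≠ m) : π m a = 0 :=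
  DirectSum.decompose_of_mem_ne 𝒜 ha h

theorem gproj_mul_left {n : ℕ} {a : A} (ha : a ∈ 𝒜 n) (m : ℕ) (b : A) :
    π (n + m) (a * b) = a * π m b :=
  DirectSum.coe_decompose_mul_add_of_left_mem 𝒜 ha

theorem gproj_mul_right {n : ℕ} {b : A} (hb : b ∈ 𝒜 n) (m : ℕ) (a : A) :
    π (m + n) (a * b) = π m a * b :=
  DirectSum.coe_decompose_mul_add_of_right_mem 𝒜 hb

theorem sum_gproj {c : ℕ} (htop : ∀ n : ℕ, c < n → 𝒜 n = ⊥) (a : A) :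
    ∑ m ∈ Finset.range (c + 1), π m a = a := by
  induction a using BeiExt.induction_homogeneous 𝒜 with
  | add a b ha hb => simp only [map_add, Finset.sum_add_distrib, ha, hb]
  | hom d a ha =>
    by_cases hd : c < d
    · rw [htop d hd] at ha
      simp [(Submodule.mem_bot k).1 ha]
    · rw [Finset.sum_eq_single d]
      · exact gproj_of_mem ha
      · exact fun m _ hm => gproj_of_mem_ne ha hm.symm
      · intro h
        rw [Finset.mem_range] at h
        omega

theorem exists_gproj_ne_zero {c : ℕ} (htop : ∀ n : ℕ, c < n → 𝒜 n = ⊥) {a : A} (ha : a ≠ 0) :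
    ∃ m ≤ c, π m a ≠ 0 := by
  by_contra! h
  refine ha ?_
  rw [← sum_gproj htop a]
  exact Finset.sum_eq_zero fun m hm => h m (by rw [Finset.mem_range] at hm; omega)

theorem mul_eq_zero_of_lt {c : ℕ} (htop : ∀ n : ℕ, c < n → 𝒜 n = ⊥) {m n : ℕ} {a b : A}
    (ha : a ∈ 𝒜 m) (hb : b ∈ 𝒜 n) (h : c < m + n) : a * b = 0 := by
  have := SetLike.mul_mem_graded ha hb
  rw [htop _ h] at this
  exact this

variable (𝒜) in
/-- The top component of a graded algebra, as a left ideal. -/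
def topIdeal {c : ℕ} (htop : ∀ n : ℕ, c < n → 𝒜 n = ⊥) : Submodule A A where
  carrier := 𝒜 c
  zero_mem' := zero_mem _
  add_mem' := add_mem
  smul_mem' a x hx := by
    induction a using BeiExt.induction_homogeneous 𝒜 with
    | add a b ha hb =>
      rw [add_smul]
      exact add_mem (S := Submodule k A) ha hb
    | hom d a ha =>
      rcases Nat.eq_zero_or_pos d with rfl | hd
      · have := SetLike.mul_mem_graded ha hx
        rwa [zero_add] at this
      · rw [smul_eq_mul, mul_eq_zero_of_lt htop ha hx (by omega)]
        exact zero_mem (𝒜 c)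

/-- Over a right well-graded self-injective algebra, homogeneous elements are detected by left
multiplication into the top degree. -/
theorem exists_mul_ne_zero [FiniteDimensional k A] {c : ℕ} (htop : ∀ n : ℕ, c < n → 𝒜 n = ⊥)
    (hwg : RightWellGraded 𝒜 c) (hinj : Module.Injective A A) {m : ℕ} (hm : m ≤ c) {a : A}
    (ha : a ∈ 𝒜 m) (hne : a ≠ 0) : ∃ x ∈ 𝒜 (c - m), x * a ≠ 0 := by
  by_contra! h
  let J : Submodule A A := Submodule.span A {a}
  let K : Submodule A A := topIdeal 𝒜 htop
  have hJK : Disjoint J K := by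
    rw [Submodule.disjoint_def]
    intro x hx hxK
    obtain ⟨y, rfl⟩ := Submodule.mem_span_singleton.1 hx
    have h1 : π c (y * a) = y * a := gproj_of_mem hxK
    have h2 := gproj_mul_right ha (c - m) y
    rw [Nat.sub_add_cancel hm, h1, h _ (gproj_mem 𝒜 _ y)] at h2
    exact h2
  let f : J × K →ₗ[A] A := J.subtype.coprod K.subtype
  have hf : Function.Injective f := by
    rw [injective_iff_map_eq_zero]
    rintro ⟨x, y⟩ hxy
    have hxy' : x.1 + y.1 = 0 := hxy
    have hx : x.1 = 0 := Submodule.disjoint_def.1 hJK x.1 x.2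
      (by rw [eq_neg_of_add_eq_zero_left hxy']; exact neg_mem y.2)
    rw [hx, zero_add] at hxy'
    exact Prod.ext (Subtype.ext hx) (Subtype.ext hxy')
  obtain ⟨g, hg⟩ := hinj.out f hf (J.subtype.comp (LinearMap.fst A J K))
  have hg1 : ∀ y, g y = y * g 1 := fun y => by
    rw [← smul_eq_mul, ← map_smul, smul_eq_mul, mul_one]
  let r := π 0 (g 1)
  have har : a * r = a := by
    have h1 := hg (⟨a, Submodule.mem_span_singleton_self a⟩, 0)
    have h2 : a * g 1 = a := by
      rw [← hg1]
      simpa [f] using h1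
    have h3 := gproj_mul_left ha 0 (g 1)
    rw [h2, add_zero, gproj_of_mem ha] at h3
    exact h3.symm
  have hKr : ∀ y ∈ 𝒜 c, y * r = 0 := fun y hy => by
    have h1 := hg (0, ⟨y, hy⟩)
    have h2 : y * g 1 = 0 := by
      rw [← hg1]
      simpa [f] using h1
    have h3 := gproj_mul_left hy 0 (g 1)
    rw [h2, map_zero] at h3
    exact h3.symm
  obtain ⟨n, y, hy, hyr⟩ := exists_pow_succ_mul_eq_pow (k := k) r
  have hr0 : r ∈ SetLike.GradeZero.subalgebra 𝒜 := gproj_mem 𝒜 0 _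
  have hy0 : y ∈ SetLike.GradeZero.subalgebra 𝒜 :=
    Algebra.adjoin_le (Set.singleton_subset_iff.2 hr0) hy
  have hcomm : Commute r y := by
    have := Algebra.adjoin_le_centralizer_centralizer k {r} hy
    exact (Subalgebra.mem_centralizer_iff k).1 this r
      ((Subalgebra.mem_centralizer_iff k).2 fun s hs => by rw [hs])
  have hstep : ∀ j, r ^ (n + 1) = r ^ (n + 1 + j) * y ^ j := fun j => by
    induction j with
    | zero => simp
    | succ j ih =>
      have h1 : r ^ (n + 1 + (j + 1)) * y = r ^ (n + 1 + j) := by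
        rw [show n + 1 + (j + 1) = (1 + j) + (n + 1) by ring, pow_add, mul_assoc, hyr, ← pow_add]
        congr 1; ring
      rw [pow_succ' y, ← mul_assoc, h1, ← ih]
  have hae : ∀ j, a * r ^ j = a := fun j => by
    induction j with
    | zero => simp
    | succ j ih => rw [pow_succ, ← mul_assoc, ih, har]
  have hay : a * y = a := by
    conv_rhs => rw [← hae n, ← hyr, ← mul_assoc, hae]
  have hay' : ∀ j, a * y ^ j = a := fun j => by
    induction j with
    | zero => simp
    | succ j ih => rw [pow_succ, ← mul_assoc, ih, hay]
  let e := r ^ (n + 1) * y ^ (n + 1)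
  have he : IsIdempotentElem e := by
    change r ^ (n + 1) * y ^ (n + 1) * (r ^ (n + 1) * y ^ (n + 1)) = _
    rw [mul_assoc, ← mul_assoc (y ^ (n + 1)), ((hcomm.pow_pow (n + 1) (n + 1)).eq).symm,
      mul_assoc, ← mul_assoc, ← mul_assoc, ← pow_add, ← hstep]
  have hae' : a * e = a := by
    change a * (r ^ (n + 1) * y ^ (n + 1)) = a
    rw [← mul_assoc, hae, hay']
  have he0 : e = 0 := by
    by_contra hne'
    have hmem : e ∈ SetLike.GradeZero.subalgebra 𝒜 := mul_mem (pow_mem hr0 _) (pow_mem hy0 _)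
    obtain ⟨x, hx, hxe⟩ := hwg e hmem he hne'
    refine hxe ?_
    change x * (r ^ (n + 1) * y ^ (n + 1)) = 0
    rw [pow_succ', mul_assoc, ← mul_assoc x, hKr x hx, zero_mul]
  exact hne (by rw [← hae', he0, mul_zero])

end GradedAlgebra

section DualPairing

variable {k : Type} [Field k] {A : Type} [Ring A] [Algebra k A]
variable (𝒜 : ℕ → Submodule k A) [GradedAlgebra 𝒜]

local notation "π" => GradedAlgebra.proj 𝒜

/-- The functionals supported on the component of degree `m`. -/
def dualPiece (m : ℕ) : Submodule k (Module.Dual k A) where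
  carrier := {φ | ∀ a, φ (π m a) = φ a}
  zero_mem' := fun a => rfl
  add_mem' := fun {φ ψ} hφ hψ a => by
    rw [LinearMap.add_apply, LinearMap.add_apply, hφ a, hψ a]
  smul_mem' := fun t φ hφ a => by rw [LinearMap.smul_apply, LinearMap.smul_apply, hφ a]

variable {𝒜}

theorem comp_gproj_mem_dualPiece (m : ℕ) (φ : Module.Dual k A) :
    φ.comp (π m) ∈ dualPiece 𝒜 m := fun a =>
  congrArg φ (gproj_of_mem (gproj_mem 𝒜 m a))

theorem dualPiece_apply_of_ne {m n : ℕ} {φ : Module.Dual k A} (hφ : φ ∈ dualPiece 𝒜 m) {a : A}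
    (ha : a ∈ 𝒜 n) (h : n ≠ m) : φ a = 0 := by
  rw [← hφ a, gproj_of_mem_ne ha h, map_zero]

theorem eq_zero_of_mem_dualPiece {c m : ℕ} (htop : ∀ n : ℕ, c < n → 𝒜 n = ⊥) (hm : c < m)
    {φ : Module.Dual k A} (hφ : φ ∈ dualPiece 𝒜 m) : φ = 0 := LinearMap.ext fun a => by
  have h := gproj_mem 𝒜 m a
  rw [htop m hm] at h
  rw [← hφ a, (Submodule.mem_bot k).1 h, map_zero, LinearMap.zero_apply]

theorem sum_comp_gproj {c : ℕ} (htop : ∀ n : ℕ, c < n → 𝒜 n = ⊥) (φ : Module.Dual k A) :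
    ∑ m ∈ Finset.range (c + 1), φ.comp (π m) = φ := LinearMap.ext fun a => by
  rw [LinearMap.sum_apply]
  simp only [LinearMap.comp_apply]
  rw [← map_sum, sum_gproj htop]

theorem smul_mem_dualPiece {m d : ℕ} {φ : Module.Dual k A} (hφ : φ ∈ dualPiece 𝒜 (m + d)) {a : A}
    (ha : a ∈ 𝒜 d) : a • φ ∈ dualPiece 𝒜 m := fun y => by
  rw [dual_smul_apply, dual_smul_apply, ← gproj_mul_right ha, hφ]

theorem op_smul_mem_dualPiece {m : ℕ} {φ : Module.Dual k A} (hφ : φ ∈ dualPiece 𝒜 m) {a : A}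
    (ha : a ∈ 𝒜 0) : op a • φ ∈ dualPiece 𝒜 m := fun y => by
  have h := gproj_mul_left ha m y
  rw [zero_add] at h
  rw [dual_op_smul_apply, dual_op_smul_apply, ← h, hφ]

variable (𝒜) in
/-- A linear map from the dual of `A` to `A` is homogeneous of top degree if it takes functionals
supported on degree `m` to elements of degree `c - m`. -/
def IsTopHomogeneous (c : ℕ) (h : Module.Dual k A →ₗ[A] A) : Prop :=
  ∀ m, ∀ φ ∈ dualPiece 𝒜 m, h φ ∈ 𝒜 (c - m)

/-- The component of top degree of a linear map. -/
noncomputable def topComponent {c : ℕ} (htop : ∀ n : ℕ, c < n → 𝒜 n = ⊥)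
    (h : Module.Dual k A →ₗ[A] A) :
    Module.Dual k A →ₗ[A] A where
  toFun φ := ∑ m ∈ Finset.range (c + 1), π (c - m) (h (φ.comp (π m)))
  map_add' φ ψ := by
    simp only [LinearMap.add_comp, map_add, Finset.sum_add_distrib]
  map_smul' a φ := by
    rw [RingHom.id_apply]
    induction a using BeiExt.induction_homogeneous 𝒜 with
    | add a b ha hb =>
      rw [add_smul, add_smul, ← ha, ← hb]
      simp only [LinearMap.add_comp, map_add, Finset.sum_add_distrib]
    | hom d a ha =>
      have hcomp : ∀ m, (a • φ).comp (π m) = a • φ.comp (π (m + d)) := fun m =>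
        LinearMap.ext fun y => by
          change φ (π m y * a) = φ (π (m + d) (y * a))
          rw [gproj_mul_right ha]
      rw [Finset.smul_sum]
      simp only [hcomp, map_smul, smul_eq_mul]
      have hlow : ∀ m, m < d → a * π (c - m) (h (φ.comp (π m))) = 0 := fun m hm => by
        rcases le_or_gt m c with hmc | hmc
        · exact mul_eq_zero_of_lt htop ha (gproj_mem 𝒜 _ _) (by omega)
        · rw [eq_zero_of_mem_dualPiece htop hmc (comp_gproj_mem_dualPiece m φ)]
          simp
      have hbig : ∀ m, c < m → a * π (c - m) (h (φ.comp (π m))) = 0 := fun m hm => by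
        rw [eq_zero_of_mem_dualPiece htop hm (comp_gproj_mem_dualPiece m φ)]
        simp
      have hshift : ∀ m, π (c - m) (a * h (φ.comp (π (m + d)))) =
          a * π (c - (m + d)) (h (φ.comp (π (m + d)))) := fun m => by
        rcases le_or_gt (m + d) c with hm | hm
        · rw [← gproj_mul_left ha, show d + (c - (m + d)) = c - m by omega]
        · rw [eq_zero_of_mem_dualPiece htop hm (comp_gproj_mem_dualPiece _ φ)]
          simp
      simp only [hshift]
      have h1 : ∑ m ∈ Finset.range (c + 1), a * π (c - m) (h (φ.comp (π m))) =
          ∑ m ∈ Finset.range (d + (c + 1)), a * π (c - m) (h (φ.comp (π m))) := by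
        refine Finset.sum_subset (Finset.range_subset_range.2 (by omega)) fun m _ hm => hbig m ?_
        rw [Finset.mem_range] at hm
        omega
      rw [h1, Finset.sum_range_add _ d (c + 1),
        Finset.sum_eq_zero fun m hm => hlow m (Finset.mem_range.1 hm),
        zero_add]
      exact Finset.sum_congr rfl fun m _ => by rw [add_comm d m]

theorem topComponent_apply {c : ℕ} (htop : ∀ n : ℕ, c < n → 𝒜 n = ⊥)
    (h : Module.Dual k A →ₗ[A] A) {m : ℕ} (hm : m ≤ c) {φ : Module.Dual k A}
    (hφ : φ ∈ dualPiece 𝒜 m) : topComponent htop h φ = π (c - m) (h φ) := by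
  change ∑ m ∈ Finset.range (c + 1), π (c - m) (h (φ.comp (π m))) = _
  rw [Finset.sum_eq_single m]
  · rw [show φ.comp (π m) = φ from LinearMap.ext hφ]
  · intro n _ hn
    have h0 : φ.comp (π n) = 0 := LinearMap.ext fun a =>
      dualPiece_apply_of_ne hφ (gproj_mem 𝒜 n a) hn
    rw [h0, map_zero, map_zero]
  · intro h
    rw [Finset.mem_range] at h
    omega

theorem isTopHomogeneous_topComponent {c : ℕ} (htop : ∀ n : ℕ, c < n → 𝒜 n = ⊥)
    (h : Module.Dual k A →ₗ[A] A) : IsTopHomogeneous 𝒜 c (topComponent htop h) := fun m φ hφ => by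
  rcases le_or_gt m c with hm | hm
  · rw [topComponent_apply htop h hm hφ]
    exact gproj_mem 𝒜 _ _
  · rw [eq_zero_of_mem_dualPiece htop hm hφ, map_zero]
    exact zero_mem _

/-- The dual of a right well-graded self-injective algebra is a generator, through homogeneous
elements and maps. -/
theorem exists_sum_apply_eq_one [FiniteDimensional k A] {c : ℕ}
    (htop : ∀ n : ℕ, c < n → 𝒜 n = ⊥) (hwg : RightWellGraded 𝒜 c)
    (hinj : Module.Injective A A) :
    ∃ (n : ℕ) (h : Fin n → Module.Dual k A →ₗ[A] A) (w : Fin n → Module.Dual k A),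
      (∀ i, IsTopHomogeneous 𝒜 c (h i)) ∧ (∀ i, w i ∈ dualPiece 𝒜 c) ∧ ∑ i, h i (w i) = 1 := by
  let β := Module.finBasis k (Module.Dual k A)
  let w : Fin (Module.finrank k (Module.Dual k A)) → Module.Dual k A := fun i => (β i).comp (π c)
  let f : A →ₗ[A] (Fin (Module.finrank k (Module.Dual k A)) → Module.Dual k A) :=
    LinearMap.pi fun i => LinearMap.toSpanSingleton A _ (w i)
  have hf : Function.Injective f := by
    rw [injective_iff_map_eq_zero]
    intro a ha
    have hall : ((Algebra.lsmul k k (Module.Dual k A) a).comp (π c).dualMap :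
        Module.Dual k A →ₗ[k] Module.Dual k A) = 0 := β.ext fun i => congrFun ha i
    by_contra hne
    obtain ⟨m, hm, hma⟩ := exists_gproj_ne_zero htop hne
    obtain ⟨x, hx, hxa⟩ := exists_mul_ne_zero htop hwg hinj hm (gproj_mem 𝒜 m a) hma
    rw [← gproj_mul_left hx, Nat.sub_add_cancel hm] at hxa
    refine hxa ((Module.forall_dual_apply_eq_zero_iff k _).1 fun φ => ?_)
    exact LinearMap.congr_fun (LinearMap.congr_fun hall φ) x
  obtain ⟨g, hg⟩ := hinj.out f hf LinearMap.id
  refine ⟨_,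
    fun i => topComponent htop (g.comp (LinearMap.single A (fun _ => Module.Dual k A) i)), w,
    fun i => isTopHomogeneous_topComponent htop _, fun i => comp_gproj_mem_dualPiece c _, ?_⟩
  have h1 : g (f 1) = 1 := hg 1
  have h2 : f 1 = ∑ i, LinearMap.single A (fun _ => Module.Dual k A) i (w i) := by
    have hw : f 1 = w := funext fun i => one_smul A (w i)
    rw [hw]
    exact (Finset.univ_sum_single w).symm
  have h3 : ∀ i, topComponent htop
      (g.comp (LinearMap.single A (fun _ => Module.Dual k A) i)) (w i) =
      π 0 (g (LinearMap.single A (fun _ => Module.Dual k A) i (w i))) := fun i => by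
    rw [topComponent_apply htop _ le_rfl (comp_gproj_mem_dualPiece c _), Nat.sub_self]
    rfl
  simp only [h3]
  rw [← map_sum, ← map_sum, ← h2, h1]
  exact gproj_of_mem (SetLike.one_mem_graded 𝒜)

end DualPairing

section DualBracket

variable {k : Type} [Field k] {A : Type} [Ring A] [Algebra k A]

/-- Precomposition of a linear map with the right action of `b`. -/
noncomputable def precompOp (b : A) (h : Module.Dual k A →ₗ[A] A) : Module.Dual k A →ₗ[A] A where
  toFun φ := h (op b • φ)
  map_add' φ ψ := by rw [smul_add, map_add]
  map_smul' a φ := by rw [← smul_comm a (op b) φ, map_smul, RingHom.id_apply]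

variable {𝒜 : ℕ → Submodule k A} [GradedAlgebra 𝒜] {c : ℕ}

local notation "π" => GradedAlgebra.proj 𝒜

theorem IsTopHomogeneous.precompOp {h : Module.Dual k A →ₗ[A] A} (hh : IsTopHomogeneous 𝒜 c h)
    {b : A} (hb : b ∈ 𝒜 0) : IsTopHomogeneous 𝒜 c (precompOp b h) := fun m _ hφ =>
  hh m _ (op_smul_mem_dualPiece hφ hb)

theorem smul_mem_dualPiece_of_mem_zero {m : ℕ} {φ : Module.Dual k A} (hφ : φ ∈ dualPiece 𝒜 m)
    {a : A} (ha : a ∈ 𝒜 0) : a • φ ∈ dualPiece 𝒜 m :=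
  smul_mem_dualPiece (d := 0) hφ ha

variable (𝒜) in
/-- The two-sided ideals of the component of degree zero, as subspaces. -/
structure IsZeroIdeal (I : Submodule k A) : Prop where
  le : I ≤ 𝒜 0
  mul_left : ∀ a ∈ I, ∀ b ∈ 𝒜 0, b * a ∈ I
  mul_right : ∀ a ∈ I, ∀ b ∈ 𝒜 0, a * b ∈ I

theorem isZeroIdeal_zero : IsZeroIdeal 𝒜 (𝒜 0) where
  le := le_rfl
  mul_left a ha b hb := by simpa using SetLike.mul_mem_graded hb ha
  mul_right a ha b hb := by simpa using SetLike.mul_mem_graded ha hb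

variable [FiniteDimensional k A]

theorem eq_of_forall_dual {a b : A} (h : ∀ φ : Module.Dual k A, φ a = φ b) : a = b :=
  (Module.evalEquiv k A).injective (LinearMap.ext h)

/-- The element of `A` through which `φ ↦ h φ • w` is right multiplication. -/
noncomputable def dualBracket (h : Module.Dual k A →ₗ[A] A) (w : Module.Dual k A) : A :=
  (Module.evalEquiv k A).symm (w.comp (h.restrictScalars k))

theorem apply_dualBracket (h : Module.Dual k A →ₗ[A] A) (w φ : Module.Dual k A) :
    φ (dualBracket h w) = w (h φ) :=
  Module.apply_evalEquiv_symm_apply k A φ (w.comp (h.restrictScalars k))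

theorem op_dualBracket_smul (h : Module.Dual k A →ₗ[A] A) (w φ : Module.Dual k A) :
    op (dualBracket h w) • φ = h φ • w := LinearMap.ext fun y => by
  rw [dual_op_smul_apply, dual_smul_apply, ← dual_smul_apply y φ, apply_dualBracket, map_smul,
    smul_eq_mul]

theorem dualBracket_smul (h : Module.Dual k A →ₗ[A] A) (t : k) (w : Module.Dual k A) :
    dualBracket h (t • w) = t • dualBracket h w :=
  map_smul (Module.evalEquiv k A).symm t (w.comp (h.restrictScalars k))

theorem dualBracket_mul (h : Module.Dual k A →ₗ[A] A) (w : Module.Dual k A) (b : A) :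
    dualBracket h w * b = dualBracket h (op b • w) := eq_of_forall_dual (k := k) fun φ => by
  rw [← dual_smul_apply, apply_dualBracket, apply_dualBracket, map_smul, smul_eq_mul,
    dual_op_smul_apply]

theorem mul_dualBracket (b : A) (h : Module.Dual k A →ₗ[A] A) (w : Module.Dual k A) :
    b * dualBracket h w = dualBracket (precompOp b h) w := eq_of_forall_dual (k := k) fun φ => by
  rw [← dual_op_smul_apply, apply_dualBracket, apply_dualBracket]
  rfl

theorem IsTopHomogeneous.dualBracket_mem (htop : ∀ n : ℕ, c < n → 𝒜 n = ⊥)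
    {h : Module.Dual k A →ₗ[A] A} (hh : IsTopHomogeneous 𝒜 c h) {m : ℕ} (hm : m ≤ c)
    {w : Module.Dual k A} (hw : w ∈ dualPiece 𝒜 m) : dualBracket h w ∈ 𝒜 (c - m) := by
  have key : π (c - m) (dualBracket h w) = dualBracket h w := eq_of_forall_dual (k := k) fun φ => by
    rw [← LinearMap.comp_apply, apply_dualBracket, apply_dualBracket]
    conv_rhs => rw [← sum_comp_gproj htop φ]
    rw [map_sum, map_sum, Finset.sum_eq_single (c - m)]
    · intro n hn hne
      rw [Finset.mem_range] at hn
      exact dualPiece_apply_of_ne hw (hh n _ (comp_gproj_mem_dualPiece n φ)) (by omega)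
    · intro hn
      rw [Finset.mem_range] at hn
      omega
  rw [← key]
  exact gproj_mem 𝒜 _ _

variable (𝒜 c) in
/-- The span of the elements `[h, a • w]` with `a` in `I`. -/
noncomputable def bracketSpan (I : Submodule k A) : Submodule k A :=
  Submodule.span k {z | ∃ h, IsTopHomogeneous 𝒜 c h ∧ ∃ w ∈ dualPiece 𝒜 c, ∃ a ∈ I,
    dualBracket h (a • w) = z}

variable (𝒜 c) in
/-- The span of the elements `h (w • a)` with `a` in `I`. -/
noncomputable def evalSpan (I : Submodule k A) : Submodule k A :=
  Submodule.span k {z | ∃ h, IsTopHomogeneous 𝒜 c h ∧ ∃ w ∈ dualPiece 𝒜 c, ∃ a ∈ I,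
    h (op a • w) = z}

theorem bracketSpan_mono {I J : Submodule k A} (h : I ≤ J) :
    bracketSpan 𝒜 c I ≤ bracketSpan 𝒜 c J :=
  Submodule.span_mono fun _ ⟨f, hf, w, hw, a, ha, hz⟩ => ⟨f, hf, w, hw, a, h ha, hz⟩

theorem IsZeroIdeal.bracketSpan (htop : ∀ n : ℕ, c < n → 𝒜 n = ⊥) {I : Submodule k A}
    (hI : IsZeroIdeal 𝒜 I) : IsZeroIdeal 𝒜 (bracketSpan 𝒜 c I) where
  le := Submodule.span_le.2 fun z ⟨h, hh, w, hw, a, ha, hz⟩ => by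
    have := hh.dualBracket_mem htop le_rfl (smul_mem_dualPiece_of_mem_zero hw (hI.le ha))
    rwa [hz, Nat.sub_self] at this
  mul_left z hz b hb := by
    refine ((Submodule.span_le (p := (_root_.bracketSpan 𝒜 c I).comap (LinearMap.mulLeft k b))).2
      ?_) hz
    rintro _ ⟨h, hh, w, hw, a, ha, rfl⟩
    exact Submodule.subset_span
      ⟨precompOp b h, hh.precompOp hb, w, hw, a, ha, (mul_dualBracket b h _).symm⟩
  mul_right z hz b hb := by
    refine ((Submodule.span_le (p := (_root_.bracketSpan 𝒜 c I).comap (LinearMap.mulRight k b))).2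
      ?_) hz
    rintro _ ⟨h, hh, w, hw, a, ha, rfl⟩
    refine Submodule.subset_span ⟨h, hh, op b • w, op_smul_mem_dualPiece hw hb, a, ha, ?_⟩
    rw [smul_comm]
    exact (dualBracket_mul h _ b).symm

theorem apply_op_dualBracket_smul (h h' : Module.Dual k A →ₗ[A] A) (a : A)
    (w w' : Module.Dual k A) : h' (op (dualBracket h (a • w)) • w') = h w' * a * h' w := by
  rw [op_dualBracket_smul, map_smul, map_smul, smul_eq_mul, smul_eq_mul, mul_assoc]

theorem evalSpan_bracketSpan (htop : ∀ n : ℕ, c < n → 𝒜 n = ⊥) (hwg : RightWellGraded 𝒜 c)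
    (hinj : Module.Injective A A) {I : Submodule k A} (hI : IsZeroIdeal 𝒜 I) :
    evalSpan 𝒜 c (bracketSpan 𝒜 c I) = I := by
  have hzero : ∀ {h : Module.Dual k A →ₗ[A] A} {w : Module.Dual k A}, IsTopHomogeneous 𝒜 c h →
      w ∈ dualPiece 𝒜 c → h w ∈ 𝒜 0 := fun hh hw => by
    have := hh c _ hw
    rwa [Nat.sub_self] at this
  apply le_antisymm
  · refine Submodule.span_le.2 ?_
    rintro _ ⟨h', hh', w', hw', z, hz, rfl⟩
    let p : A →ₗ[k] A :=
      { toFun := fun z => h' (op z • w')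
        map_add' := fun z z' => by rw [MulOpposite.op_add, add_smul, map_add]
        map_smul' := fun t z => by
          rw [MulOpposite.op_smul, smul_assoc, RingHom.id_apply]
          exact map_smul (h'.restrictScalars k) t _ }
    refine ((Submodule.span_le (p := I.comap p)).2 ?_) hz
    rintro _ ⟨h, hh, w, hw, a, ha, rfl⟩
    change h' (op (dualBracket h (a • w)) • w') ∈ I
    rw [apply_op_dualBracket_smul]
    exact hI.mul_right _ (hI.mul_left a ha _ (hzero hh hw')) _ (hzero hh' hw)
  · intro a ha
    obtain ⟨n, h, w, hh, hw, hsum⟩ := exists_sum_apply_eq_one htop hwg hinj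
    have hexp : a = ∑ i, ∑ j, h j (op (dualBracket (h i) (a • w j)) • w i) := by
      simp only [apply_op_dualBracket_smul]
      simp only [← Finset.mul_sum, hsum, mul_one, ← Finset.sum_mul, one_mul]
    rw [hexp]
    exact Submodule.sum_mem _ fun i _ => Submodule.sum_mem _ fun j _ => Submodule.subset_span
      ⟨h j, hh j, w i, hw i, _, Submodule.subset_span ⟨h i, hh i, w j, hw j, a, ha, rfl⟩, rfl⟩

theorem bracketSpan_iterate_injective (htop : ∀ n : ℕ, c < n → 𝒜 n = ⊥)
    (hwg : RightWellGraded 𝒜 c) (hinj : Module.Injective A A) (n : ℕ) {I J : Submodule k A}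
    (hI : IsZeroIdeal 𝒜 I) (hJ : IsZeroIdeal 𝒜 J)
    (h : (bracketSpan 𝒜 c)^[n] I = (bracketSpan 𝒜 c)^[n] J) : I = J := by
  induction n generalizing I J with
  | zero => exact h
  | succ n ih =>
    rw [← evalSpan_bracketSpan htop hwg hinj hI, ← evalSpan_bracketSpan htop hwg hinj hJ]
    exact congrArg _ (ih (hI.bracketSpan htop) (hJ.bracketSpan htop) h)

theorem bracketSpan_zero (htop : ∀ n : ℕ, c < n → 𝒜 n = ⊥)
    (hwg : RightWellGraded 𝒜 c) (hinj : Module.Injective A A) :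
    bracketSpan 𝒜 c (𝒜 0) = 𝒜 0 := by
  have hle := (isZeroIdeal_zero (𝒜 := 𝒜)).bracketSpan htop |>.le
  have hanti : Antitone fun n => (bracketSpan 𝒜 c)^[n] (𝒜 0) := antitone_nat_of_succ_le fun n => by
    induction n with
    | zero => exact hle
    | succ n ih =>
      rw [Function.iterate_succ_apply']
      conv_rhs => rw [Function.iterate_succ_apply']
      exact bracketSpan_mono ih
  obtain ⟨n, hn⟩ := IsArtinian.monotone_stabilizes
    (⟨fun n => OrderDual.toDual ((bracketSpan 𝒜 c)^[n] (𝒜 0)), fun _ _ h => hanti h⟩ :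
      ℕ →o (Submodule k A)ᵒᵈ)
  exact (bracketSpan_iterate_injective htop hwg hinj n isZeroIdeal_zero
    (isZeroIdeal_zero.bracketSpan htop) (hn (n + 1) n.le_succ)).symm

/-- The dual of a right well-graded self-injective algebra is projective, with a homogeneous dual
basis concentrated in top degree. -/
theorem exists_sum_smul_eq_self (htop : ∀ n : ℕ, c < n → 𝒜 n = ⊥)
    (hwg : RightWellGraded 𝒜 c) (hinj : Module.Injective A A) :
    ∃ (n : ℕ) (h : Fin n → Module.Dual k A →ₗ[A] A) (w : Fin n → Module.Dual k A),
      (∀ i, IsTopHomogeneous 𝒜 c (h i)) ∧ (∀ i, w i ∈ dualPiece 𝒜 c) ∧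
        ∀ φ, ∑ i, h i φ • w i = φ := by
  have hone : (1 : A) ∈ bracketSpan 𝒜 c (𝒜 0) := by
    rw [bracketSpan_zero htop hwg hinj]
    exact SetLike.one_mem_graded 𝒜
  obtain ⟨n, t, g, hg⟩ := Submodule.mem_span_set'.1 hone
  choose h hh w hw a ha hz using fun i => (g i).2
  refine ⟨n, h, fun i => t i • (a i • w i), hh,
    fun i => Submodule.smul_mem _ _ (smul_mem_dualPiece_of_mem_zero (hw i) (ha i)), fun φ => ?_⟩
  simp only [← op_dualBracket_smul, dualBracket_smul, hz]
  rw [← Finset.sum_smul, ← Finset.op_sum, hg, MulOpposite.op_one, one_smul]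

end DualBracket

section BeiTopDual

variable {k : Type} [Field k] {A : Type} [Ring A] [Algebra k A]
variable {𝒜 : ℕ → Submodule k A} {c : ℕ}

theorem coe_sum_beiTop {ι : Type} (s : Finset ι) (x : ι → ↥(beiTop k A 𝒜 c)) (p q : Fin c) :
    (∑ i ∈ s, x i).1 p q = ∑ i ∈ s, (x i).1 p q := by
  rw [AddSubmonoidClass.coe_finsetSum, Matrix.sum_apply]

variable [GradedAlgebra 𝒜]

local notation "π" => GradedAlgebra.proj 𝒜

variable (𝒜) in
/-- The matrix in `beiTop` with the component of `a` of the relevant degree as its only nonzero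
entry. -/
def beiTopSingle (i j : Fin c) : A →ₗ[k] ↥(beiTop k A 𝒜 c) where
  toFun a := ⟨Matrix.single i j (π (c + j - i) a), fun p q => by
    by_cases h : i = p ∧ j = q
    · obtain ⟨rfl, rfl⟩ := h
      rw [Matrix.single_apply_same]
      exact gproj_mem 𝒜 _ a
    · rw [Matrix.single_apply, if_neg h]
      exact zero_mem _⟩
  map_add' a b := Subtype.ext
    ((congrArg (Matrix.single i j) (map_add _ a b)).trans (Matrix.single_add i j _ _))
  map_smul' t a := Subtype.ext
    ((congrArg (Matrix.single i j) (map_smul _ t a)).trans (Matrix.smul_single t i j _).symm)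

theorem beiTopSingle_apply (i j p q : Fin c) (a : A) :
    (beiTopSingle 𝒜 i j a).1 p q = if i = p ∧ j = q then π (c + j - i) a else 0 :=
  Matrix.single_apply i j _ p q

theorem sum_beiTopSingle (x : ↥(beiTop k A 𝒜 c)) :
    ∑ i, ∑ j, beiTopSingle 𝒜 i j (x.1 i j) = x := Subtype.ext (Matrix.ext fun p q => by
  simp only [coe_sum_beiTop, beiTopSingle_apply, ite_and]
  rw [Finset.sum_eq_single p (fun i _ h => by simp [h]) (by simp),
    Finset.sum_eq_single q (fun j _ h => by simp [h]) (by simp), if_pos rfl, if_pos rfl]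
  exact gproj_of_mem (x.2 p q))

theorem op_smul_beiTopSingle (b : ↥(bei k A 𝒜 c)) (i j : Fin c) (a : A) :
    op b • beiTopSingle 𝒜 i j a = ∑ l, beiTopSingle 𝒜 i l (a * b.1 j l) :=
  Subtype.ext (Matrix.ext fun p q => by
    rw [coe_bei_op_smul, Matrix.mul_apply, coe_sum_beiTop]
    simp only [beiTopSingle_apply, ite_and]
    rw [Finset.sum_eq_single j (fun l _ h => by simp [h.symm]) (by simp),
      Finset.sum_eq_single q (fun l _ h => by simp [h]) (by simp), if_pos rfl, if_pos rfl]
    by_cases hip : i = p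
    · rw [if_pos hip, if_pos hip]
      rcases le_or_gt (j : ℕ) (q : ℕ) with h | h
      · rw [← gproj_mul_right ((b.2 j q).1 h), show c + (j : ℕ) - i + (q - j) = c + q - i by omega]
      · rw [(b.2 j q).2 h, mul_zero, mul_zero, map_zero]
    · rw [if_neg hip, if_neg hip, zero_mul])

theorem smul_beiTopSingle (b : ↥(bei k A 𝒜 c)) (i j : Fin c) (a : A) :
    b • beiTopSingle 𝒜 i j a = ∑ l, beiTopSingle 𝒜 l j (b.1 l i * a) :=
  Subtype.ext (Matrix.ext fun p q => by
    rw [coe_bei_smul, Matrix.mul_apply, coe_sum_beiTop]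
    simp only [beiTopSingle_apply, ite_and]
    rw [Finset.sum_eq_single i (fun l _ h => by simp [h.symm]) (by simp),
      Finset.sum_eq_single p (fun l _ h => by simp [h]) (by simp), if_pos rfl, if_pos rfl]
    by_cases hjq : j = q
    · rw [if_pos hjq, if_pos hjq]
      rcases le_or_gt (p : ℕ) (i : ℕ) with h | h
      · rw [← gproj_mul_left ((b.2 p i).1 h), show (i : ℕ) - p + (c + j - i) = c + j - p by omega]
      · rw [(b.2 p i).2 h, zero_mul, zero_mul, map_zero]
    · rw [if_neg hjq, if_neg hjq, mul_zero])

/-- The `(i, j)` component of a functional on `beiTop`. -/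
def dualEntry (u : DualBi k ↥(beiTop k A 𝒜 c)) (i j : Fin c) : Module.Dual k A where
  toFun a := u (beiTopSingle 𝒜 i j a)
  map_add' a b := by rw [map_add, map_add]
  map_smul' t a := by rw [map_smul, map_smul, RingHom.id_apply]

theorem dualEntry_apply (u : DualBi k ↥(beiTop k A 𝒜 c)) (i j : Fin c) (a : A) :
    dualEntry u i j a = u (beiTopSingle 𝒜 i j a) := rfl

theorem dualEntry_mem (u : DualBi k ↥(beiTop k A 𝒜 c)) (i j : Fin c) :
    dualEntry u i j ∈ dualPiece 𝒜 (c + j - i) := fun a => by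
  rw [dualEntry_apply, dualEntry_apply]
  refine congrArg u (Subtype.ext ?_)
  change Matrix.single i j (π (c + j - i) (π (c + j - i) a)) = Matrix.single i j (π (c + j - i) a)
  rw [gproj_of_mem (gproj_mem 𝒜 _ a)]

theorem dualEntry_eq_zero (htop : ∀ n : ℕ, c < n → 𝒜 n = ⊥) (u : DualBi k ↥(beiTop k A 𝒜 c))
    {i j : Fin c} (h : (i : ℕ) < j) : dualEntry u i j = 0 :=
  eq_zero_of_mem_dualPiece htop (by omega) (dualEntry_mem u i j)

theorem dualEntry_ext {u v : DualBi k ↥(beiTop k A 𝒜 c)}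
    (h : ∀ i j, dualEntry u i j = dualEntry v i j) : u = v := DualBi.ext fun x => by
  rw [← sum_beiTopSingle x]
  simp only [map_sum]
  exact Finset.sum_congr rfl fun i _ => Finset.sum_congr rfl fun j _ =>
    LinearMap.congr_fun (h i j) _

theorem dualEntry_add (u v : DualBi k ↥(beiTop k A 𝒜 c)) (i j : Fin c) :
    dualEntry (u + v) i j = dualEntry u i j + dualEntry v i j := rfl

theorem dualEntry_sum {ι : Type} (s : Finset ι) (u : ι → DualBi k ↥(beiTop k A 𝒜 c))
    (i j : Fin c) : dualEntry (∑ t ∈ s, u t) i j = ∑ t ∈ s, dualEntry (u t) i j :=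
  LinearMap.ext fun a => by
    rw [dualEntry_apply, DualBi.sum_apply, LinearMap.sum_apply]
    rfl

theorem dualEntry_smul (b : ↥(bei k A 𝒜 c)) (u : DualBi k ↥(beiTop k A 𝒜 c)) (i j : Fin c) :
    dualEntry (b • u) i j = ∑ l, b.1 j l • dualEntry u i l := LinearMap.ext fun a => by
  rw [dualEntry_apply, DualBi.smul_apply, op_smul_beiTopSingle, map_sum, LinearMap.sum_apply]
  rfl

theorem dualEntry_op_smul (b : ↥(bei k A 𝒜 c)) (u : DualBi k ↥(beiTop k A 𝒜 c)) (i j : Fin c) :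
    dualEntry (op b • u) i j = ∑ l, op (b.1 l i) • dualEntry u l j := LinearMap.ext fun a => by
  rw [dualEntry_apply, DualBi.op_smul_apply, smul_beiTopSingle, map_sum, LinearMap.sum_apply]
  rfl

/-- Entrywise application of a map of top degree. -/
noncomputable def beiTopMap (htop : ∀ n : ℕ, c < n → 𝒜 n = ⊥) {h : Module.Dual k A →ₗ[A] A}
    (hh : IsTopHomogeneous 𝒜 c h) :
    CoindHom ↥(bei k A 𝒜 c) (DualBi k ↥(beiTop k A 𝒜 c)) ↥(bei k A 𝒜 c) :=
  ({ toFun := fun u => ⟨Matrix.of fun j i => h (dualEntry u i j), fun j i =>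
      ⟨fun hji => by
        have := hh _ _ (dualEntry_mem u i j)
        rwa [show c - (c + (j : ℕ) - i) = i - j by omega] at this,
      fun hij => by rw [Matrix.of_apply, dualEntry_eq_zero htop u hij, map_zero]⟩⟩
     map_add' := fun u v => Subtype.ext (Matrix.ext fun j i => by
      change h (dualEntry (u + v) i j) = h (dualEntry u i j) + h (dualEntry v i j)
      rw [dualEntry_add, map_add])
     map_smul' := fun b u => Subtype.ext (Matrix.ext fun j i => by
      change h (dualEntry (b • u) i j) = ∑ l, b.1 j l * h (dualEntry u i l)
      rw [dualEntry_smul, map_sum]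
      exact Finset.sum_congr rfl fun l _ => map_smul h _ _) } :
    DualBi k ↥(beiTop k A 𝒜 c) →ₗ[↥(bei k A 𝒜 c)] ↥(bei k A 𝒜 c))

theorem beiTopMap_apply (htop : ∀ n : ℕ, c < n → 𝒜 n = ⊥) {h : Module.Dual k A →ₗ[A] A}
    (hh : IsTopHomogeneous 𝒜 c h) (u : DualBi k ↥(beiTop k A 𝒜 c)) (i j : Fin c) :
    (beiTopMap htop hh u).1 j i = h (dualEntry u i j) := rfl

variable (𝒜 c) in
/-- The composite of a functional with the trace. -/
def traceDual (w : Module.Dual k A) : DualBi k ↥(beiTop k A 𝒜 c) :=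
  ({ toFun := fun x => ∑ i, w (x.1 i i)
     map_add' := fun x y => by
      rw [← Finset.sum_add_distrib]
      exact Finset.sum_congr rfl fun i _ => map_add w _ _
     map_smul' := fun t x => by
      rw [Finset.smul_sum]
      exact Finset.sum_congr rfl fun i _ => map_smul w _ _ } : Module.Dual k ↥(beiTop k A 𝒜 c))

theorem dualEntry_traceDual {w : Module.Dual k A} (hw : w ∈ dualPiece 𝒜 c) (i j : Fin c) :
    dualEntry (traceDual 𝒜 c w) i j = if i = j then w else 0 := LinearMap.ext fun a => by
  change ∑ p, w ((beiTopSingle 𝒜 i j a).1 p p) = _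
  simp only [beiTopSingle_apply, ite_and]
  rw [Finset.sum_eq_single i (fun p _ h => by simp [h.symm]) (by simp), if_pos rfl]
  by_cases h : i = j
  · subst h
    rw [if_pos rfl, if_pos rfl, Nat.add_sub_cancel]
    exact hw a
  · rw [if_neg (Ne.symm h), if_neg h, map_zero, LinearMap.zero_apply]

theorem smul_traceDual (b : ↥(bei k A 𝒜 c)) {w : Module.Dual k A} (hw : w ∈ dualPiece 𝒜 c)
    (i j : Fin c) : dualEntry (b • traceDual 𝒜 c w) i j = b.1 j i • w := by
  rw [dualEntry_smul, Finset.sum_eq_single i, dualEntry_traceDual hw, if_pos rfl]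
  · intro l _ hl
    rw [dualEntry_traceDual hw, if_neg hl.symm, smul_zero]
  · simp

variable [FiniteDimensional k A]

/-- The matrix of brackets of a map of top degree with the entries of a functional. -/
noncomputable def bracketMatrix (htop : ∀ n : ℕ, c < n → 𝒜 n = ⊥) {h : Module.Dual k A →ₗ[A] A}
    (hh : IsTopHomogeneous 𝒜 c h) (v : DualBi k ↥(beiTop k A 𝒜 c)) : ↥(bei k A 𝒜 c) :=
  ⟨Matrix.of fun l p => dualBracket h (dualEntry v p l), fun l p =>
    ⟨fun hlp => by
      have := hh.dualBracket_mem htop (by omega) (dualEntry_mem v p l)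
      rwa [show c - (c + (l : ℕ) - p) = p - l by omega] at this,
    fun hpl => by
      rw [Matrix.of_apply, dualEntry_eq_zero htop v hpl]
      exact map_zero (Module.evalEquiv k A).symm⟩⟩

theorem beiTopMap_smul (htop : ∀ n : ℕ, c < n → 𝒜 n = ⊥) {h : Module.Dual k A →ₗ[A] A}
    (hh : IsTopHomogeneous 𝒜 c h) (u v : DualBi k ↥(beiTop k A 𝒜 c)) :
    beiTopMap htop hh u • v = op (bracketMatrix htop hh v) • u := dualEntry_ext fun i j => by
  rw [dualEntry_smul, dualEntry_op_smul]
  exact Finset.sum_congr rfl fun l _ => (op_dualBracket_smul h _ _).symm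

theorem eq_zero_of_forall_mul_eq_zero (htop : ∀ n : ℕ, c < n → 𝒜 n = ⊥)
    (hwg : RightWellGraded 𝒜 c) (hinj : Module.Injective A A) {m : ℕ} {a : A} (ha : a ∈ 𝒜 m)
    (h : ∀ y ∈ 𝒜 (c - m), a * y = 0) : a = 0 := eq_of_forall_dual (k := k) fun φ => by
  obtain ⟨n, f, w, hf, hw, hsum⟩ := exists_sum_smul_eq_self htop hwg hinj
  have h1 : φ a = (φ.comp (π m)) a := by rw [LinearMap.comp_apply, gproj_of_mem ha]
  rw [map_zero, h1, ← hsum (φ.comp (π m)), LinearMap.sum_apply]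
  refine Finset.sum_eq_zero fun i _ => ?_
  rw [dual_smul_apply, h _ (hf i m _ (comp_gproj_mem_dualPiece m φ)), map_zero]

/-- Over a right well-graded self-injective algebra the dual of `beiTop` is invertible. -/
theorem invertibleDual_beiTop (htop : ∀ n : ℕ, c < n → 𝒜 n = ⊥) (hwg : RightWellGraded 𝒜 c)
    (hinj : Module.Injective A A) : InvertibleDual k ↥(bei k A 𝒜 c) ↥(beiTop k A 𝒜 c) := by
  obtain ⟨n, h, w, hh, hw, hsum⟩ := exists_sum_smul_eq_self htop hwg hinj
  have hbasis : ∀ u : DualBi k ↥(beiTop k A 𝒜 c),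
      ∑ t, beiTopMap htop (hh t) u • traceDual 𝒜 c (w t) = u := fun u =>
    dualEntry_ext fun i j => by
      rw [dualEntry_sum]
      simp only [smul_traceDual _ (hw _)]
      exact hsum _
  refine ⟨?_, ⟨n, fun t => beiTopMap htop (hh t), fun t => traceDual 𝒜 c (w t), hbasis⟩, ?_, ?_⟩
  · obtain ⟨n, h, w, hh, hw, hsum⟩ := exists_sum_apply_eq_one htop hwg hinj
    refine ⟨n, fun t => beiTopMap htop (hh t), fun t => traceDual 𝒜 c (w t),
      Subtype.ext (Matrix.ext fun j i => ?_)⟩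
    rw [AddSubmonoidClass.coe_finsetSum, Matrix.sum_apply]
    simp only [beiTopMap_apply, dualEntry_traceDual (hw _)]
    change _ = (1 : Matrix (Fin c) (Fin c) A) j i
    rw [Matrix.one_apply]
    by_cases hij : i = j
    · simp only [if_pos hij, if_pos hij.symm, hsum]
    · simp only [if_neg hij, if_neg (Ne.symm hij), map_zero, Finset.sum_const_zero]
  · intro f v
    refine ⟨∑ t, bracketMatrix htop (hh t) (f (traceDual 𝒜 c (w t)) • v), fun u => ?_⟩
    conv_lhs => rw [← hbasis u]
    rw [map_sum, Finset.sum_smul, Finset.op_sum, Finset.sum_smul]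
    refine Finset.sum_congr rfl fun t _ => ?_
    rw [map_smul f, smul_eq_mul, mul_smul, beiTopMap_smul]
  · intro b hb
    have hzero : ∀ x : ↥(beiTop k A 𝒜 c), b • x = 0 := fun x =>
      DualBi.eval_injective (k := k) fun u => by
        rw [map_zero, ← DualBi.op_smul_apply, hb]
        rfl
    refine Subtype.ext (Matrix.ext fun i j => ?_)
    rcases le_or_gt (i : ℕ) (j : ℕ) with hij | hij
    · refine eq_zero_of_forall_mul_eq_zero htop hwg hinj ((b.2 i j).1 hij) fun y hy => ?_
      rw [show c - ((j : ℕ) - i) = c + i - j by omega] at hy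
      have h1 := congrFun (congrFun (congrArg Subtype.val (hzero (beiTopSingle 𝒜 j i y))) i) i
      rw [coe_bei_smul, Matrix.mul_apply, Finset.sum_eq_single j
        (fun l _ hl => by rw [beiTopSingle_apply, if_neg (fun h => hl h.1.symm), mul_zero])
        (by simp), beiTopSingle_apply, if_pos ⟨rfl, rfl⟩, gproj_of_mem hy] at h1
      exact h1
    · exact (b.2 i j).2 hij

end BeiTopDual

theorem wellGraded_selfInjective_graded_modules_equiv_trivExt_beilinson
    (k : Type) [Field k] (A : Type) [Ring A] [Algebra k A] [FiniteDimensional k A]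
    (𝒜 : ℕ → Submodule k A) [GradedAlgebra 𝒜]
    (c : ℕ) (hc : 1 ≤ c) (hcne : 𝒜 c ≠ ⊥) (htop : ∀ n : ℕ, c < n → 𝒜 n = ⊥)
    (hwg : LeftWellGraded 𝒜 c ∧ RightWellGraded 𝒜 c)
    (hinj : Module.Injective A A) :
    Nonempty ((GrMod k A 𝒜) ≌
      GrMod k (TBei k A 𝒜 c)
        (tszGrading k ↥(bei k A 𝒜 c) (Module.Dual k ↥(bei k A 𝒜 c)))) := by
  obtain ⟨e⟩ := (invertibleDual_beiTop htop hwg.2 hinj).nonempty_equiv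
  exact ⟨(GrMod.equivBeiExt k A 𝒜 hc htop).trans <| (GrMod.equivGSeq k _ _).trans <|
    e.trans (GrMod.equivGSeq k _ _).symm⟩
end

section
/- Let A = ⊕_{n≥0} A_n be a graded self-injective positively graded finite-dimensional k-algebra with c ≥ 1. If A is left well-graded, then A is right well-graded (hence well-graded). -/
/-- A non-nilpotent element `b` of a finite-dimensional algebra has a nonzero idempotent
polynomial multiple `p(b) * b`. -/
theorem exists_aeval_mul_self_isIdempotentElem {k A : Type*} [Field k] [Ring A] [Algebra k A]
    [FiniteDimensional k A] {b : A} (hb : ¬ IsNilpotent b) :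
    ∃ p : Polynomial k, IsIdempotentElem (Polynomial.aeval b p * b) ∧
      Polynomial.aeval b p * b ≠ 0 := by
  have hne : minpoly k b ≠ 0 := minpoly.ne_zero (Algebra.IsIntegral.isIntegral b)
  obtain ⟨q, hq, hndvd⟩ := Polynomial.exists_eq_pow_rootMultiplicity_mul_and_not_dvd _ hne 0
  generalize (minpoly k b).rootMultiplicity 0 = n at hq
  rw [map_zero, sub_zero] at hq hndvd
  have hcop : IsCoprime ((Polynomial.X : Polynomial k) ^ (n + 1)) q :=
    ((Polynomial.irreducible_X.coprime_iff_not_dvd).2 hndvd).pow_left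
  obtain ⟨u, v, huv⟩ := hcop
  have hzero : Polynomial.aeval b (Polynomial.X ^ n * q) = 0 := hq ▸ minpoly.aeval k b
  have hval : Polynomial.aeval b (u * Polynomial.X ^ n) * b =
      Polynomial.aeval b (u * Polynomial.X ^ (n + 1)) := by
    rw [pow_succ, ← mul_assoc, map_mul _ _ Polynomial.X, Polynomial.aeval_X]
  refine ⟨u * Polynomial.X ^ n, ?_, ?_⟩
  · rw [hval, IsIdempotentElem, ← map_mul, ← sub_eq_zero, ← map_sub]
    have : u * Polynomial.X ^ (n + 1) * (u * Polynomial.X ^ (n + 1)) - u * Polynomial.X ^ (n + 1)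
        = -(u * Polynomial.X * v) * (Polynomial.X ^ n * q) := by
      linear_combination (u * Polynomial.X ^ (n + 1)) * huv
    rw [this, map_mul, hzero, mul_zero]
  · rw [hval]
    intro h
    refine hb ⟨n, ?_⟩
    have : (Polynomial.X : Polynomial k) ^ n =
        Polynomial.X ^ n * (u * Polynomial.X ^ (n + 1)) + v * (Polynomial.X ^ n * q) := by
      linear_combination -(Polynomial.X ^ n) * huv
    rw [← Polynomial.aeval_X_pow (R := k) b, this, map_add, map_mul, map_mul _ v, h, hzero,
      mul_zero, mul_zero, add_zero]

section Graded

variable {k A : Type*} [Field k] [Ring A] [Algebra k A] (𝒜 : ℕ → Submodule k A)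
  [GradedAlgebra 𝒜]

/-- Multiplication by an element with no degree-zero part has no nonzero fixed point. -/
theorem eq_zero_of_mul_eq_self_of_projZero_eq_zero {y s : A}
    (hy : GradedRing.projZeroRingHom 𝒜 y = 0) (hs : y * s = s) : s = 0 := by
  classical
  have hy0 : (DirectSum.decompose 𝒜 y 0 : A) = 0 := hy
  have key : ∀ i, (DirectSum.decompose 𝒜 s i : A) = 0 := by
    intro i
    induction i using Nat.strong_induction_on with
    | _ i ih =>
      rw [← hs, DirectSum.decompose_mul, DirectSum.coe_mul_apply]
      refine Finset.sum_eq_zero fun ij hij => ?_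
      have hsum := (Finset.mem_filter.1 hij).2
      rcases Nat.eq_zero_or_pos ij.1 with h0 | hpos
      · rw [h0, hy0, zero_mul]
      · rw [ih ij.2 (by omega), mul_zero]
  rw [← DirectSum.sum_support_decompose 𝒜 s]
  exact Finset.sum_eq_zero fun i _ => key i

variable {𝒜}

theorem mul_mem_top_degree {c : ℕ} (htop : ∀ n : ℕ, c < n → 𝒜 n = ⊥) {z : A}
    (hz : z ∈ 𝒜 c) (y : A) : z * y ∈ 𝒜 c := by
  induction y using DirectSum.Decomposition.inductionOn 𝒜 with
  | zero => simp
  | @homogeneous i m =>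
    have h := SetLike.mul_mem_graded hz m.2
    rcases Nat.eq_zero_or_pos i with rfl | hpos
    · simpa using h
    · rw [htop _ (by omega), Submodule.mem_bot] at h
      rw [h]
      exact zero_mem _
  | add m m' h h' => rw [mul_add]; exact add_mem h h'

theorem projZero_mul_top_degree {c : ℕ} (htop : ∀ n : ℕ, c < n → 𝒜 n = ⊥) {w : A}
    (hw : w ∈ 𝒜 c) (b : A) :
    GradedRing.projZeroRingHom 𝒜 b * w = b * w := by
  induction b using DirectSum.Decomposition.inductionOn 𝒜 with
  | zero => simp
  | @homogeneous i m =>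
    rcases Nat.eq_zero_or_pos i with rfl | hpos
    · rw [GradedRing.projZeroRingHom_apply, DirectSum.decompose_of_mem_same 𝒜 m.2]
    · have h := SetLike.mul_mem_graded m.2 hw
      rw [htop _ (by omega), Submodule.mem_bot] at h
      rw [h, GradedRing.projZeroRingHom_apply,
        DirectSum.decompose_of_mem_ne 𝒜 m.2 (by omega), zero_mul]
  | add m m' h h' => rw [map_add, add_mul, add_mul, h, h']

end Graded

/-- If `A` is left self-injective and `x` is killed by the common left annihilator of finitely
many elements `z i`, then `x` lies in the right ideal generated by the `z i`. -/
theorem exists_eq_sum_mul_of_injective {A : Type} [Ring A] (hinj : Module.Injective A A)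
    {ι : Type} [Fintype ι] (z : ι → A) (x : A)
    (h : ∀ b : A, (∀ i, b * z i = 0) → b * x = 0) : ∃ y : ι → A, x = ∑ i, z i * y i := by
  classical
  let φ : A →ₗ[A] (ι → A) := LinearMap.toSpanSingleton A _ z
  let ψ : A →ₗ[A] A := LinearMap.toSpanSingleton A _ x
  have hle : LinearMap.ker φ ≤ LinearMap.ker ψ := fun b hb => h b fun i => congrFun hb i
  obtain ⟨g, hg⟩ := hinj.out ((LinearMap.ker φ).liftQ φ le_rfl)
    (LinearMap.ker_eq_bot.1 (Submodule.ker_liftQ_eq_bot _ _ _ le_rfl))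
    ((LinearMap.ker φ).liftQ ψ hle)
  have hgz : g z = x := by simpa [φ, ψ] using hg (Submodule.Quotient.mk 1)
  exact ⟨fun i => g (Pi.single i 1), by
    rw [← hgz, LinearMap.pi_apply_eq_sum_univ g z]
    refine Finset.sum_congr rfl fun i _ => ?_
    rw [smul_eq_mul]
    congr 2
    ext j
    simp [Pi.single_apply, eq_comm]⟩

/-- In a left well-graded algebra, no left multiplication by an element annihilating the top
degree has a nonzero fixed point. -/
theorem LeftWellGraded.eq_zero_of_mul_eq_self {k A : Type} [Field k] [Ring A] [Algebra k A]
    [FiniteDimensional k A] {𝒜 : ℕ → Submodule k A} [GradedAlgebra 𝒜] {c : ℕ}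
    (htop : ∀ n : ℕ, c < n → 𝒜 n = ⊥) (hlwg : LeftWellGraded 𝒜 c) {b s : A}
    (hb : ∀ w ∈ 𝒜 c, b * w = 0) (hs : b * s = s) : s = 0 := by
  set b₀ := GradedRing.projZeroRingHom 𝒜 b with hb₀
  have hnil : IsNilpotent b₀ := by
    by_contra hnot
    obtain ⟨p, hidem, hne⟩ := exists_aeval_mul_self_isIdempotentElem (k := k) hnot
    have hmem : b₀ ∈ 𝒜 0 := SetLike.coe_mem _
    have hp : Polynomial.aeval b₀ p ∈ SetLike.GradeZero.subalgebra 𝒜 :=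
      Algebra.adjoin_le (Set.singleton_subset_iff.2 hmem)
        (Polynomial.aeval_mem_adjoin_singleton k b₀)
    obtain ⟨w, hw, hw0⟩ := hlwg _ (Subalgebra.mul_mem _ hp hmem) hidem hne
    rw [mul_assoc, projZero_mul_top_degree htop hw, hb w hw, mul_zero] at hw0
    exact hw0 rfl
  obtain ⟨n, hn⟩ := hnil
  refine eq_zero_of_mul_eq_self_of_projZero_eq_zero 𝒜 (y := b ^ n) (by rw [map_pow, ← hb₀, hn]) ?_
  clear hn
  induction n with
  | zero => simp
  | succ n ih => rw [pow_succ, mul_assoc, hs, ih]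

theorem left_wellGraded_implies_right_wellGraded
    (k : Type) [Field k] (A : Type) [Ring A] [Algebra k A] [FiniteDimensional k A]
    (𝒜 : ℕ → Submodule k A) [GradedAlgebra 𝒜]
    (c : ℕ) (hc : 1 ≤ c) (hcne : 𝒜 c ≠ ⊥) (htop : ∀ n : ℕ, c < n → 𝒜 n = ⊥)
    (hinj : Module.Injective A A)
    (hlwg : LeftWellGraded 𝒜 c) :
    RightWellGraded 𝒜 c := by
  intro e _ hidem hne
  have : IsArtinianRing A := IsArtinianRing.of_finite k A
  obtain ⟨S, hS, hSe⟩ := (eq_bot_or_exists_atom_le (Submodule.span A {e})).resolve_left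
    (by simpa using hne)
  obtain ⟨s, hsS, hs0⟩ := S.ne_bot_iff.1 hS.1
  have hse : s * e = s := by
    obtain ⟨a, rfl⟩ := Submodule.mem_span_singleton.1 (hSe hsS)
    rw [smul_eq_mul, mul_assoc, hidem.eq]
  have hann : ∀ b : A, (∀ w ∈ 𝒜 c, b * w = 0) → b * s = 0 := by
    intro b hb
    by_contra hbs
    have hle : Submodule.span A {b * s} ≤ S :=
      (Submodule.span_singleton_le_iff_mem _ _).2 (S.smul_mem b hsS)
    have heq := (hS.le_iff.1 hle).resolve_left (by simpa using hbs)
    rw [← heq] at hsS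
    obtain ⟨a, ha⟩ := Submodule.mem_span_singleton.1 hsS
    refine hs0 (hlwg.eq_zero_of_mul_eq_self htop (b := a * b) (fun w hw => ?_) ?_)
    · rw [mul_assoc, hb w hw, mul_zero]
    · rw [mul_assoc, ← smul_eq_mul a, ha]
  let B := Module.finBasis k (𝒜 c)
  obtain ⟨y, hy⟩ := exists_eq_sum_mul_of_injective hinj (fun i => (B i : A)) s (by
    refine fun b hb => hann b fun w hw => ?_
    have hspan : 𝒜 c ≤ LinearMap.ker (LinearMap.mulLeft k b) := by
      rw [← Submodule.map_subtype_top (𝒜 c), ← B.span_eq, Submodule.map_span, Submodule.span_le]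
      rintro _ ⟨_, ⟨i, rfl⟩, rfl⟩
      exact hb i
    exact hspan hw)
  refine ⟨s, ?_, by rwa [hse]⟩
  rw [hy]
  exact sum_mem fun i _ => mul_mem_top_degree htop (B i).2 (y i)
end
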